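/- Let X be a projective variety over an algebraically closed field k, φ: X → X a dominant morphism, and L a line bundle on X such that φ*(L) ⊗ L^{−1} is ample. Then the set of periodic points of φ in X(k) is Zariski dense in X. -/

import Mathlib

open AlgebraicGeometry CategoryTheory CategoryTheory.Limits Opposite

noncomputable section

universe u

/-- Restriction of sections of the structure sheaf, as a ring homomorphism. -/
def sres (X : Scheme.{u}) {V W : X.Opens} (h : V ≤ W) : Γ(X, W) →+* Γ(X, V) :=
  (X.presheaf.map (homOfLE h).op : Γ(X, W) ⟶ Γ(X, V)).hom

lemma sres_sres (X : Scheme.{u}) {V W T : X.Opens} (h₁ : V ≤ W) (h₂ : W ≤ T) (a : Γ(X, T)) :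
    sres X h₁ (sres X h₂ a) = sres X (h₁.trans h₂) a := by
  have : (homOfLE (h₁.trans h₂)).op = (homOfLE h₂).op ≫ (homOfLE h₁).op := rfl
  simp only [sres, this, Functor.map_comp]
  rfl

/-- A line bundle (invertible sheaf) on a scheme `X`, presented by an open cover and a
Čech `1`-cocycle of transition units. -/
structure LineBundle (X : Scheme.{u}) where
  ι : Type u
  U : ι → X.Opens
  covers : iSup U = ⊤
  t : ∀ i j, (Γ(X, U i ⊓ U j))ˣ
  cocycle : ∀ i j l,
    Units.map (sres X (show U i ⊓ U j ⊓ U l ≤ U i ⊓ U j from inf_le_left)).toMonoidHom (t i j)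
      * Units.map (sres X (show U i ⊓ U j ⊓ U l ≤ U j ⊓ U l from
          le_inf (inf_le_left.trans inf_le_right) inf_le_right)).toMonoidHom (t j l)
    = Units.map (sres X (show U i ⊓ U j ⊓ U l ≤ U i ⊓ U l from
          le_inf (inf_le_left.trans inf_le_left) inf_le_right)).toMonoidHom (t i l)

namespace LineBundle

variable {X Y : Scheme.{u}}

/-- The `n`-th tensor power of a line bundle. -/
def pow (L : LineBundle X) (n : ℕ) : LineBundle X where
  ι := L.ι
  U := L.U
  covers := L.covers
  t i j := L.t i j ^ n
  cocycle i j l := by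
    simp only [map_pow, ← mul_pow, L.cocycle i j l]

/-- The dual (inverse) of a line bundle. -/
def dual (L : LineBundle X) : LineBundle X where
  ι := L.ι
  U := L.U
  covers := L.covers
  t i j := (L.t i j)⁻¹
  cocycle i j l := by
    simp only [map_inv, ← mul_inv, L.cocycle i j l]

/-- The trivial line bundle. -/
def trivial (X : Scheme.{u}) : LineBundle X where
  ι := PUnit
  U _ := ⊤
  covers := by simp
  t _ _ := 1
  cocycle _ _ _ := by simp

lemma unit_sres_sres (X : Scheme.{u}) {V W T : X.Opens} (h₁ : V ≤ W) (h₂ : W ≤ T)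
    (u : (Γ(X, T))ˣ) :
    Units.map (sres X h₁).toMonoidHom (Units.map (sres X h₂).toMonoidHom u)
      = Units.map (sres X (h₁.trans h₂)).toMonoidHom u := by
  ext
  exact sres_sres X h₁ h₂ u

/-- The tensor product of two line bundles. -/
def tensor (L M : LineBundle X) : LineBundle X where
  ι := L.ι × M.ι
  U p := L.U p.1 ⊓ M.U p.2
  covers := by
    apply le_antisymm le_top
    have h : (⊤ : X.Opens) = (⨆ i, L.U i) ⊓ ⨆ j, M.U j := by
      rw [L.covers, M.covers, top_inf_eq]
    rw [h, iSup_inf_eq]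
    refine iSup_le fun i => ?_
    rw [inf_iSup_eq]
    exact iSup_le fun j => le_iSup_of_le (i, j) le_rfl
  t p q :=
    Units.map (sres X (show (L.U p.1 ⊓ M.U p.2) ⊓ (L.U q.1 ⊓ M.U q.2) ≤ L.U p.1 ⊓ L.U q.1 from
        le_inf (inf_le_left.trans inf_le_left) (inf_le_right.trans inf_le_left))).toMonoidHom
      (L.t p.1 q.1) *
    Units.map (sres X (show (L.U p.1 ⊓ M.U p.2) ⊓ (L.U q.1 ⊓ M.U q.2) ≤ M.U p.2 ⊓ M.U q.2 from
        le_inf (inf_le_left.trans inf_le_right) (inf_le_right.trans inf_le_right))).toMonoidHom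
      (M.t p.2 q.2)
  cocycle p q r := by
    simp only [map_mul, unit_sres_sres]
    have hL := congrArg (Units.map (sres X (show
        (L.U p.1 ⊓ M.U p.2) ⊓ (L.U q.1 ⊓ M.U q.2) ⊓ (L.U r.1 ⊓ M.U r.2) ≤
          L.U p.1 ⊓ L.U q.1 ⊓ L.U r.1 from
        le_inf (le_inf (inf_le_left.trans (inf_le_left.trans inf_le_left))
          (inf_le_left.trans (inf_le_right.trans inf_le_left)))
          (inf_le_right.trans inf_le_left))).toMonoidHom) (L.cocycle p.1 q.1 r.1)
    have hM := congrArg (Units.map (sres X (show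
        (L.U p.1 ⊓ M.U p.2) ⊓ (L.U q.1 ⊓ M.U q.2) ⊓ (L.U r.1 ⊓ M.U r.2) ≤
          M.U p.2 ⊓ M.U q.2 ⊓ M.U r.2 from
        le_inf (le_inf (inf_le_left.trans (inf_le_left.trans inf_le_right))
          (inf_le_left.trans (inf_le_right.trans inf_le_right)))
          (inf_le_right.trans inf_le_right))).toMonoidHom) (M.cocycle p.2 q.2 r.2)
    simp only [map_mul, unit_sres_sres] at hL hM
    rw [mul_mul_mul_comm, hL, hM]

lemma preimage_mono (f : X ⟶ Y) {U U' : Y.Opens} (h : U ≤ U') : f ⁻¹ᵁ U ≤ f ⁻¹ᵁ U' :=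
  fun _ hx => h hx

lemma unit_sres_appLE (f : X ⟶ Y) {U : Y.Opens} {V V' : X.Opens} (e : V ≤ f ⁻¹ᵁ U)
    (h : V' ≤ V) (u : (Γ(Y, U))ˣ) :
    Units.map (sres X h).toMonoidHom (Units.map (f.appLE U V e).hom.toMonoidHom u)
      = Units.map (f.appLE U V' (h.trans e)).hom.toMonoidHom u := by
  ext
  show sres X h (f.appLE U V e u) = f.appLE U V' (h.trans e) u
  rw [show f.appLE U V' (h.trans e)
      = f.appLE U V e ≫ X.presheaf.map (homOfLE h).op from (f.appLE_map e (homOfLE h).op).symm]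
  rfl

lemma unit_appLE_sres (f : X ⟶ Y) {U U' : Y.Opens} {V : X.Opens} (e : V ≤ f ⁻¹ᵁ U)
    (h : U ≤ U') (u : (Γ(Y, U'))ˣ) :
    Units.map (f.appLE U V e).hom.toMonoidHom (Units.map (sres Y h).toMonoidHom u)
      = Units.map (f.appLE U' V (e.trans (preimage_mono f h))).hom.toMonoidHom u := by
  ext
  show f.appLE U V e (sres Y h u) = f.appLE U' V _ u
  rw [show f.appLE U' V (e.trans (preimage_mono f h))
      = Y.presheaf.map (homOfLE h).op ≫ f.appLE U V e from (f.map_appLE e (homOfLE h).op).symm]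
  rfl

lemma preimage_inf (f : X ⟶ Y) (U V : Y.Opens) :
    f ⁻¹ᵁ (U ⊓ V) = f ⁻¹ᵁ U ⊓ f ⁻¹ᵁ V := by
  ext x; simp

set_option maxHeartbeats 1000000 in
/-- The pullback of a line bundle along a morphism of schemes. -/
def pullbackLB (f : X ⟶ Y) (L : LineBundle Y) : LineBundle X where
  ι := L.ι
  U i := f ⁻¹ᵁ L.U i
  covers := by
    have : (⨆ i, f ⁻¹ᵁ L.U i) = f ⁻¹ᵁ (⨆ i, L.U i) := by
      ext x
      simp [TopologicalSpace.Opens.mem_iSup]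
    rw [this, L.covers]
    rfl
  t i j :=
    Units.map (f.appLE (L.U i ⊓ L.U j) (f ⁻¹ᵁ L.U i ⊓ f ⁻¹ᵁ L.U j)
      (preimage_inf f (L.U i) (L.U j)).ge).hom.toMonoidHom (L.t i j)
  cocycle i j l := by
    have key := congrArg (Units.map (f.appLE (L.U i ⊓ L.U j ⊓ L.U l)
        (f ⁻¹ᵁ L.U i ⊓ f ⁻¹ᵁ L.U j ⊓ f ⁻¹ᵁ L.U l)
        (le_of_eq (show f ⁻¹ᵁ L.U i ⊓ f ⁻¹ᵁ L.U j ⊓ f ⁻¹ᵁ L.U l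
            = f ⁻¹ᵁ (L.U i ⊓ L.U j ⊓ L.U l) by
          rw [preimage_inf, preimage_inf]))).hom.toMonoidHom)
      (L.cocycle i j l)
    rw [map_mul] at key
    rw [unit_sres_appLE, unit_sres_appLE, unit_sres_appLE]
    rw [unit_appLE_sres, unit_appLE_sres, unit_appLE_sres] at key
    exact key

/-- A global section of a line bundle: compatible local sections with respect to the
transition cocycle. -/
@[ext]
structure GlobalSec {X : Scheme.{u}} (L : LineBundle X) where
  s : ∀ i, Γ(X, L.U i)
  compat : ∀ i j, sres X (inf_le_left : L.U i ⊓ L.U j ≤ L.U i) (s i)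
    = (L.t i j : Γ(X, L.U i ⊓ L.U j)) * sres X inf_le_right (s j)

/-- The open locus where a global section of a line bundle does not vanish. -/
def GlobalSec.locus {X : Scheme.{u}} {L : LineBundle X} (σ : GlobalSec L) : X.Opens :=
  ⨆ i, X.basicOpen (σ.s i)

/-- A line bundle `L` on a scheme `X` is ample if `X` is quasi-compact and every point has
an affine neighbourhood of the form `X_s` for a global section `s` of some positive tensor
power of `L`. -/
def IsAmple {X : Scheme.{u}} (L : LineBundle X) : Prop :=
  CompactSpace X ∧ ∀ x : X, ∃ (m : ℕ) (_ : 0 < m) (σ : GlobalSec (L.pow m)),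
    x ∈ σ.locus ∧ IsAffineOpen σ.locus

/-- Two line bundles are isomorphic iff on a common refinement of their trivialising covers
their transition cocycles differ by a coboundary. -/
def EquivLB {X : Scheme.{u}} (L M : LineBundle X) : Prop :=
  ∃ (κ : Type u) (V : κ → X.Opens) (_ : iSup V = ⊤) (a : κ → L.ι) (b : κ → M.ι)
    (ha : ∀ c, V c ≤ L.U (a c)) (hb : ∀ c, V c ≤ M.U (b c)) (s : ∀ c, (Γ(X, V c))ˣ),
    ∀ c c' : κ,
      Units.map (sres X (le_inf ((inf_le_left.trans (ha c)))
          (inf_le_right.trans (ha c')) : V c ⊓ V c' ≤ L.U (a c) ⊓ L.U (a c'))).toMonoidHom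
          (L.t (a c) (a c'))
        * Units.map (sres X (inf_le_right : V c ⊓ V c' ≤ V c')).toMonoidHom (s c')
      = Units.map (sres X (inf_le_left : V c ⊓ V c' ≤ V c)).toMonoidHom (s c)
        * Units.map (sres X (le_inf ((inf_le_left.trans (hb c)))
            (inf_le_right.trans (hb c')))).toMonoidHom (M.t (b c) (b c'))

/-- The canonical algebra map `k → Γ(X, U)` for a scheme `X` over `Spec k`. -/
def toSections {k : Type u} [Field k] {X : Scheme.{u}} (sX : X ⟶ Spec (CommRingCat.of k))
    (U : X.Opens) : k →+* Γ(X, U) :=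
  ((sres X (le_top : U ≤ ⊤)).comp
    ((sX.appTop.hom : Γ(Spec (CommRingCat.of k), ⊤) →+* Γ(X, ⊤)))).comp
    ((Scheme.ΓSpecIso (CommRingCat.of k)).inv : CommRingCat.of k ⟶ _).hom

lemma sres_toSections {k : Type u} [Field k] {X : Scheme.{u}}
    (sX : X ⟶ Spec (CommRingCat.of k)) {V U : X.Opens} (h : V ≤ U) (c : k) :
    sres X h (toSections sX U c) = toSections sX V c := by
  simp only [toSections, RingHom.comp_apply, sres_sres]

/-- The space of global sections of a line bundle on a scheme over `k`, as a `k`-submodule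
of the product of the local section spaces. -/
def secSubmodule {k : Type u} [Field k] {X : Scheme.{u}} (sX : X ⟶ Spec (CommRingCat.of k))
    (L : LineBundle X) :
    letI : ∀ i, Module k Γ(X, L.U i) := fun i => (toSections sX (L.U i)).toModule
    Submodule k (∀ i, Γ(X, L.U i)) :=
  letI : ∀ i, Module k Γ(X, L.U i) := fun i => (toSections sX (L.U i)).toModule
  { carrier := {s | ∀ i j, sres X (inf_le_left : L.U i ⊓ L.U j ≤ L.U i) (s i)
      = (L.t i j : Γ(X, L.U i ⊓ L.U j)) * sres X inf_le_right (s j)}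
    add_mem' := by
      intro s r hs hr i j
      simp only [Pi.add_apply, map_add, hs i j, hr i j, mul_add]
    zero_mem' := by
      intro i j
      simp
    smul_mem' := by
      intro c s hs i j
      show sres X _ (toSections sX (L.U i) c * s i)
        = (L.t i j : Γ(X, L.U i ⊓ L.U j)) * sres X _ (toSections sX (L.U j) c * s j)
      rw [map_mul, map_mul, hs i j, sres_toSections, sres_toSections]
      ring }

/-- The dimension `h⁰(X, L)` of the space of global sections of a line bundle on a scheme
over a field `k`. -/
def h0 {k : Type u} [Field k] {X : Scheme.{u}} (sX : X ⟶ Spec (CommRingCat.of k))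
    (L : LineBundle X) : ℕ :=
  letI : ∀ i, Module k Γ(X, L.U i) := fun i => (toSections sX (L.U i)).toModule
  Module.finrank k (secSubmodule sX L)

lemma sres_appLE (f : X ⟶ Y) {U : Y.Opens} {V V' : X.Opens} (e : V ≤ f ⁻¹ᵁ U)
    (h : V' ≤ V) (a : Γ(Y, U)) :
    sres X h (f.appLE U V e a) = f.appLE U V' (h.trans e) a := by
  rw [show f.appLE U V' (h.trans e)
      = f.appLE U V e ≫ X.presheaf.map (homOfLE h).op from (f.appLE_map e (homOfLE h).op).symm]
  rfl

lemma appLE_sres (f : X ⟶ Y) {U U' : Y.Opens} {V : X.Opens} (e : V ≤ f ⁻¹ᵁ U)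
    (h : U ≤ U') (a : Γ(Y, U')) :
    f.appLE U V e (sres Y h a) = f.appLE U' V (e.trans (preimage_mono f h)) a := by
  rw [show f.appLE U' V (e.trans (preimage_mono f h))
      = Y.presheaf.map (homOfLE h).op ≫ f.appLE U V e from (f.map_appLE e (homOfLE h).op).symm]
  rfl

/-- Pullback of global sections of a line bundle. -/
def pullbackSec (f : X ⟶ Y) (L : LineBundle Y) (σ : GlobalSec L) :
    GlobalSec (pullbackLB f L) where
  s i := f.app (L.U i) (σ.s i)
  compat i j := by
    have key := congrArg (f.appLE (L.U i ⊓ L.U j)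
      (f ⁻¹ᵁ L.U i ⊓ f ⁻¹ᵁ L.U j) (preimage_inf f (L.U i) (L.U j)).ge) (σ.compat i j)
    rw [map_mul, appLE_sres, appLE_sres] at key
    exact key

end LineBundle

attribute [local instance] MvPolynomial.gradedAlgebra

/-- Projective `N`-space over `k`, as the `Proj` of the polynomial ring in `N + 1`
variables with its standard grading. -/
def ProjSpace (k : Type u) [Field k] (N : ℕ) : Scheme.{u} :=
  Proj (MvPolynomial.homogeneousSubmodule (Fin (N + 1)) k)

/-- The inclusion of `k` into the degree-zero part of the polynomial ring. -/
def degreeZeroInclusion (k : Type u) [Field k] (N : ℕ) :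
    k →+* (MvPolynomial.homogeneousSubmodule (Fin (N + 1)) k 0) where
  toFun c := ⟨MvPolynomial.C c, by
    simp [MvPolynomial.mem_homogeneousSubmodule, MvPolynomial.isHomogeneous_C]⟩
  map_one' := by ext; simp
  map_mul' x y := by ext; simp
  map_zero' := by ext; simp
  map_add' x y := by ext; simp

/-- The structure morphism of projective space over `k`. -/
def ProjSpace.str (k : Type u) [Field k] (N : ℕ) :
    ProjSpace k N ⟶ Spec (CommRingCat.of k) :=
  Proj.toSpecZero _ ≫ Spec.map (CommRingCat.ofHom (degreeZeroInclusion k N))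

/-- A scheme over `k` is a projective variety if it is integral and admits a closed
immersion into some projective space over `k`, compatibly with the structure morphisms. -/
def IsProjectiveVariety {k : Type u} [Field k] {X : Scheme.{u}}
    (sX : X ⟶ Spec (CommRingCat.of k)) : Prop :=
  IsIntegral X ∧ ∃ (N : ℕ) (ι : X ⟶ ProjSpace k N),
    IsClosedImmersion ι ∧ ι ≫ ProjSpace.str k N = sX

/-- The `n`-th iterate of a self-morphism of a scheme. -/
def morphIter {X : Scheme.{u}} (φ : X ⟶ X) : ℕ → (X ⟶ X) :=
  Nat.rec (𝟙 X) (fun _ g => g ≫ φ)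

section TraceLemmas

variable {F V : Type*} [Field F] [AddCommGroup V] [Module F V]

open Classical in
/-- The trace of the restriction of `f` to `S` (zero if `S` is not stable under `f`). -/
def trOn (f : Module.End F V) (S : Submodule F V) : F :=
  if h : ∀ x ∈ S, f x ∈ S then LinearMap.trace F S (f.restrict h) else 0

theorem trOn_of_mapsTo {f : Module.End F V} {S : Submodule F V} (h : ∀ x ∈ S, f x ∈ S) :
    trOn f S = LinearMap.trace F S (f.restrict h) := dif_pos h

theorem trOn_mul_comm (a b : Module.End F V) (S₁ S₂ : Submodule F V)
    [FiniteDimensional F S₁] [FiniteDimensional F S₂]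
    (hb : ∀ x ∈ S₁, b x ∈ S₂) (ha : ∀ x ∈ S₂, a x ∈ S₁) :
    trOn (a * b) S₁ = trOn (b * a) S₂ := by
  rw [trOn_of_mapsTo (f := a * b) (fun x hx => ha _ (hb x hx)),
    trOn_of_mapsTo (f := b * a) (fun x hx => hb _ (ha x hx))]
  exact LinearMap.trace_comp_comm' (b.restrict hb) (a.restrict ha)

theorem trOn_eq_of_le {f : Module.End F V} {S₁ S₂ : Submodule F V}
    [FiniteDimensional F S₁] [FiniteDimensional F S₂] (h : S₁ ≤ S₂)
    (hf : ∀ x ∈ S₂, f x ∈ S₁) : trOn f S₁ = trOn f S₂ := by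
  simpa using trOn_mul_comm f 1 S₁ S₂ (fun x hx => h hx) hf

theorem trOn_add {f g : Module.End F V} {S : Submodule F V}
    (hf : ∀ x ∈ S, f x ∈ S) (hg : ∀ x ∈ S, g x ∈ S) :
    trOn (f + g) S = trOn f S + trOn g S := by
  rw [trOn_of_mapsTo hf, trOn_of_mapsTo hg,
    trOn_of_mapsTo (f := f + g) (fun x hx => S.add_mem (hf x hx) (hg x hx)), ← map_add]
  rfl

theorem trOn_zero (S : Submodule F V) : trOn (0 : Module.End F V) S = 0 := by
  rw [trOn_of_mapsTo (fun x _ => S.zero_mem)]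
  have : LinearMap.restrict (0 : Module.End F V) (fun x (_ : x ∈ S) => S.zero_mem) = 0 := rfl
  rw [this, map_zero]

theorem trOn_neg (f : Module.End F V) (S : Submodule F V) : trOn (-f) S = -trOn f S := by
  unfold trOn
  have : (∀ x ∈ S, (-f) x ∈ S) ↔ (∀ x ∈ S, f x ∈ S) :=
    forall₂_congr fun x hx => by simp
  by_cases hf : ∀ x ∈ S, f x ∈ S
  · rw [dif_pos hf, dif_pos (this.2 hf), ← map_neg]
    rfl
  · rw [dif_neg hf, dif_neg (fun h' => hf (this.1 h')), neg_zero]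

end TraceLemmas

section FiniteTransitive

variable {F : Type*} [Field F] [Finite F]

/-- A subring of endomorphisms which is a division ring acting transitively contains an element
of nonzero trace. -/
theorem exists_trace_ne_zero_of_divisionRing {W : Type*} [AddCommGroup W] [Module F W]
    [FiniteDimensional F W] (E : Subalgebra F (Module.End F W))
    (hinj : ∀ e ∈ E, e ≠ 0 → Function.Injective e) {u : W} (hu : u ≠ 0)
    (htr : ∀ v : W, ∃ e ∈ E, e u = v) : ∃ e ∈ E, LinearMap.trace F W e ≠ 0 := by
  have : Finite (Module.End F W) := Module.finite_of_finite F
  have : Nontrivial W := ⟨u, 0, hu⟩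
  have : IsDomain E := by
    have : NoZeroDivisors E := ⟨by
      rintro ⟨a, ha⟩ ⟨b, hb⟩ hab
      by_cases h : a = 0
      · left; ext1; exact h
      · right
        ext1
        apply LinearMap.ext
        intro x
        apply hinj a ha h
        have := congrArg Subtype.val hab
        simpa using LinearMap.congr_fun this x⟩
    exact NoZeroDivisors.to_isDomain E
  let : Field E := (Finite.isDomain_to_isField E).toField
  have : Module.Finite F E := Module.Finite.of_finite
  obtain ⟨e, he⟩ : ∃ e : E, Algebra.trace F E e ≠ 0 := by
    by_contra! h
    exact Algebra.trace_ne_zero F E (LinearMap.ext h)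
  refine ⟨e, e.2, ?_⟩
  let ev : E →ₗ[F] W :=
    { toFun := fun a => (a : Module.End F W) u
      map_add' := fun _ _ => rfl
      map_smul' := fun _ _ => rfl }
  have hev : Function.Bijective ev := by
    refine ⟨?_, fun v => ?_⟩
    · rw [injective_iff_map_eq_zero]
      intro a ha
      by_contra hne
      apply hu
      apply hinj a a.2 (fun h => hne (Subtype.ext h))
      rw [map_zero]; exact ha
    · obtain ⟨a, ha, h⟩ := htr v
      exact ⟨⟨a, ha⟩, h⟩
  let ε : E ≃ₗ[F] W := LinearEquiv.ofBijective ev hev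
  have : (e : Module.End F W) = ε.conj (LinearMap.mulLeft F e) := by
    apply LinearMap.ext
    intro x
    obtain ⟨y, rfl⟩ := ε.surjective x
    rw [LinearEquiv.conj_apply_apply, LinearEquiv.symm_apply_apply]
    rfl
  rw [this, LinearMap.trace_conj']
  exact he

/-- A multiplicatively closed set of endomorphisms acting transitively enough contains an element
of nonzero trace. -/
theorem exists_trace_ne_zero {V : Type*} [AddCommGroup V] [Module F V] [FiniteDimensional F V]
    (S : Set (Module.End F V)) (hS : ∀ a ∈ S, ∀ b ∈ S, a * b ∈ S) {w : V} (hw : w ≠ 0)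
    (h : ∀ f : V, f ≠ 0 → ∃ t ∈ S, t f = w ∧
      ∀ v, t v ∈ Submodule.span F ((fun s : Module.End F V => s w) '' S)) :
    ∃ t ∈ S, LinearMap.trace F V t ≠ 0 := by
  classical
  by_contra! htr
  set V₁ := Submodule.span F ((fun s : Module.End F V => s w) '' S) with hV₁
  set A := Submodule.span F S with hA
  have hAtr : ∀ a ∈ A, LinearMap.trace F V a = 0 := fun a ha => by
    have : A ≤ LinearMap.ker (LinearMap.trace F V) := Submodule.span_le.2 htr
    exact this ha
  have hAmul : ∀ a ∈ A, ∀ b ∈ A, a * b ∈ A := by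
    intro a ha b hb
    have : A * A ≤ A := by
      rw [hA, Submodule.span_mul_span]
      apply Submodule.span_mono
      rintro _ ⟨x, hx, y, hy, rfl⟩
      exact hS x hx y hy
    exact this (Submodule.mul_mem_mul ha hb)
  have hV₁A : ∀ v ∈ V₁, ∃ a ∈ A, a w = v := by
    intro v hv
    have : V₁ ≤ A.map (LinearMap.applyₗ w) := by
      rw [hV₁, Submodule.span_le]
      rintro _ ⟨s, hs, rfl⟩
      exact ⟨s, Submodule.subset_span hs, rfl⟩
    obtain ⟨a, ha, h⟩ := this hv
    exact ⟨a, ha, h⟩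
  have hAV₁ : ∀ a ∈ A, a w ∈ V₁ := by
    intro a ha
    have : A ≤ V₁.comap (LinearMap.applyₗ w) := by
      rw [hA, Submodule.span_le]
      intro s hs
      exact Submodule.subset_span ⟨s, hs, rfl⟩
    exact this ha
  have hAV₁' : ∀ a ∈ A, ∀ v ∈ V₁, a v ∈ V₁ := by
    intro a ha v hv
    obtain ⟨b, hb, rfl⟩ := hV₁A v hv
    exact hAV₁ _ (hAmul a ha b hb)
  let J : Set (Module.End F V) := {t | t ∈ A ∧ ∀ v, t v ∈ V₁}
  have hJtrans : ∀ f, f ≠ 0 → ∀ v ∈ V₁, ∃ t ∈ J, t f = v := by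
    intro f hf v hv
    obtain ⟨t, ht, htf, htV⟩ := h f hf
    obtain ⟨a, ha, rfl⟩ := hV₁A v hv
    refine ⟨a * t, ⟨hAmul _ ha _ (Submodule.subset_span ht), fun v => hAV₁' a ha _ (htV v)⟩, ?_⟩
    change a (t f) = _
    rw [htf]
  have hwV₁ : w ∈ V₁ := by
    obtain ⟨t, ht, htw, htV⟩ := h w hw
    rw [← htw]
    exact htV w
  have hJmul : ∀ a ∈ J, ∀ b ∈ J, a * b ∈ J := fun a ha b hb =>
    ⟨hAmul _ ha.1 _ hb.1, fun v => ha.2 _⟩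
  -- an element of minimal rank
  let P : ℕ → Prop := fun n => ∃ t ∈ J, V₁.map t ≠ ⊥ ∧ Module.finrank F (V₁.map t) = n
  have hP : ∃ n, P n := by
    obtain ⟨t, ht, htw⟩ := hJtrans w hw w hwV₁
    refine ⟨_, t, ht, ?_, rfl⟩
    intro hbot
    apply hw
    have : t w ∈ V₁.map t := ⟨w, hwV₁, rfl⟩
    rw [hbot, htw] at this
    exact this
  obtain ⟨t, ht, htne, htr'⟩ := Nat.find_spec hP
  have hmin : ∀ t' ∈ J, V₁.map t' ≠ ⊥ → Nat.find hP ≤ Module.finrank F (V₁.map t') :=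
    fun t' h1 h2 => Nat.find_min' hP ⟨t', h1, h2, rfl⟩
  set W := V₁.map t with hW
  have hWV₁ : W ≤ V₁ := by
    rintro _ ⟨v, _, rfl⟩
    exact ht.2 v
  have hta : ∀ a ∈ J, ∀ v, (t * a) v ∈ W := fun a ha v => ⟨a v, ha.2 v, rfl⟩
  obtain ⟨u, huW, hu⟩ := Submodule.exists_mem_ne_zero_of_ne_bot htne
  have hJadd : ∀ a ∈ J, ∀ b ∈ J, a + b ∈ J := fun a ha b hb =>
    ⟨A.add_mem ha.1 hb.1, fun v => V₁.add_mem (ha.2 v) (hb.2 v)⟩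
  have hJsmul : ∀ c : F, ∀ a ∈ J, c • a ∈ J := fun c a ha =>
    ⟨A.smul_mem c ha.1, fun v => V₁.smul_mem c (ha.2 v)⟩
  have hJ0 : (0 : Module.End F V) ∈ J := ⟨A.zero_mem, fun v => V₁.zero_mem⟩
  let res : ∀ a ∈ J, Module.End F W := fun a ha => (t * a).restrict (fun v _ => hta a ha v)
  let E0 : Set (Module.End F W) := {e | ∃ a, ∃ ha : a ∈ J, res a ha = e}
  have hE0mul : ∀ a ∈ E0, ∀ b ∈ E0, a * b ∈ E0 := by
    rintro _ ⟨a, ha, rfl⟩ _ ⟨b, hb, rfl⟩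
    exact ⟨a * (t * b), hJmul _ ha _ (hJmul _ ht _ hb), rfl⟩
  have hinj : ∀ e ∈ E0, e ≠ 0 → Function.Injective e := by
    rintro _ ⟨a, ha, rfl⟩ hne
    have h1 : V₁.map (t * a * t) ≠ ⊥ := by
      intro hbot
      apply hne
      apply LinearMap.ext
      rintro ⟨_, v, hv, rfl⟩
      have : (t * a * t) v ∈ V₁.map (t * a * t) := ⟨v, hv, rfl⟩
      rw [hbot] at this
      ext1
      exact this
    have h2 := hmin _ (hJmul _ (hJmul _ ht _ ha) _ ht) h1
    have h3 : V₁.map (t * a * t) = W.map (t * a) := by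
      rw [hW, ← Submodule.map_comp]; rfl
    have h4 : LinearMap.range (res a ha) = ⊤ := by
      apply Submodule.eq_top_of_finrank_eq
      apply le_antisymm (Submodule.finrank_le _)
      rw [htr']
      refine h2.trans (le_of_eq ?_)
      rw [h3]
      have h5 : (LinearMap.range (res a ha)).map W.subtype = W.map (t * a) := by
        ext x
        constructor
        · rintro ⟨_, ⟨y, rfl⟩, rfl⟩
          exact ⟨y, y.2, rfl⟩
        · rintro ⟨y, hy, rfl⟩
          exact ⟨_, ⟨⟨y, hy⟩, rfl⟩, rfl⟩
      rw [← h5]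
      exact Submodule.finrank_map_subtype_eq W _
    exact LinearMap.injective_iff_surjective.2 (LinearMap.range_eq_top.1 h4)
  have htrans : ∀ v : W, ∃ e ∈ E0, e ⟨u, huW⟩ = v := by
    rintro ⟨_, v, hv, rfl⟩
    obtain ⟨a, ha, hau⟩ := hJtrans u hu v hv
    refine ⟨_, ⟨a, ha, rfl⟩, ?_⟩
    ext1
    change t (a u) = t v
    rw [hau]
  have hone : (1 : Module.End F W) ∈ E0 := by
    have : Finite (Module.End F W) := Module.finite_of_finite F
    obtain ⟨e, he, heu⟩ := htrans ⟨u, huW⟩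
    have hu' : (⟨u, huW⟩ : W) ≠ 0 := fun h => hu (congrArg Subtype.val h)
    have hne : e ≠ 0 := by
      rintro rfl
      exact hu' heu.symm
    have hunit : IsUnit e := (LinearMap.isUnit_iff_ker_eq_bot e).2
      (LinearMap.ker_eq_bot.2 (hinj e he hne))
    obtain ⟨n, hn, hn1⟩ : ∃ n, 0 < n ∧ e ^ n = 1 := by
      have : Finite (Module.End F W)ˣ := inferInstance
      refine ⟨orderOf hunit.unit, orderOf_pos _, ?_⟩
      have := congrArg Units.val (pow_orderOf_eq_one hunit.unit)
      rwa [Units.val_pow_eq_pow_val, IsUnit.unit_spec, Units.val_one] at this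
    have hpow : ∀ n, 0 < n → e ^ n ∈ E0 := by
      intro n hn
      induction n, hn using Nat.le_induction with
      | base => simpa using he
      | succ k _ ih => rw [pow_succ]; exact hE0mul _ ih _ he
    rw [← hn1]
    exact hpow n hn
  let E : Subalgebra F (Module.End F W) :=
    { carrier := E0
      mul_mem' := fun {a b} ha hb => hE0mul a ha b hb
      one_mem' := hone
      add_mem' := by
        rintro _ _ ⟨a, ha, rfl⟩ ⟨b, hb, rfl⟩
        refine ⟨a + b, hJadd a ha b hb, ?_⟩
        ext x
        change t ((a + b) x) = t (a x) + t (b x)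
        rw [← map_add]; rfl
      zero_mem' := ⟨0, hJ0, by ext x; change t 0 = 0; exact map_zero t⟩
      algebraMap_mem' := by
        intro c
        obtain ⟨a, ha, h1⟩ := hone
        refine ⟨c • a, hJsmul c a ha, ?_⟩
        rw [Algebra.algebraMap_eq_smul_one, ← h1]
        ext x
        change t (c • a x) = c • t (a x)
        rw [map_smul] }
  have hu' : (⟨u, huW⟩ : W) ≠ 0 := fun h => hu (congrArg Subtype.val h)
  obtain ⟨e, ⟨a, ha, rfl⟩, he⟩ := exists_trace_ne_zero_of_divisionRing E hinj hu' htrans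
  apply he
  rw [← hAtr (t * a) (hAmul _ ht.1 _ ha.1)]
  exact LinearMap.trace_restrict_eq_of_forall_mem W (t * a) (hta a ha)

end FiniteTransitive

/-- A pair of fields `K ⊇ L` of characteristic `p` with a homomorphism `φ : K → L`,
compatible `p`-inverse linear operators on both and filtrations of finitely generated subrings
which are almost contracted by these operators. -/
structure CartierData (p : ℕ) (K L : Type*) [Field K] [Field L] [Algebra (ZMod p) K]
    [Algebra (ZMod p) L] [Fact p.Prime] where
  i : L →ₐ[ZMod p] K
  φ : K →ₐ[ZMod p] L
  R : Module.End (ZMod p) K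
  RL : Module.End (ZMod p) L
  R_mul : ∀ a b, R (a ^ p * b) = a * R b
  RL_mul : ∀ a b, RL (a ^ p * b) = a * RL b
  RL_φ : ∀ a, RL (φ a) = φ (R a)
  g : L
  m₀ : ℕ
  R_g : ∀ h, (R ^ (m₀ + 1)) (i (g * h)) = (R ^ m₀) (i (RL h))
  U : ℕ → Submodule (ZMod p) L
  W : ℕ → Submodule (ZMod p) K
  U_fin : ∀ j, FiniteDimensional (ZMod p) (U j)
  U_mono : Monotone U
  U_one : 1 ∈ U 0
  U_mul : ∀ {a b x y}, x ∈ U a → y ∈ U b → x * y ∈ U (a + b)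
  W_mono : Monotone W
  U_le_W : ∀ {j x}, x ∈ U j → i x ∈ W j
  cR : ℕ
  R_mem' : ∀ {j x}, x ∈ W j → R x ∈ W (j / p + cR)
  cL : ℕ
  RL_mem : ∀ {j x}, x ∈ U j → RL x ∈ U (j / p + cL)
  s : L
  s_ne : s ≠ 0
  cs : ℕ
  s_mem : ∀ {j x}, x ∈ W j → s ^ j * φ x ∈ U (cs * j)
  rP : ℕ
  W_pow : ∀ {j x}, x ∈ W j → ∃ y ∈ U (j * p ^ rP), i y = x ^ p ^ rP
  dg : ℕ
  g_mem : g ∈ U dg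
  exists_inv : ∀ {j f}, f ∈ U j → f ≠ 0 → ∃ j' m₁, ∃ e ∈ U j', ∀ m, m₁ ≤ m →
    (R ^ m) (i (e * f)) = 1

namespace CartierData

variable {p : ℕ} {K L : Type*} [Field K] [Field L] [Algebra (ZMod p) K] [Algebra (ZMod p) L]
  [hp : Fact p.Prime] (D : CartierData p K L)

attribute [instance] CartierData.U_fin

/-- The endomorphism of `L` induced by `φ`. -/
def φL : L →ₐ[ZMod p] L := D.φ.comp D.i

theorem R_pow_mul (n : ℕ) (a b : K) : (D.R ^ n) (a ^ p ^ n * b) = a * (D.R ^ n) b := by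
  induction n generalizing a b with
  | zero => simp
  | succ n ih =>
    rw [pow_succ, Module.End.mul_apply, Module.End.mul_apply, pow_succ, pow_mul, D.R_mul, ih]

/-- The exponent bound stable under iterating `R`. -/
def c : ℕ := 2 * D.cR + 2

theorem R_pow_mem (n : ℕ) {j : ℕ} {x : K} (hx : x ∈ D.W j) :
    (D.R ^ n) x ∈ D.W (j / p ^ n + D.c) := by
  induction n with
  | zero => simpa using D.W_mono (Nat.le_add_right _ _) hx
  | succ n ih =>
    rw [pow_succ' D.R, Module.End.mul_apply]
    refine D.W_mono ?_ (D.R_mem' ih)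
    rw [pow_succ, ← Nat.div_div_eq_div_mul]
    have h2 := hp.out.two_le
    have : (j / p ^ n + D.c) / p ≤ j / p ^ n / p + D.c / p + 1 := by
      rw [Nat.add_div hp.out.pos]
      split_ifs <;> omega
    have h3 : D.c / p ≤ D.cR + 1 := by
      calc D.c / p ≤ D.c / 2 := Nat.div_le_div_left h2 (by norm_num)
        _ = D.cR + 1 := by unfold c; omega
    unfold c at *
    omega

theorem U_pow {a : ℕ} {x : L} (hx : x ∈ D.U a) (n : ℕ) : x ^ n ∈ D.U (a * n) := by
  induction n with
  | zero => simpa using D.U_one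
  | succ n ih => rw [pow_succ, Nat.mul_succ]; exact D.U_mul ih hx

/-- The element `g ^ ((p ^ k - 1) / (p - 1))`. -/
def γ : ℕ → L
  | 0 => 1
  | k + 1 => γ k ^ p * D.g

theorem γ_mem (k : ℕ) : D.γ k ∈ D.U (D.dg * (p ^ k - 1)) := by
  induction k with
  | zero => simpa [γ] using D.U_one
  | succ k ih =>
    refine D.U_mono ?_ (D.U_mul (D.U_pow ih p) D.g_mem)
    have h2 := hp.out.two_le
    have h1 : 1 ≤ p ^ k := Nat.one_le_pow _ _ hp.out.pos
    rw [mul_assoc, ← Nat.mul_succ]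
    apply Nat.mul_le_mul_left
    rw [pow_succ, Nat.sub_mul, one_mul]
    have : p ≤ p ^ k * p := Nat.le_mul_of_pos_left _ h1
    omega

theorem R_g' {m : ℕ} (hm : D.m₀ ≤ m) (h : L) :
    (D.R ^ (m + 1)) (D.i (D.g * h)) = (D.R ^ m) (D.i (D.RL h)) := by
  obtain ⟨t, rfl⟩ := Nat.exists_eq_add_of_le' hm
  rw [add_assoc, pow_add, Module.End.mul_apply, D.R_g, pow_add, Module.End.mul_apply]

/-- The exponent of the element `s` in the letters. -/
def M : ℕ := 2 * D.c + 2 + D.dg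

/-- Half of a letter. -/
def G (m k : ℕ) (e : L) : Module.End (ZMod p) L :=
  LinearMap.mulLeft (ZMod p) (D.s ^ (D.M * p ^ (k + 1))) ∘ₗ D.φ.toLinearMap ∘ₗ
    (D.R ^ m) ∘ₗ D.i.toLinearMap ∘ₗ LinearMap.mulLeft (ZMod p) (e ^ p ^ k * D.γ k)

theorem G_apply (m k : ℕ) (e h : L) : D.G m k e h =
    D.s ^ (D.M * p ^ (k + 1)) * D.φ ((D.R ^ m) (D.i (e ^ p ^ k * D.γ k * h))) := rfl

/-- The letters: the Cartier-type operators composed with `φ`. -/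
def T (m k : ℕ) (e : L) : Module.End (ZMod p) L := D.RL * D.G m k e

theorem T_apply (m k : ℕ) (e h : L) : D.T m k e h =
    D.s ^ (D.M * p ^ k) * D.φ ((D.R ^ (m + 1)) (D.i (e ^ p ^ k * D.γ k * h))) := by
  unfold T
  rw [Module.End.mul_apply, G_apply, pow_succ, ← mul_assoc D.M, pow_mul, D.RL_mul, D.RL_φ,
    pow_succ' D.R, Module.End.mul_apply]

theorem T_succ {m : ℕ} (hm : D.m₀ ≤ m) (k : ℕ) (e : L) :
    D.T m (k + 1) e = D.G m k e * D.RL := by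
  ext h
  rw [T_apply, Module.End.mul_apply, G_apply]
  congr 2
  have : e ^ p ^ (k + 1) * D.γ (k + 1) * h = D.g * ((e ^ p ^ k * D.γ k) ^ p * h) := by
    rw [γ, pow_succ p, pow_mul, mul_pow]; ring
  rw [this, D.R_g' hm, D.RL_mul]

/-- The product of the letters of a word. -/
def word (m k : ℕ) (es : List L) : Module.End (ZMod p) L := (es.map (D.T m k)).prod

theorem word_cons (m k : ℕ) (e : L) (es : List L) :
    D.word m k (e :: es) = D.T m k e * D.word m k es := by
  simp [word]

theorem word_append (m k : ℕ) (es es' : List L) :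
    D.word m k (es ++ es') = D.word m k es * D.word m k es' := by
  simp [word]

theorem word_succ {m : ℕ} (hm : D.m₀ ≤ m) (k : ℕ) (e : L) (es : List L) :
    D.word m (k + 1) (e :: es) = D.G m k e * D.word m k es * D.RL := by
  induction es generalizing e with
  | nil => simp [word, D.T_succ hm]
  | cons e' es ih =>
    rw [word_cons, ih, D.T_succ hm, word_cons, T]
    simp only [mul_assoc]

theorem T_semilinear (m k : ℕ) (e b h : L) :
    D.T m k e (b ^ p ^ (m + 1) * h) = D.φL b * D.T m k e h := by
  rw [T_apply, T_apply]
  have : D.i (e ^ p ^ k * D.γ k * (b ^ p ^ (m + 1) * h)) =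
      D.i b ^ p ^ (m + 1) * D.i (e ^ p ^ k * D.γ k * h) := by
    rw [← map_pow, ← map_mul]; congr 1; ring
  rw [this, R_pow_mul, map_mul]
  change _ * (D.φL b * _) = _
  ring

theorem word_semilinear (m k : ℕ) (es : List L) (b h : L) :
    D.word m k es (b ^ (p ^ (m + 1)) ^ es.length * h) =
      (D.φL ^ es.length) b * D.word m k es h := by
  induction es generalizing b h with
  | nil => simp [word]
  | cons e es ih =>
    rw [word_cons, Module.End.mul_apply, Module.End.mul_apply, List.length_cons,
      pow_succ' (p ^ (m + 1)), pow_mul, ih, map_pow, D.T_semilinear, pow_succ' D.φL]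
    rfl

/-- The degree bound for the images of letters. -/
def J₀ : ℕ := D.cs * D.M

/-- The degree bound for the images of letters. -/
def J : ℕ := D.J₀ + D.cL

theorem G_mem {m k : ℕ} {e h : L} (he : e ∈ D.U ((D.c + 1) * p ^ (m + 1)))
    (hh : h ∈ D.U (p ^ (m + 1) * p ^ k)) : D.G m k e h ∈ D.U (D.J₀ * p ^ (k + 1)) := by
  rw [G_apply, J₀, mul_assoc]
  apply D.s_mem
  have h1 := D.U_mul (D.U_mul (D.U_pow he (p ^ k)) (D.γ_mem k)) hh
  refine D.W_mono ?_ (D.R_pow_mem m (D.U_le_W h1))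
  have hpos : 0 < p ^ m := Nat.pow_pos hp.out.pos
  have h2 : (D.c + 1) * p ^ (m + 1) * p ^ k + D.dg * (p ^ k - 1) + p ^ (m + 1) * p ^ k ≤
      p ^ m * ((D.c + 2 + D.dg) * p ^ (k + 1)) := by
    have h3 : D.dg * (p ^ k - 1) ≤ D.dg * (p ^ m * p ^ (k + 1)) := by
      apply Nat.mul_le_mul_left
      calc p ^ k - 1 ≤ p ^ k := Nat.sub_le _ _
        _ ≤ p ^ (k + 1) := Nat.pow_le_pow_right hp.out.pos (Nat.le_succ k)
        _ ≤ p ^ m * p ^ (k + 1) := Nat.le_mul_of_pos_left _ hpos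
    have h4 : p ^ m * ((D.c + 2 + D.dg) * p ^ (k + 1)) =
      (D.c + 1) * p ^ (m + 1) * p ^ k + D.dg * (p ^ m * p ^ (k + 1)) + p ^ (m + 1) * p ^ k := by
      ring
    omega
  have h5 := Nat.div_le_of_le_mul h2
  have h6 : D.c ≤ D.c * p ^ (k + 1) := Nat.le_mul_of_pos_right _ (Nat.pow_pos hp.out.pos)
  calc _ ≤ (D.c + 2 + D.dg) * p ^ (k + 1) + D.c * p ^ (k + 1) := add_le_add h5 h6
    _ = D.M * p ^ (k + 1) := by unfold M; ring

theorem T_mem₀ {m k : ℕ} {e h : L} (he : e ∈ D.U ((D.c + 1) * p ^ (m + 1)))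
    (hh : h ∈ D.U (p ^ (m + 1) * p ^ k)) : D.T m k e h ∈ D.U (D.J₀ * p ^ k + D.cL) := by
  have := D.RL_mem (D.G_mem he hh)
  rwa [pow_succ, ← mul_assoc, Nat.mul_div_cancel _ hp.out.pos] at this

theorem J_bound (k : ℕ) : D.J₀ * p ^ k + D.cL ≤ D.J * p ^ k := by
  have : D.cL ≤ D.cL * p ^ k := Nat.le_mul_of_pos_right _ (Nat.pow_pos hp.out.pos)
  unfold J
  rw [add_mul]
  omega

theorem T_mem {m k : ℕ} {e h : L} (he : e ∈ D.U ((D.c + 1) * p ^ (m + 1)))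
    (hh : h ∈ D.U (p ^ (m + 1) * p ^ k)) : D.T m k e h ∈ D.U (D.J * p ^ k) :=
  D.U_mono (D.J_bound k) (D.T_mem₀ he hh)

theorem word_mem {m k : ℕ} (hQ : 2 * D.J + 4 ≤ p ^ (m + 1)) {es : List L}
    (hes : ∀ e ∈ es, e ∈ D.U ((D.c + 1) * p ^ (m + 1))) {h : L}
    (hh : h ∈ D.U (p ^ (m + 1) * p ^ k)) : D.word m k es h ∈ D.U (p ^ (m + 1) * p ^ k) ∧
      (es ≠ [] → D.word m k es h ∈ D.U (D.J * p ^ k)) := by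
  induction es with
  | nil => simpa [word] using hh
  | cons e es ih =>
    rw [word_cons]
    have h1 := D.T_mem (hes e (by simp)) (ih (fun e' he' => hes e' (by simp [he']))).1
    exact ⟨D.U_mono (Nat.mul_le_mul_right _ (by omega)) h1, fun _ => h1⟩

theorem trOn_word_succ {m : ℕ} (hm : D.m₀ ≤ m) (hQ : 2 * D.J + 4 ≤ p ^ (m + 1)) (k : ℕ) {es : List L}
    (hes : ∀ e ∈ es, e ∈ D.U ((D.c + 1) * p ^ (m + 1))) (hne : es ≠ []) :
    trOn (D.word m k es) (D.U (D.J * p ^ k)) =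
      trOn (D.word m (k + 1) es) (D.U (D.J * p ^ (k + 1))) := by
  obtain ⟨e, es, rfl⟩ := List.exists_cons_of_ne_nil hne
  have hle : D.U (D.J * p ^ k + D.cL) ≤ D.U (p ^ (m + 1) * p ^ k) := D.U_mono <| by
    have h1 : D.cL ≤ D.J * p ^ k := (D.J_bound k).trans' (Nat.le_add_left _ _)
    have h2 := Nat.mul_le_mul_right (p ^ k) hQ
    rw [add_mul, mul_assoc] at h2
    omega
  have hb : ∀ x ∈ D.U (D.J * p ^ k + D.cL), D.G m k e (D.word m k es x) ∈
      D.U (D.J₀ * p ^ (k + 1)) := fun x hx =>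
    D.G_mem (hes e (by simp))
      (D.word_mem hQ (fun e' he' => hes e' (by simp [he'])) (hle hx)).1
  have h1 : D.U (D.J₀ * p ^ (k + 1)) ≤ D.U (D.J * p ^ (k + 1)) :=
    D.U_mono (Nat.mul_le_mul_right _ (Nat.le_add_right _ _))
  have h2 : ∀ x ∈ D.U (D.J₀ * p ^ (k + 1)), D.RL x ∈ D.U (D.J * p ^ k) := fun x hx => by
    have := D.RL_mem hx
    rw [pow_succ, ← mul_assoc, Nat.mul_div_cancel _ hp.out.pos] at this
    exact D.U_mono (D.J_bound k) this
  have h3 : ∀ x ∈ D.U (D.J * p ^ (k + 1)), D.RL x ∈ D.U (D.J * p ^ k + D.cL) := fun x hx => by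
    have := D.RL_mem hx
    rwa [pow_succ, ← mul_assoc, Nat.mul_div_cancel _ hp.out.pos] at this
  rw [D.word_succ hm, word_cons, T, mul_assoc,
    trOn_mul_comm _ D.RL _ (D.U (D.J * p ^ k + D.cL)) h3 (fun x hx => h1 (hb x hx))]
  exact trOn_eq_of_le (D.U_mono (Nat.le_add_right _ _)) fun x hx => h2 _ (hb x hx)

theorem trOn_word {m : ℕ} (hm : D.m₀ ≤ m) (hQ : 2 * D.J + 4 ≤ p ^ (m + 1)) (k : ℕ) {es : List L}
    (hes : ∀ e ∈ es, e ∈ D.U ((D.c + 1) * p ^ (m + 1))) (hne : es ≠ []) :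
    trOn (D.word m k es) (D.U (D.J * p ^ k)) = trOn (D.word m 0 es) (D.U D.J) := by
  induction k with
  | zero => simp
  | succ k ih => rw [← D.trOn_word_succ hm hQ k hes hne, ih]

/-- There is a word of nonzero trace. -/
theorem exists_word : ∃ m, D.m₀ ≤ m ∧ 2 * D.J + 4 ≤ p ^ (m + 1) ∧ ∃ es : List L,
    (∀ e ∈ es, e ∈ D.U ((D.c + 1) * p ^ (m + 1))) ∧ es ≠ [] ∧
    trOn (D.word m 0 es) (D.U D.J) ≠ 0 := by
  have : Finite (D.U D.J) := Module.finite_of_finite (ZMod p)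
  choose! j' m₁ e he hinv using fun (f : L) (h : f ∈ D.U D.J ∧ f ≠ 0) => D.exists_inv h.1 h.2
  obtain ⟨j, hj⟩ : ∃ j, ∀ f ∈ D.U D.J, j' f ≤ j := by
    obtain ⟨j, hj⟩ := (Set.finite_range (fun f : D.U D.J => j' f)).bddAbove
    exact ⟨j, fun f hf => hj ⟨⟨f, hf⟩, rfl⟩⟩
  obtain ⟨m₂, hm₂⟩ : ∃ j, ∀ f ∈ D.U D.J, m₁ f ≤ j := by
    obtain ⟨j, hj⟩ := (Set.finite_range (fun f : D.U D.J => m₁ f)).bddAbove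
    exact ⟨j, fun f hf => hj ⟨⟨f, hf⟩, rfl⟩⟩
  obtain ⟨m, h1, h2, h3, h4⟩ : ∃ m, D.m₀ ≤ m ∧ m₂ ≤ m ∧ D.rP ≤ m ∧
      2 * D.J + 4 + j ≤ m := ⟨D.m₀ + m₂ + D.rP + (2 * D.J + 4 + j), by omega, by omega, by omega,
        by omega⟩
  have hQ : 2 * D.J + 4 + j < p ^ (m + 1) :=
    (Nat.lt_pow_self hp.out.one_lt).trans_le (Nat.pow_le_pow_right hp.out.pos (by omega))
  have hQ' : 2 * D.J + 4 ≤ p ^ (m + 1) := by omega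
  refine ⟨m, h1, hQ', ?_⟩
  have hQ1 : D.U D.J ≤ D.U (p ^ (m + 1) * p ^ 0) := D.U_mono (by rw [pow_zero, mul_one]; omega)
  have hT0 : ∀ e h, D.T m 0 e h = D.s ^ D.M * D.φ ((D.R ^ (m + 1)) (D.i (e * h))) := by
    intro e h
    rw [T_apply]
    simp [γ]
  set Q := p ^ (m + 1) with hQdef
  have hgood : ∀ f ∈ D.U D.J, f ≠ 0 → e f ∈ D.U ((D.c + 1) * Q) := fun f hf hf0 =>
    D.U_mono (by
      have := hj f hf
      have h5 : Q ≤ (D.c + 1) * Q := Nat.le_mul_of_pos_left _ (by omega)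
      omega) (he f ⟨hf, hf0⟩)
  have hword : ∀ es : List L, (∀ e ∈ es, e ∈ D.U ((D.c + 1) * Q)) → es ≠ [] → ∀ x ∈ D.U D.J,
      D.word m 0 es x ∈ D.U D.J := by
    intro es hes hne x hx
    simpa using (D.word_mem hQ' hes (hQ1 hx)).2 hne
  let S : Set (Module.End (ZMod p) (D.U D.J)) := {f | ∃ es : List L,
    ∃ hes : ∀ e ∈ es, e ∈ D.U ((D.c + 1) * Q), ∃ hne : es ≠ [],
      (D.word m 0 es).restrict (hword es hes hne) = f}
  have hw : D.s ^ D.M ∈ D.U D.J := by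
    have h5 := D.s_mem (j := D.M) (D.W_mono (Nat.zero_le _) (D.U_le_W D.U_one))
    rw [map_one, map_one, mul_one] at h5
    exact D.U_mono (Nat.le_add_right _ _) h5
  have hw0 : D.s ^ D.M ≠ 0 := pow_ne_zero _ D.s_ne
  obtain ⟨_, ⟨es, hes, hne, rfl⟩, htr⟩ := exists_trace_ne_zero S (by
      rintro _ ⟨a, ha, ha0, rfl⟩ _ ⟨b, hb, hb0, rfl⟩
      refine ⟨a ++ b, ?_, by simp [ha0], ?_⟩
      · intro e' he'
        rcases List.mem_append.1 he' with h | h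
        exacts [ha _ h, hb _ h]
      · ext x
        change D.word m 0 (a ++ b) x = D.word m 0 a (D.word m 0 b x)
        rw [word_append]; rfl)
    (w := (⟨D.s ^ D.M, hw⟩ : D.U D.J)) (fun h => hw0 (congrArg Subtype.val h)) (by
      rintro ⟨f, hf⟩ hf0
      have hf0 : f ≠ 0 := fun h => hf0 (Subtype.ext h)
      refine ⟨_, ⟨[e f], by simpa using hgood f hf hf0, by simp, rfl⟩, ?_, ?_⟩
      · ext1
        change D.word m 0 [e f] f = _
        simp only [word, List.map_cons, List.map_nil, List.prod_singleton]
        rw [hT0, hinv f ⟨hf, hf0⟩ (m + 1) (by have := hm₂ f hf; omega), map_one, mul_one]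
      · rintro ⟨v, hv⟩
        apply Submodule.subset_span
        set a := (D.R ^ (m + 1)) (D.i (e f * v)) with ha
        have haW : a ∈ D.W D.c := by
          have h5 := D.R_pow_mem (m + 1) (D.U_le_W (D.U_mul (he f ⟨hf, hf0⟩) hv))
          rwa [Nat.div_eq_of_lt (by have := hj f hf; omega), zero_add] at h5
        obtain ⟨y, hy, hya⟩ := D.W_pow haW
        have hyQ : D.i (y ^ p ^ (m + 1 - D.rP)) = a ^ Q := by
          rw [map_pow, hya, ← pow_mul, ← pow_add]
          congr 2
          omega
        refine ⟨_, ⟨[e (D.s ^ D.M) * y ^ p ^ (m + 1 - D.rP)], ?_, by simp, rfl⟩, ?_⟩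
        · simp only [List.mem_singleton, forall_eq]
          refine D.U_mono ?_ (D.U_mul (he _ ⟨hw, hw0⟩) (D.U_pow hy _))
          have h5 : p ^ (m + 1 - D.rP) ≤ Q := Nat.pow_le_pow_right hp.out.pos (by omega)
          have h6 := hj _ hw
          have h7 : D.c * p ^ D.rP * p ^ (m + 1 - D.rP) = D.c * Q := by
            rw [mul_assoc, ← pow_add, hQdef]
            congr 2
            omega
          rw [h7, add_mul, one_mul]
          omega
        · ext1
          change D.word m 0 [_] (D.s ^ D.M) = D.word m 0 [e f] v
          simp only [word, List.map_cons, List.map_nil, List.prod_singleton]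
          rw [hT0, hT0, ← ha]
          have h5 : D.i (e (D.s ^ D.M) * y ^ p ^ (m + 1 - D.rP) * D.s ^ D.M) =
              a ^ p ^ (m + 1) * D.i (e (D.s ^ D.M) * D.s ^ D.M) := by
            rw [← hQdef, ← hyQ, ← map_mul]; congr 1; ring
          rw [h5, R_pow_mul, hinv _ ⟨hw, hw0⟩ (m + 1) (by have := hm₂ _ hw; omega), mul_one])
  refine ⟨es, hes, hne, ?_⟩
  rwa [trOn_of_mapsTo (hword es hes hne)]

/-- Monomials in the elements `φ ^ i b` with `b ∈ B` and `i ≤ n`. -/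
def mon (B : Set L) : ℕ → Set L
  | 0 => B
  | n + 1 => {a | ∃ β ∈ B, ∃ a' ∈ mon B n, a = β * D.φL a'}

theorem mon_mul_word_mem (B : Set L) (hB : ∀ b ∈ B, ∃ j, b ∈ D.U j) {m : ℕ}
    (hQ : 2 * D.J + 4 ≤ p ^ (m + 1)) {es : List L}
    (hes : ∀ e ∈ es, e ∈ D.U ((D.c + 1) * p ^ (m + 1))) (r : ℕ) {a : L}
    (ha : a ∈ D.mon B es.length) :
    ∃ k₀, ∀ k, k₀ ≤ k → ∀ h ∈ D.U ((p ^ (m + 1) - 1) * p ^ k),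
      a ^ (p ^ (m + 1)) ^ r * D.word m k es h ∈ D.U (p ^ (m + 1) * p ^ k) ∧
      (es ≠ [] → a ^ (p ^ (m + 1)) ^ r * D.word m k es h ∈ D.U ((D.J + 1) * p ^ k)) := by
  have hpow : ∀ b ∈ B, ∀ N, ∃ k₀, ∀ k, k₀ ≤ k → b ^ N ∈ D.U (p ^ k) := by
    intro b hb N
    obtain ⟨j, hj⟩ := hB b hb
    refine ⟨j * N, fun k hk => D.U_mono ?_ (D.U_pow hj N)⟩
    exact hk.trans (Nat.lt_pow_self hp.out.one_lt).le
  induction es generalizing a r with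
  | nil =>
    obtain ⟨k₀, hk₀⟩ := hpow a ha ((p ^ (m + 1)) ^ r)
    refine ⟨k₀, fun k hk h hh => ⟨?_, fun h => absurd rfl h⟩⟩
    have h1 := D.U_mul (hk₀ k hk) hh
    have h2 : p ^ k + (p ^ (m + 1) - 1) * p ^ k = p ^ (m + 1) * p ^ k := by
      obtain ⟨q, hq⟩ : ∃ q, p ^ (m + 1) = q + 1 := ⟨p ^ (m + 1) - 1, by omega⟩
      rw [hq, Nat.add_sub_cancel]; ring
    rw [h2] at h1
    simpa [word] using h1
  | cons e es ih =>
    obtain ⟨β, hβ, a', ha', rfl⟩ := ha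
    obtain ⟨k₁, hk₁⟩ := hpow β hβ ((p ^ (m + 1)) ^ r)
    obtain ⟨k₂, hk₂⟩ := ih (fun e' he' => hes e' (by simp [he'])) (r + 1) ha'
    refine ⟨max k₁ k₂, fun k hk h hh => ?_⟩
    have h1 := (hk₂ k (le_of_max_le_right hk) h hh).1
    have h2 := D.T_mem (hes e (by simp)) h1
    rw [pow_succ, mul_comm ((p ^ (m + 1)) ^ r), mul_comm, mul_comm (p ^ (m + 1)), pow_mul, mul_comm,
      D.T_semilinear] at h2
    have h3 := D.U_mul (hk₁ k (le_of_max_le_left hk)) h2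
    have h4 : (β * D.φL a') ^ (p ^ (m + 1)) ^ r * D.word m k (e :: es) h ∈
        D.U ((D.J + 1) * p ^ k) := by
      convert h3 using 1
      · congr 1; ring
      · rw [mul_pow, map_pow, word_cons, Module.End.mul_apply]; ring
    exact ⟨D.U_mono (Nat.mul_le_mul_right _ (by omega)) h4, fun _ => h4⟩

theorem exists_pow_ne_one (B : Set L) (hB : ∀ b ∈ B, ∃ j, b ∈ D.U j) :
    ∃ q n : ℕ, 0 < n ∧ 1 ∉ AddSubgroup.closure
      {x | ∃ b ∈ B, ∃ a ∈ D.mon B n, x = ((D.φL ^ n) b - b ^ p ^ q) * a} := by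
  obtain ⟨m, hm, hQ, es, hes, hne, htr⟩ := D.exists_word
  refine ⟨(m + 1) * es.length, es.length, List.length_pos_iff.2 hne, fun h1 => ?_⟩
  have key : ∀ x ∈ AddSubgroup.closure
      {x | ∃ b ∈ B, ∃ a ∈ D.mon B es.length,
        x = ((D.φL ^ es.length) b - b ^ p ^ ((m + 1) * es.length)) * a},
      ∃ k₀, ∀ k, k₀ ≤ k → (∀ h ∈ D.U ((D.J + 2) * p ^ k),
        (LinearMap.mulLeft (ZMod p) x * D.word m k es) h ∈ D.U ((D.J + 2) * p ^ k)) ∧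
        trOn (LinearMap.mulLeft (ZMod p) x * D.word m k es) (D.U ((D.J + 2) * p ^ k)) = 0 := by
    intro x hx
    induction hx using AddSubgroup.closure_induction with
    | mem x hx =>
      obtain ⟨b, hb, a, ha, rfl⟩ := hx
      obtain ⟨k₁, hk₁⟩ := D.mon_mul_word_mem B hB hQ hes 0 ha
      obtain ⟨j, hj⟩ := hB b hb
      set N := p ^ ((m + 1) * es.length) with hN
      refine ⟨max k₁ (j * N), fun k hk => ?_⟩
      have hbk : b ^ N ∈ D.U (p ^ k) := D.U_mono
        ((le_of_max_le_right hk).trans (Nat.lt_pow_self hp.out.one_lt).le) (D.U_pow hj N)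
      set t := D.word m k es
      set A := LinearMap.mulLeft (ZMod p) a * t with hA
      set β := LinearMap.mulLeft (ZMod p) (b ^ N) with hβ
      have hat : ∀ h ∈ D.U ((D.J + 3) * p ^ k), A h ∈ D.U ((D.J + 1) * p ^ k) := by
        intro h hh
        have := (hk₁ k (le_of_max_le_left hk) h
          (D.U_mono (Nat.mul_le_mul_right _ (by omega)) hh)).2 hne
        simpa [hA, t] using this
      have hmulβ : ∀ J', ∀ h ∈ D.U (J' * p ^ k), β h ∈ D.U ((J' + 1) * p ^ k) := by
        intro J' h hh
        have := D.U_mul hbk hh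
        rwa [show p ^ k + J' * p ^ k = (J' + 1) * p ^ k by ring] at this
      have hle : ∀ a b : ℕ, a ≤ b → D.U (a * p ^ k) ≤ D.U (b * p ^ k) := fun a b h =>
        D.U_mono (Nat.mul_le_mul_right _ h)
      have heq : LinearMap.mulLeft (ZMod p) (((D.φL ^ es.length) b - b ^ N) * a) * t =
          A * β + -(β * A) := by
        ext h
        change ((D.φL ^ es.length) b - b ^ N) * a * t h = a * t (b ^ N * h) + -(b ^ N * (a * t h))
        rw [hN, pow_mul p, D.word_semilinear]
        ring
      have hAβ : ∀ h ∈ D.U ((D.J + 2) * p ^ k), (A * β) h ∈ D.U ((D.J + 1) * p ^ k) :=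
        fun h hh => hat _ (hmulβ _ _ hh)
      have hβA : ∀ h ∈ D.U ((D.J + 3) * p ^ k), (β * A) h ∈ D.U ((D.J + 2) * p ^ k) :=
        fun h hh => hmulβ _ _ (hat _ hh)
      have hβA' : ∀ h ∈ D.U ((D.J + 2) * p ^ k), (β * A) h ∈ D.U ((D.J + 2) * p ^ k) :=
        fun h hh => hβA _ (hle _ _ (by omega) hh)
      rw [heq]
      refine ⟨fun h hh => (D.U _).add_mem (hle _ _ (by omega) (hAβ h hh))
        ((D.U _).neg_mem (hβA' h hh)), ?_⟩
      rw [trOn_add (fun h hh => hle _ _ (by omega) (hAβ h hh))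
        (fun h hh => (D.U _).neg_mem (hβA' h hh)), trOn_neg,
        trOn_mul_comm A β _ (D.U ((D.J + 3) * p ^ k)) (hmulβ _)
        (fun h hh => hle _ _ (by omega) (hat h hh)),
        ← trOn_eq_of_le (hle _ _ (by omega)) hβA, add_neg_cancel]
    | zero =>
      refine ⟨0, fun k _ => ?_⟩
      have : LinearMap.mulLeft (ZMod p) (0 : L) * D.word m k es = 0 := by ext; simp
      rw [this]
      exact ⟨fun h _ => (D.U _).zero_mem, trOn_zero _⟩
    | add x y _ _ hx hy =>
      obtain ⟨k₁, hk₁⟩ := hx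
      obtain ⟨k₂, hk₂⟩ := hy
      refine ⟨max k₁ k₂, fun k hk => ?_⟩
      obtain ⟨h1, h2⟩ := hk₁ k (le_of_max_le_left hk)
      obtain ⟨h3, h4⟩ := hk₂ k (le_of_max_le_right hk)
      have : LinearMap.mulLeft (ZMod p) (x + y) * D.word m k es =
        LinearMap.mulLeft (ZMod p) x * D.word m k es +
          LinearMap.mulLeft (ZMod p) y * D.word m k es := by
        ext; simp [add_mul]
      rw [this]
      exact ⟨fun h hh => (D.U _).add_mem (h1 h hh) (h3 h hh),
        by rw [trOn_add h1 h3, h2, h4, add_zero]⟩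
    | neg x _ hx =>
      obtain ⟨k₁, hk₁⟩ := hx
      refine ⟨k₁, fun k hk => ?_⟩
      obtain ⟨h1, h2⟩ := hk₁ k hk
      have : LinearMap.mulLeft (ZMod p) (-x) * D.word m k es =
        -(LinearMap.mulLeft (ZMod p) x * D.word m k es) := by
        ext; simp
      rw [this]
      exact ⟨fun h hh => (D.U _).neg_mem (h1 h hh), by rw [trOn_neg, h2, neg_zero]⟩
  obtain ⟨k, hk⟩ := key 1 h1
  apply htr
  rw [← D.trOn_word hm hQ k hes hne]
  have h2 := (hk k le_rfl).2
  have h3 : LinearMap.mulLeft (ZMod p) (1 : L) * D.word m k es = D.word m k es := by ext; simp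
  rw [h3] at h2
  rw [← h2]
  apply trOn_eq_of_le (D.U_mono (Nat.mul_le_mul_right _ (by omega)))
  intro x hx
  exact (D.word_mem hQ hes (D.U_mono (Nat.mul_le_mul_right _ (by omega)) hx)).2 hne

end CartierData

namespace CartierData

variable {p : ℕ} {K : Type*} {L : Type u} [Field K] [Field L] [Algebra (ZMod p) K] [Algebra (ZMod p) L]
  [hp : Fact p.Prime] (D : CartierData p K L)

theorem one_mem_mon (B : Subalgebra (ZMod p) L) (n : ℕ) : (1 : L) ∈ D.mon B n := by
  induction n with
  | zero => exact B.one_mem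
  | succ n ih => exact ⟨1, B.one_mem, 1, ih, by simp⟩

theorem mul_mem_mon (B : Subalgebra (ZMod p) L) (n : ℕ) {x y : L} (hx : x ∈ D.mon B n)
    (hy : y ∈ D.mon B n) : x * y ∈ D.mon B n := by
  induction n generalizing x y with
  | zero => exact B.mul_mem hx hy
  | succ n ih =>
    obtain ⟨b, hb, x, hx, rfl⟩ := hx
    obtain ⟨c, hc, y, hy, rfl⟩ := hy
    exact ⟨b * c, B.mul_mem hb hc, x * y, ih hx hy, by rw [map_mul]; ring⟩

theorem base_mem_mon (B : Subalgebra (ZMod p) L) (n : ℕ) {x : L} (hx : x ∈ B) :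
    x ∈ D.mon B n := by
  cases n with
  | zero => exact hx
  | succ n => exact ⟨x, hx, 1, D.one_mem_mon B n, by simp⟩

theorem pow_mem_mon (B : Subalgebra (ZMod p) L) {n i : ℕ} (hi : i ≤ n) {x : L} (hx : x ∈ B) :
    (D.φL ^ i) x ∈ D.mon B n := by
  induction n generalizing i with
  | zero =>
    obtain rfl : i = 0 := by omega
    simpa using D.base_mem_mon B 0 hx
  | succ n ih =>
    rcases i with _ | i
    · simpa using D.base_mem_mon B _ hx
    · refine ⟨1, B.one_mem, _, ih (i := i) (by omega), ?_⟩
      rw [pow_succ', AlgHom.mul_apply, one_mul]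

/-- The subalgebra generated by the first iterates of `B`. -/
def O (B : Subalgebra (ZMod p) L) (n : ℕ) : Subalgebra (ZMod p) L :=
  ⨆ i : Fin (n + 1), B.map (D.φL ^ (i : ℕ))

theorem O_fg {B : Subalgebra (ZMod p) L} (hB : B.FG) (n : ℕ) : (D.O B n).FG := by
  have (s : Finset (Fin (n + 1))) : (⨆ i ∈ s, B.map (D.φL ^ (i : ℕ))).FG := by
    classical
    induction s using Finset.induction_on with
    | empty => simpa using Subalgebra.fg_bot
    | insert a s _ ih =>
      rw [Finset.iSup_insert]
      exact (hB.map _).sup ih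
  simpa [O] using this Finset.univ

theorem mem_O (B : Subalgebra (ZMod p) L) {n i : ℕ} (hi : i ≤ n) {x : L} (hx : x ∈ B) :
    (D.φL ^ i) x ∈ D.O B n :=
  (le_iSup (fun i : Fin (n + 1) => B.map (D.φL ^ (i : ℕ))) ⟨i, by omega⟩) ⟨x, hx, rfl⟩

theorem O_le (B : Subalgebra (ZMod p) L) (n : ℕ) {x : L} (hx : x ∈ D.O B n) :
    x ∈ AddSubgroup.closure (D.mon B n) := by
  let M : Submonoid L := ⟨⟨D.mon B n, D.mul_mem_mon B n⟩, D.one_mem_mon B n⟩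
  let S : Subalgebra (ZMod p) L :=
    { Subring.closure (M : Set L) with
      algebraMap_mem' := fun r => by
        obtain ⟨k, rfl⟩ := ZMod.intCast_surjective r
        rw [map_intCast]
        exact intCast_mem (Subring.closure (M : Set L)) k }
  have hle : D.O B n ≤ S := by
    refine iSup_le fun i => ?_
    rintro _ ⟨y, hy, rfl⟩
    exact Subring.subset_closure (D.pow_mem_mon B (by omega) hy)
  have := Subring.mem_closure_iff.1 (show x ∈ Subring.closure (M : Set L) from hle hx)
  rwa [Submonoid.closure_eq] at this

theorem exists_points_of_base (B : Subalgebra (ZMod p) L) (hfg : B.FG)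
    (hB : ∀ b ∈ B, ∃ j, b ∈ D.U j) :
    ∃ (F : Type u) (_ : Field F) (_ : Finite F) (N : ℕ) (χ : ℕ → B →+* F), 0 < N ∧
      (∀ i (b c : B), (c : L) = D.φL b → χ (i + 1) b = χ i c) ∧ ∀ i, χ (i + N) = χ i := by
  obtain ⟨q, n, hn, h1⟩ := D.exists_pow_ne_one B hB
  set O := D.O B n with hO
  let gen (b : B) : O := ⟨(D.φL ^ n) b, D.mem_O B le_rfl b.2⟩ -
    ⟨b, by simpa using D.mem_O B (Nat.zero_le n) b.2⟩ ^ p ^ q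
  have hI : Ideal.span (Set.range gen) ≠ ⊤ := by
    rw [Ideal.ne_top_iff_one]
    intro h
    refine h1 ?_
    have key : ∀ x ∈ Ideal.span (Set.range gen), ∀ o : O, ((o * x : O) : L) ∈ AddSubgroup.closure
        {x | ∃ b ∈ B, ∃ a ∈ D.mon B n, x = ((D.φL ^ n) b - b ^ p ^ q) * a} := by
      intro x hx
      induction hx using Submodule.span_induction with
      | mem x hx =>
        obtain ⟨b, rfl⟩ := hx
        intro o
        have := D.O_le B n o.2
        change (o : L) * ((D.φL ^ n) b - b ^ p ^ q) ∈ _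
        generalize (o : L) = o' at this
        induction this using AddSubgroup.closure_induction with
        | mem a ha => exact AddSubgroup.subset_closure ⟨b, b.2, a, ha, by ring⟩
        | zero => simp
        | add x y _ _ hx hy => rw [add_mul]; exact add_mem hx hy
        | neg x _ hx => rw [neg_mul]; exact neg_mem hx
      | zero => simp
      | add x y _ _ hx hy => intro o; rw [mul_add]; exact add_mem (hx o) (hy o)
      | smul a x _ hx => intro o; rw [smul_eq_mul, ← mul_assoc]; exact hx _
    simpa using key 1 h 1
  obtain ⟨m, hm, hIm⟩ := Ideal.exists_le_maximal _ hI
  let _ := Ideal.Quotient.field m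
  have : Algebra.FiniteType (ZMod p) O := (Subalgebra.fg_iff_finiteType _).1 (D.O_fg hfg n)
  have : Algebra.FiniteType (ZMod p) (O ⧸ m) := Algebra.FiniteType.of_surjective
    (Ideal.Quotient.mkₐ (ZMod p) m) Ideal.Quotient.mk_surjective
  have : Module.Finite (ZMod p) (O ⧸ m) := finite_of_finite_type_of_isJacobsonRing _ _
  have : Finite (O ⧸ m) := Module.finite_of_finite (ZMod p)
  have : CharP (O ⧸ m) p := charP_of_injective_algebraMap (algebraMap (ZMod p) _).injective p
  have : Fintype (O ⧸ m) := Fintype.ofFinite _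
  obtain ⟨f, -, hf⟩ := FiniteField.card (O ⧸ m) p
  have hgen (b : B) : Ideal.Quotient.mk m ⟨(D.φL ^ n) b, D.mem_O B le_rfl b.2⟩ =
      Ideal.Quotient.mk m ⟨b, by simpa using D.mem_O B (Nat.zero_le n) b.2⟩ ^ p ^ q := by
    rw [← map_pow, Ideal.Quotient.eq]
    exact hIm (Ideal.subset_span ⟨b, rfl⟩)
  let ι (i : ℕ) : B →+* O := (((D.φL ^ (i % n)).comp B.val).codRestrict O
    fun b => D.mem_O B (Nat.mod_lt _ hn).le b.2).toRingHom
  let χ (i : ℕ) : B →+* O ⧸ m :=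
    (iterateFrobenius (O ⧸ m) p (q * (i / n))).comp ((Ideal.Quotient.mk m).comp (ι i))
  have hχ (i : ℕ) (b : B) : χ i b = Ideal.Quotient.mk m ⟨(D.φL ^ (i % n)) b,
      D.mem_O B (Nat.mod_lt _ hn).le b.2⟩ ^ p ^ (q * (i / n)) := rfl
  refine ⟨O ⧸ m, inferInstance, inferInstance, n * f, χ, Nat.mul_pos hn f.pos, ?_, ?_⟩
  · intro i b c hc
    rw [hχ, hχ]
    have hc' (j : ℕ) : (D.φL ^ j) (c : L) = (D.φL ^ (j + 1)) (b : L) := by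
      rw [hc, pow_succ, AlgHom.mul_apply]
    by_cases h : i % n + 1 < n
    · have e1 : (i + 1) % n = i % n + 1 := by
        rw [Nat.add_mod, Nat.mod_eq_of_lt (a := 1) (by omega), Nat.mod_eq_of_lt h]
      have e2 : (i + 1) / n = i / n := by
        rw [Nat.succ_div, if_neg, add_zero]
        rw [Nat.dvd_iff_mod_eq_zero, e1]
        omega
      simp only [e1, e2, hc']
    · have e0 : i % n + 1 = n := by have := Nat.mod_lt i hn; omega
      have hd : n ∣ i + 1 := by
        rw [Nat.dvd_iff_mod_eq_zero, ← Nat.mod_add_mod, e0, Nat.mod_self]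
      have e1 : (i + 1) % n = 0 := Nat.mod_eq_zero_of_dvd hd
      have e2 : (i + 1) / n = i / n + 1 := by rw [Nat.succ_div, if_pos hd]
      simp only [e1, e2, hc', e0, hgen]
      rw [← pow_mul, ← pow_add]
      congr 2
      ring
  · intro i
    ext b
    rw [hχ, hχ]
    have e2 : (i + n * f) / n = i / n + f := Nat.add_mul_div_left _ _ hn
    simp only [Nat.add_mul_mod_self_left, e2]
    have e3 : p ^ (q * (f : ℕ)) = Fintype.card (O ⧸ m) ^ q := by rw [hf, mul_comm, pow_mul]
    rw [mul_add, pow_add, pow_mul, e3, FiniteField.pow_card_pow]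

theorem exists_points (B : Subalgebra (ZMod p) K) (G : Finset K)
    (hG : Algebra.adjoin (ZMod p) (G : Set K) = B) (hB : ∀ b ∈ G, ∃ j, b ∈ D.W j) :
    ∃ (F : Type u) (_ : Field F) (_ : Finite F) (N : ℕ) (χ : ℕ → B →+* F), 0 < N ∧
      (∀ i (b c : B), (c : K) = D.i (D.φ b) → χ (i + 1) b = χ i c) ∧ ∀ i, χ (i + N) = χ i := by
  have hB' : ∀ b : G, ∃ y, (∃ j, y ∈ D.U j) ∧ D.i y = b ^ p ^ D.rP := fun b => by
    obtain ⟨j, hj⟩ := hB b b.2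
    obtain ⟨y, hy, h⟩ := D.W_pow hj
    exact ⟨y, ⟨_, hy⟩, h⟩
  choose y hyU hy using hB'
  set B' := Algebra.adjoin (ZMod p) (Set.range y) with hB'
  have hfg : B'.FG := Subalgebra.fg_def.2 ⟨_, Set.finite_range y, rfl⟩
  have hBU : ∀ b ∈ B', ∃ j, b ∈ D.U j := by
    intro b hb
    induction hb using Algebra.adjoin_induction with
    | mem x hx => obtain ⟨x, rfl⟩ := hx; exact hyU x
    | algebraMap r => exact ⟨0, by
        rw [Algebra.algebraMap_eq_smul_one]; exact Submodule.smul_mem _ _ D.U_one⟩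
    | add x y _ _ hx hy =>
      obtain ⟨j, hj⟩ := hx
      obtain ⟨k, hk⟩ := hy
      exact ⟨max j k, add_mem (D.U_mono (le_max_left _ _) hj) (D.U_mono (le_max_right _ _) hk)⟩
    | mul x y _ _ hx hy =>
      obtain ⟨j, hj⟩ := hx
      obtain ⟨k, hk⟩ := hy
      exact ⟨j + k, D.U_mul hj hk⟩
  have : CharP K p := charP_of_injective_algebraMap (algebraMap (ZMod p) _).injective p
  have hex : ∀ b : B, ∃ z : B', D.i z = (b : K) ^ p ^ D.rP := by
    rintro ⟨b, hb⟩
    rw [← hG] at hb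
    dsimp only
    clear * - hb hy
    induction hb using Algebra.adjoin_induction with
    | mem x hx => exact ⟨⟨y ⟨x, hx⟩, Algebra.subset_adjoin ⟨_, rfl⟩⟩, hy _⟩
    | algebraMap r =>
      refine ⟨⟨algebraMap _ _ r, Subalgebra.algebraMap_mem _ _⟩, ?_⟩
      rw [AlgHom.commutes, ← map_pow, ZMod.pow_card_pow]
    | add x y _ _ hx hy =>
      obtain ⟨a, ha⟩ := hx
      obtain ⟨b, hb⟩ := hy
      exact ⟨a + b, by rw [add_pow_char_pow, ← ha, ← hb]; simp⟩
    | mul x y _ _ hx hy =>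
      obtain ⟨a, ha⟩ := hx
      obtain ⟨b, hb⟩ := hy
      exact ⟨a * b, by rw [mul_pow, ← ha, ← hb]; simp⟩
  choose z hz using hex
  have hinj : Function.Injective fun a : B' => D.i (a : L) :=
    D.i.toRingHom.injective.comp Subtype.val_injective
  let θ : B →+* B' :=
    { toFun := z
      map_one' := hinj (by simp [hz])
      map_mul' := fun a b => hinj (by simp [hz, mul_pow])
      map_zero' := hinj (by simp [hz, hp.out.ne_zero])
      map_add' := fun a b => hinj (by simp [hz, add_pow_char_pow]) }
  obtain ⟨F, hF, hfin, N, χ, hN, h1, h2⟩ := D.exists_points_of_base B' hfg hBU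
  refine ⟨F, hF, hfin, N, fun i => (χ i).comp θ, hN, ?_, fun i => by simp [h2]⟩
  intro i b c hc
  refine h1 i _ _ (D.i.toRingHom.injective ?_)
  change D.i (z c) = D.i (D.φ (D.i (z b)))
  rw [hz, hz, hc, map_pow, map_pow]

end CartierData

/-- The operator on polynomials extracting the coefficients whose exponents are divisible by `p`. -/
def cartierPoly (p : ℕ) [hp : Fact p.Prime] (σ : Type*) :
    MvPolynomial σ (ZMod p) →+ MvPolynomial σ (ZMod p) where
  toFun f := AddMonoidAlgebra.ofCoeff (Finsupp.comapDomain (fun γ => p • γ)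
    (AddMonoidAlgebra.coeff f) (by
      refine Function.Injective.injOn fun a b h => Finsupp.ext fun i => ?_
      exact Nat.eq_of_mul_eq_mul_left hp.out.pos (by simpa using DFunLike.congr_fun h i)))
  map_zero' := by ext; simp [MvPolynomial.coeff]
  map_add' f g := by ext; simp [MvPolynomial.coeff]

section CartierPoly

variable {p : ℕ} [hp : Fact p.Prime] {σ : Type*}

open MvPolynomial in
theorem coeff_cartierPoly (γ : σ →₀ ℕ) (f : MvPolynomial σ (ZMod p)) :
    coeff γ (cartierPoly p σ f) = coeff (p • γ) f := rfl

open MvPolynomial in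
theorem coeff_cartierPoly_iterate (n : ℕ) (γ : σ →₀ ℕ) (f : MvPolynomial σ (ZMod p)) :
    coeff γ ((cartierPoly p σ)^[n] f) = coeff (p ^ n • γ) f := by
  induction n generalizing γ with
  | zero => simp
  | succ n ih => rw [Function.iterate_succ_apply', coeff_cartierPoly, ih, smul_smul, pow_succ]

open MvPolynomial in
theorem cartierPoly_pow_mul (a b : MvPolynomial σ (ZMod p)) :
    cartierPoly p σ (a ^ p * b) = a * cartierPoly p σ b := by
  induction a using MvPolynomial.induction_on generalizing b with
  | C c =>
    ext γ
    rw [← C_pow, ZMod.pow_card, coeff_cartierPoly, coeff_C_mul, coeff_C_mul, coeff_cartierPoly]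
  | add f g hf hg => rw [add_pow_char, add_mul, map_add, hf, hg, add_mul]
  | mul_X f i hf =>
    have (b : MvPolynomial σ (ZMod p)) : cartierPoly p σ (X i ^ p * b) =
        X i * cartierPoly p σ b := by
      ext γ
      have hX : (X i : MvPolynomial σ (ZMod p)) = monomial (Finsupp.single i 1) 1 := rfl
      rw [coeff_cartierPoly, hX, monomial_pow, coeff_monomial_mul', coeff_monomial_mul',
        coeff_cartierPoly, one_pow]
      have h1 : p • Finsupp.single i 1 ≤ p • γ ↔ Finsupp.single i 1 ≤ γ := by
        rw [Finsupp.le_def, Finsupp.le_def]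
        refine forall_congr' fun j => ?_
        simp only [Finsupp.smul_apply, smul_eq_mul]
        exact Nat.mul_le_mul_left_iff hp.out.pos
      have h2 : p • γ - p • Finsupp.single i 1 = p • (γ - Finsupp.single i 1) := by
        ext j
        simp only [Finsupp.tsub_apply, Finsupp.smul_apply, smul_eq_mul, Nat.mul_sub]
      simp only [h1, h2]
    rw [mul_pow, mul_assoc, hf, this, mul_assoc]

open MvPolynomial in
theorem exists_cartierPoly_monomial_mul (b : MvPolynomial σ (ZMod p)) (hb : b ≠ 0) :
    ∃ (β : σ →₀ ℕ) (c : ZMod p) (m : ℕ), c ≠ 0 ∧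
      (cartierPoly p σ)^[m] (monomial ((p ^ m - 1) • β) 1 * b) = monomial β c := by
  classical
  obtain ⟨β, hβ⟩ := MvPolynomial.ne_zero_iff.1 hb
  obtain ⟨m, hm⟩ := pow_unbounded_of_one_lt b.totalDegree hp.out.one_lt
  have hlt (γ : σ →₀ ℕ) (hγ : coeff γ b ≠ 0) (i : σ) : γ i < p ^ m := by
    refine lt_of_le_of_lt ?_ hm
    refine le_trans ?_ (le_totalDegree (mem_support_iff.2 hγ))
    by_cases h : i ∈ γ.support
    · exact Finset.single_le_sum (f := γ) (fun _ _ => Nat.zero_le _) h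
    · simp [Finsupp.notMem_support_iff.1 h]
  have hpos : 0 < p ^ m := Nat.pow_pos hp.out.pos
  refine ⟨β, coeff β b, m, hβ, ?_⟩
  ext γ
  rw [coeff_cartierPoly_iterate, coeff_monomial_mul', coeff_monomial, one_mul]
  by_cases h : β = γ
  · subst h
    rw [if_pos rfl, if_pos]
    · congr 1
      ext i
      simp only [Finsupp.tsub_apply, Finsupp.smul_apply, smul_eq_mul]
      rw [← Nat.sub_mul, Nat.sub_sub_self hpos, Nat.succ_mul, zero_mul, zero_add]
    · exact fun i => Nat.mul_le_mul_right _ (Nat.sub_le _ _)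
  · rw [if_neg h]
    split_ifs with hle
    · by_contra hne
      refine h (Finsupp.ext fun i => ?_)
      have h1 := hlt _ hne i
      have h2 := hlt _ hβ i
      have h3 := hle i
      simp only [Finsupp.tsub_apply, Finsupp.smul_apply, smul_eq_mul] at h1 h3
      generalize p ^ m = Q at *
      obtain ⟨q, rfl⟩ : ∃ q, Q = q + 1 := ⟨Q - 1, by omega⟩
      simp only [Nat.add_sub_cancel] at h1 h3
      rw [tsub_lt_iff_left h3] at h1
      rcases lt_trichotomy (β i) (γ i) with hl | hl | hl
      · nlinarith
      · exact hl
      · nlinarith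
    · rfl

end CartierPoly

/-- A `p`-inverse linear operator on a domain extends to its field of fractions. -/
theorem exists_extend_fractionRing {p : ℕ} (hp : 0 < p) {A F : Type*} [CommRing A] [IsDomain A]
    [Field F] [Algebra A F] [IsFractionRing A F] (R : A →+ A)
    (hR : ∀ a b, R (a ^ p * b) = a * R b) :
    ∃ R' : F →+ F, (∀ a b, R' (a ^ p * b) = a * R' b) ∧
      ∀ a, R' (algebraMap A F a) = algebraMap A F (R a) := by
  have hinj := IsFractionRing.injective A F
  have h0 (d : A) (hd : d ≠ 0) : algebraMap A F d ≠ 0 := by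
    simpa using hd
  have hex (z : F) : ∃ w : F, ∀ a d : A, d ≠ 0 → z = algebraMap A F a / algebraMap A F d →
      w = algebraMap A F (R (d ^ (p - 1) * a)) / algebraMap A F d := by
    obtain ⟨a', d', hd', rfl⟩ := IsFractionRing.div_surjective (A := A) z
    have hd' := nonZeroDivisors.ne_zero hd'
    refine ⟨algebraMap A F (R (d' ^ (p - 1) * a')) / algebraMap A F d', fun a d hd h => ?_⟩
    rw [div_eq_div_iff (h0 _ hd') (h0 _ hd), ← map_mul, ← map_mul] at h ⊢
    have h := hinj h
    congr 1
    rw [mul_comm, ← hR, mul_comm _ d', ← hR]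
    congr 1
    obtain ⟨q, rfl⟩ : ∃ q, p = q + 1 := ⟨p - 1, by omega⟩
    simp only [Nat.add_sub_cancel]
    linear_combination (d ^ q * d' ^ q) * h
  choose w hw using hex
  have hdiv (z : F) : ∃ a d : A, d ≠ 0 ∧ z = algebraMap A F a / algebraMap A F d := by
    obtain ⟨a', d', hd', rfl⟩ := IsFractionRing.div_surjective (A := A) z
    exact ⟨a', d', nonZeroDivisors.ne_zero hd', rfl⟩
  have hadd (x y : F) : w (x + y) = w x + w y := by
    obtain ⟨a, d, hd, rfl⟩ := hdiv x
    obtain ⟨b, e, he, rfl⟩ := hdiv y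
    have hde : d * e ≠ 0 := mul_ne_zero hd he
    rw [hw _ (a * e + b * d) (d * e) hde, hw _ (a * e) (d * e) hde, hw _ (b * d) (d * e) hde,
      mul_add, map_add, map_add, add_div]
    all_goals
      have := h0 _ hd
      have := h0 _ he
      simp only [map_mul, map_add]
      field_simp
  refine ⟨AddMonoidHom.mk' w hadd, fun x y => ?_, fun a => ?_⟩
  · change w _ = x * w y
    obtain ⟨a, d, hd, rfl⟩ := hdiv x
    obtain ⟨b, e, he, rfl⟩ := hdiv y
    have hd' := h0 _ hd
    have he' := h0 _ he
    rw [hw _ b e he rfl, hw _ (a ^ p * b) (d ^ p * e) (mul_ne_zero (pow_ne_zero _ hd) he) (by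
      simp only [map_mul, map_pow, div_pow]; field_simp)]
    have : (d ^ p * e) ^ (p - 1) * (a ^ p * b) = (a * d ^ (p - 1)) ^ p * (e ^ (p - 1) * b) := by
      simp only [mul_pow, ← pow_mul, mul_comm p (p - 1)]
      ring
    rw [this, hR]
    obtain ⟨q, rfl⟩ : ∃ q, p = q + 1 := ⟨p - 1, by omega⟩
    simp only [map_mul, map_pow, Nat.add_sub_cancel]
    field_simp
    ring
  · change w _ = _
    rw [hw _ a 1 one_ne_zero (by simp)]
    simp

/-- A `p`-inverse linear operator extends along finite separable extensions. -/
theorem exists_extend_separable {p : ℕ} [hp : Fact p.Prime] {F E : Type*} [Field F] [Field E]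
    [CharP F p] [Algebra F E] [FiniteDimensional F E] [Algebra.IsSeparable F E] (R : F →+ F)
    (hR : ∀ a b, R (a ^ p * b) = a * R b) :
    ∃ R' : E →+ E, (∀ a b, R' (a ^ p * b) = a * R' b) ∧
      ∀ a, R' (algebraMap F E a) = algebraMap F E (R a) := by
  have : CharP E p := charP_of_injective_algebraMap (algebraMap F E).injective p
  have : ExpChar F p := .prime hp.out
  have : ExpChar E p := .prime hp.out
  let b := Module.finBasis F E
  let b' := b.mapPowExpCharPowOfIsSeparable p 1
  have hb' (i) : b' i = b i ^ p := by
    simp [b', Module.Basis.mapPowExpCharPowOfIsSeparable]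
  let R' : E →+ E := AddMonoidHom.mk' (fun x => ∑ i, R (b'.repr x i) • b i) (fun x y => by
    simp [add_smul, Finset.sum_add_distrib])
  have h1 (c : F) (v : E) : R' (c • v ^ p) = R c • v := by
    have hv : v ^ p = ∑ i, (b.repr v i) ^ p • b' i := by
      conv_lhs => rw [← b.sum_repr v, sum_pow_char]
      simp only [smul_pow, hb']
    change ∑ i, R (b'.repr _ i) • b i = _
    conv_rhs => rw [← b.sum_repr v, Finset.smul_sum]
    refine Finset.sum_congr rfl fun i _ => ?_
    rw [hv, Finset.smul_sum]
    simp only [smul_smul]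
    rw [b'.repr_sum_self, mul_comm, hR, mul_comm]
  have h2 (x : E) : ∃ c : Fin (Module.finrank F E) → F, x = ∑ i, c i • b i ^ p :=
    ⟨b'.repr x, by simp only [← hb']; exact (b'.sum_repr x).symm⟩
  refine ⟨R', fun a x => ?_, fun a => ?_⟩
  · obtain ⟨c, rfl⟩ := h2 x
    rw [Finset.mul_sum, map_sum, map_sum, Finset.mul_sum]
    refine Finset.sum_congr rfl fun i _ => ?_
    rw [mul_smul_comm, ← mul_pow, h1, h1, mul_smul_comm]
  · have := h1 a 1
    rwa [one_pow, ← Algebra.algebraMap_eq_smul_one, ← Algebra.algebraMap_eq_smul_one] at this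

open MvPolynomial in
/-- A finitely generated field of characteristic `p` carries a Frobenius splitting which does not
degenerate outside of finitely many elements. -/
theorem exists_cartier_field (p : ℕ) [hp : Fact p.Prime] (K : Type*) [Field K] [Algebra (ZMod p) K]
    [Algebra.EssFiniteType (ZMod p) K] :
    ∃ (R : K →+ K) (X : Finset K), (∀ a b, R (a ^ p * b) = a * R b) ∧ R 1 = 1 ∧
      ∀ f ≠ 0, ∃ m, ∃ e ∈ Algebra.adjoin (ZMod p) ((X : Set K) ∪ {f}), R^[m] (e * f) = 1 := by
  classical
  obtain ⟨s, hs, hsep⟩ :=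
    exists_isTranscendenceBasis_and_isSeparable_of_perfectField (ZMod p) K
  have hcharK : CharP K p := charP_of_injective_algebraMap (algebraMap (ZMod p) _).injective p
  let F := IntermediateField.adjoin (ZMod p) (Set.range ((↑) : s → K))
  have hsep : Algebra.IsSeparable F K := by
    have e : Set.range ((↑) : s → K) = (s : Set K) := Subtype.range_coe
    rw [← e] at hsep
    exact hsep
  have : Algebra.EssFiniteType F K := Algebra.EssFiniteType.of_comp (ZMod p) F K
  have : Module.Finite F K := Algebra.finite_of_essFiniteType_of_isAlgebraic
  have hcharF : CharP F p := charP_of_injective_algebraMap (algebraMap (ZMod p) _).injective p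
  let A := MvPolynomial s (ZMod p)
  obtain ⟨R₁, hR₁, hRA⟩ := exists_extend_fractionRing hp.out.pos (F := FractionRing A)
    (cartierPoly p s) cartierPoly_pow_mul
  let ε := hs.1.aevalEquivField
  let R₂ : F →+ F := (ε.toRingHom.toAddMonoidHom.comp R₁).comp ε.symm.toRingHom.toAddMonoidHom
  have hR₂ (a : F) : R₂ a = ε (R₁ (ε.symm a)) := rfl
  obtain ⟨R, hR, hRF⟩ := exists_extend_separable (E := K) (p := p) R₂ fun a b => by
    simp only [hR₂, map_mul, map_pow, hR₁, AlgEquiv.apply_symm_apply]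
  have hpoly (f : A) : R (aeval (↑) f) = aeval ((↑) : s → K) (cartierPoly p s f) := by
    have h (f : A) : aeval ((↑) : s → K) f = algebraMap F K (ε (algebraMap A _ f)) := by
      rw [IntermediateField.algebraMap_apply, hs.1.aevalEquivField_algebraMap_apply_coe]
    rw [h, hRF, hR₂, AlgEquiv.symm_apply_apply, hRA, h]
  have hpolym (m : ℕ) (f : A) :
      R^[m] (aeval (↑) f) = aeval ((↑) : s → K) ((cartierPoly p s)^[m] f) := by
    induction m with
    | zero => rfl
    | succ m ih => rw [Function.iterate_succ_apply', ih, hpoly, Function.iterate_succ_apply']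
  have hRm (m : ℕ) (a b : K) : R^[m] (a ^ p ^ m * b) = a * R^[m] b := by
    induction m generalizing a b with
    | zero => simp
    | succ m ih => rw [Function.iterate_succ_apply, pow_succ, pow_mul, hR, ih,
        Function.iterate_succ_apply]
  refine ⟨R, s ∪ s.image (·⁻¹), hR, ?_, fun f hf => ?_⟩
  · have := hpoly 1
    rw [map_one] at this
    rw [this]
    convert map_one (aeval ((↑) : s → K))
    ext γ
    rw [coeff_cartierPoly, coeff_one, coeff_one]
    refine if_congr ?_ rfl rfl
    rw [eq_comm, eq_comm (a := (0 : s →₀ ℕ)), smul_eq_zero]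
    simp [hp.out.ne_zero]
  · have : Algebra.IsAlgebraic (Algebra.adjoin (ZMod p) (Set.range ((↑) : s → K))) K :=
      hs.isAlgebraic
    obtain ⟨t, ht, ⟨b, hb⟩, hb0, hft⟩ := (Algebra.IsAlgebraic.isAlgebraic
      (R := Algebra.adjoin (ZMod p) (Set.range ((↑) : s → K))) f).exists_nonzero_eq_adjoin_mul
      (mem_nonZeroDivisors_of_ne_zero hf)
    rw [Algebra.adjoin_range_eq_range_aeval] at hb
    obtain ⟨b, rfl⟩ := hb
    have hft : f * t = aeval ((↑) : s → K) b := hft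
    have hb0 : b ≠ 0 := by
      rintro rfl
      exact hb0 (Subtype.ext (map_zero _))
    obtain ⟨β, c, m, hc, hm⟩ := exists_cartierPoly_monomial_mul b hb0
    have hs0 (i : s) : (i : K) ≠ 0 := by
      have := hs.1.ne_zero i
      exact this
    have hβ0 : aeval ((↑) : s → K) (monomial β (1 : ZMod p)) ≠ 0 := by
      rw [aeval_monomial, map_one, one_mul]
      exact Finset.prod_ne_zero_iff.2 fun i _ => pow_ne_zero _ (hs0 i)
    set xβ := aeval ((↑) : s → K) (monomial β (1 : ZMod p)) with hxβ
    have hc' : algebraMap (ZMod p) K c ≠ 0 := by simpa using hc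
    have hcm : aeval ((↑) : s → K) (monomial β c) = algebraMap _ _ c * xβ := by
      rw [hxβ, aeval_monomial, aeval_monomial, map_one, one_mul]
    have hβm : aeval ((↑) : s → K) (monomial ((p ^ m - 1) • β) (1 : ZMod p)) = xβ ^ (p ^ m - 1) := by
      rw [hxβ, ← map_pow, monomial_pow, one_pow]
    set S := Algebra.adjoin (ZMod p) (((s ∪ s.image (·⁻¹) : Finset K) : Set K) ∪ {f})
    have hSx : xβ⁻¹ ∈ S := by
      rw [hxβ, aeval_monomial, map_one, one_mul, Finsupp.prod, ← Finset.prod_inv_distrib]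
      refine S.prod_mem fun i _ => ?_
      rw [← inv_pow]
      refine S.pow_mem (Algebra.subset_adjoin (Or.inl ?_)) _
      simp
    have hSx' : xβ ∈ S := by
      rw [hxβ, aeval_monomial, map_one, one_mul, Finsupp.prod]
      refine S.prod_mem fun i _ => S.pow_mem (Algebra.subset_adjoin (Or.inl ?_)) _
      simp
    have hSt : t ∈ S := by
      have : t ∈ (Algebra.adjoin (Algebra.adjoin (ZMod p) (Set.range ((↑) : s → K)))
        {f}).restrictScalars (ZMod p) := ht
      rw [← Algebra.adjoin_union_eq_adjoin_adjoin] at this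
      refine Algebra.adjoin_mono ?_ this
      refine Set.union_subset_union_left _ ?_
      simp
    refine ⟨m, (algebraMap _ _ c⁻¹ * xβ⁻¹) ^ p ^ m * (xβ ^ (p ^ m - 1) * t), ?_, ?_⟩
    · exact mul_mem (pow_mem (mul_mem (Subalgebra.algebraMap_mem _ _) hSx) _)
        (mul_mem (pow_mem hSx' _) hSt)
    · rw [mul_assoc, hRm, mul_assoc, mul_assoc (xβ ^ _), mul_comm t, hft, ← hβm, ← map_mul, hpolym, hm, hcm, map_inv₀]
      field_simp

/-- An endomorphism of a field of finite transcendence degree maps transcendence bases to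
transcendence bases. -/
theorem IsTranscendenceBasis.comp_endomorphism {k : Type*} {ι K : Type u} [Finite ι] [Field k] [Field K]
    [Algebra k K] {x : ι → K} (hx : IsTranscendenceBasis k x) (φ : K →ₐ[k] K) :
    IsTranscendenceBasis k (φ ∘ x) := by
  have h : AlgebraicIndependent k (φ ∘ x) := hx.1.map' φ.toRingHom.injective
  exact h.isTranscendenceBasis_of_trdeg_le_of_finite hx.cardinalMk_eq_trdeg.ge

theorem exists_separable_subfield {p : ℕ} [hp : Fact p.Prime] {K : Type u} [Field K]
    [Algebra (ZMod p) K] [Algebra.EssFiniteType (ZMod p) K] (φ : K →ₐ[ZMod p] K) (R : K →+ K)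
    (hR : ∀ a b, R (a ^ p * b) = a * R b) :
    ∃ (L : IntermediateField (ZMod p) K) (φ' : K →ₐ[ZMod p] L) (RL : L →+ L) (r : ℕ),
      (∀ a, (φ' a : K) = φ a) ∧ (∀ a : K, a ^ p ^ r ∈ L) ∧ Algebra.EssFiniteType (ZMod p) L ∧
      (∀ a b, RL (a ^ p * b) = a * RL b) ∧ ∀ a, RL (φ' a) = φ' (R a) := by
  have hcharK : CharP K p := charP_of_injective_algebraMap (algebraMap (ZMod p) _).injective p
  let F := φ.fieldRange
  have hcharF : CharP F p := charP_of_injective_algebraMap (algebraMap (ZMod p) _).injective p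
  have : ExpChar F p := .prime hp.out
  have hess : Algebra.EssFiniteType F K := Algebra.EssFiniteType.of_comp (ZMod p) F K
  have halg : Algebra.IsAlgebraic F K := by
    obtain ⟨s, hs, -⟩ := exists_isTranscendenceBasis_and_isSeparable_of_perfectField (ZMod p) K
    have h1 := (hs.comp_endomorphism φ).isAlgebraic_field
    have hle : IntermediateField.adjoin (ZMod p) (Set.range (φ ∘ ((↑) : s → K))) ≤ F := by
      rw [IntermediateField.adjoin_le_iff]
      rintro _ ⟨y, rfl⟩
      exact ⟨_, rfl⟩
    refine ⟨fun x => ?_⟩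
    obtain ⟨P, hP, hPx⟩ := h1.isAlgebraic x
    refine ⟨P.map (IntermediateField.inclusion hle).toRingHom, ?_, ?_⟩
    · rwa [Polynomial.map_ne_zero_iff (IntermediateField.inclusion hle).toRingHom.injective]
    · rw [Polynomial.aeval_def, Polynomial.eval₂_map]
      exact hPx
  have : Module.Finite F K := Algebra.finite_of_essFiniteType_of_isAlgebraic
  let L₀ := separableClosure F K
  obtain ⟨r, hr⟩ : ∃ r, ∀ a : K, a ^ p ^ r ∈ L₀ := by
    refine ⟨IsPurelyInseparable.exponent L₀ K, fun a => ?_⟩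
    have : ExpChar L₀ p := expChar_of_injective_algebraMap (algebraMap F L₀).injective p
    obtain ⟨b, hb⟩ := IsPurelyInseparable.exponent_def' (K := L₀) p a
    rw [← hb]
    exact b.2
  let e : K ≃ₐ[ZMod p] F := AlgEquiv.ofInjectiveField φ
  let RF : F →+ F := (e.toRingEquiv.toRingHom.toAddMonoidHom.comp R).comp
    e.symm.toRingEquiv.toRingHom.toAddMonoidHom
  have hRF (a : F) : RF a = e (R (e.symm a)) := rfl
  obtain ⟨RL, hRL, hRLF⟩ := exists_extend_separable (E := L₀) (p := p) RF fun a b => by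
    simp only [hRF, map_mul, map_pow, hR, AlgEquiv.apply_symm_apply]
  have hessF : Algebra.EssFiniteType (ZMod p) F := by
    let _ : Algebra K F := e.toAlgHom.toRingHom.toAlgebra
    have : IsScalarTower (ZMod p) K F := IsScalarTower.of_algebraMap_eq fun c => (e.commutes c).symm
    have : Algebra.FiniteType K F := Algebra.FiniteType.of_surjective (Algebra.ofId K F) e.surjective
    exact Algebra.EssFiniteType.comp (ZMod p) K F
  refine ⟨L₀.restrictScalars (ZMod p), (φ.codRestrict (L₀.restrictScalars (ZMod p)).toSubalgebra
    fun a => L₀.algebraMap_mem (e a)), RL, r, fun a => rfl, hr, ?_, hRL, fun a => ?_⟩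
  · have : Algebra.EssFiniteType (ZMod p) L₀ := Algebra.EssFiniteType.comp (ZMod p) F L₀
    exact this
  · have := hRLF (e a)
    rw [hRF, AlgEquiv.symm_apply_apply] at this
    exact this

/-- Every `p⁻ⁿ`-linear functional is of the form `R ^ n (g * ·)`. -/
theorem exists_duality {p : ℕ} [hp : Fact p.Prime] {K L : Type*} [Field K] [Field L]
    [Algebra (ZMod p) K] [Algebra (ZMod p) L] [Algebra.EssFiniteType (ZMod p) L]
    (i : L →ₐ[ZMod p] K) (n : ℕ) (τ : K →ₐ[ZMod p] L) (hτ : ∀ a, i (τ a) = a ^ p ^ n)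
    (R : K →+ K) (hR : ∀ a b, R (i (τ a) * b) = a * R b) (hR1 : R 1 = 1)
    (Λ : L →+ K) (hΛ : ∀ a b, Λ (τ a * b) = a * Λ b) : ∃ g, ∀ h, R (i (g * h)) = Λ h := by
  let _ : Algebra K L := τ.toRingHom.toAlgebra
  have hsmul (a : K) (b : L) : a • b = τ a * b := rfl
  have : IsScalarTower (ZMod p) K L := IsScalarTower.of_algebraMap_eq fun c => (τ.commutes c).symm
  have : Algebra.EssFiniteType K L := Algebra.EssFiniteType.of_comp (ZMod p) K L
  have : Algebra.IsIntegral K L := ⟨fun a => by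
    refine IsIntegral.of_pow (n := p ^ n) (Nat.pow_pos hp.out.pos) ?_
    have : a ^ p ^ n = algebraMap K L (i a) :=
      i.toRingHom.injective (by change i _ = i (τ (i a)); rw [hτ, map_pow])
    rw [this]
    exact isIntegral_algebraMap⟩
  have : Module.Finite K L := Algebra.finite_of_essFiniteType_of_isAlgebraic
  let T : L →ₗ[K] Module.Dual K L := LinearMap.mk₂ K (fun g h => R (i (g * h)))
    (fun a b c => by rw [add_mul, map_add, map_add])
    (fun a b c => by rw [hsmul, mul_assoc, map_mul, hR, smul_eq_mul])
    (fun a b c => by rw [mul_add, map_add, map_add])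
    (fun a b c => by rw [hsmul, mul_left_comm, map_mul, hR, smul_eq_mul])
  have hT (g h : L) : T g h = R (i (g * h)) := rfl
  have hinj : Function.Injective T := by
    rw [injective_iff_map_eq_zero]
    intro g hg
    by_contra hne
    have := LinearMap.congr_fun hg g⁻¹
    rw [hT, mul_inv_cancel₀ hne, map_one, hR1] at this
    exact one_ne_zero this
  obtain ⟨g, hg⟩ := (LinearMap.injective_iff_surjective_of_finrank_eq_finrank
    (Subspace.dual_finrank_eq (K := K) (V := L)).symm).1 hinj
    ⟨⟨Λ, map_add Λ⟩, fun a b => by simp [hsmul, hΛ]⟩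
  exact ⟨g, fun h => LinearMap.congr_fun hg h⟩

/-- The values at `G` of polynomials of total degree at most `j`. -/
def filt (p : ℕ) [Fact p.Prime] {A σ : Type*} [CommRing A] [Algebra (ZMod p) A] (G : σ → A)
    (j : ℕ) : Submodule (ZMod p) A :=
  (MvPolynomial.restrictTotalDegree σ (ZMod p) j).map (MvPolynomial.aeval G).toLinearMap

section Filt

variable {p : ℕ} [hp : Fact p.Prime] {A σ : Type*} [CommRing A] [Algebra (ZMod p) A] {G : σ → A}

open MvPolynomial

theorem mem_filt {j : ℕ} {x : A} :
    x ∈ filt p G j ↔ ∃ f : MvPolynomial σ (ZMod p), f.totalDegree ≤ j ∧ aeval G f = x := by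
  simp [filt, Submodule.mem_map, mem_restrictTotalDegree]

theorem filt_mono : Monotone (filt p G) := fun i j hij x hx => by
  obtain ⟨f, hf, rfl⟩ := mem_filt.1 hx
  exact mem_filt.2 ⟨f, hf.trans hij, rfl⟩

theorem one_mem_filt (j : ℕ) : (1 : A) ∈ filt p G j := mem_filt.2 ⟨1, by simp, by simp⟩

theorem filt_mul {a b : ℕ} {x y : A} (hx : x ∈ filt p G a) (hy : y ∈ filt p G b) :
    x * y ∈ filt p G (a + b) := by
  obtain ⟨f, hf, rfl⟩ := mem_filt.1 hx
  obtain ⟨g, hg, rfl⟩ := mem_filt.1 hy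
  exact mem_filt.2 ⟨f * g, (totalDegree_mul _ _).trans (add_le_add hf hg), map_mul _ _ _⟩

theorem filt_pow {a : ℕ} {x : A} (hx : x ∈ filt p G a) (n : ℕ) : x ^ n ∈ filt p G (n * a) := by
  induction n with
  | zero => simpa using one_mem_filt _
  | succ n ih =>
    rw [pow_succ, Nat.succ_mul]
    exact filt_mul ih hx

theorem gen_mem_filt (i : σ) : G i ∈ filt p G 1 := mem_filt.2 ⟨X i, by simp, by simp⟩

theorem exists_mem_filt {x : A} : (∃ j, x ∈ filt p G j) ↔ x ∈ Algebra.adjoin (ZMod p) (Set.range G) := by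
  rw [Algebra.adjoin_range_eq_range_aeval]
  constructor
  · rintro ⟨j, hj⟩
    obtain ⟨f, -, rfl⟩ := mem_filt.1 hj
    exact ⟨f, rfl⟩
  · rintro ⟨f, rfl⟩
    exact ⟨_, mem_filt.2 ⟨f, le_rfl, rfl⟩⟩

theorem monomial_mem_filt [Finite σ] {j : ℕ} {α : σ →₀ ℕ} (h : α.degree ≤ j) :
    (α.prod fun i n => G i ^ n) ∈ filt p G j :=
  mem_filt.2 ⟨monomial α 1, (totalDegree_monomial_le _ _).trans h, by simp [aeval_monomial]⟩

theorem filt_induction {j : ℕ} {P : A → Prop} (h0 : P 0) (hadd : ∀ x y, P x → P y → P (x + y))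
    (hsmul : ∀ (c : ZMod p) x, P x → P (c • x))
    (hmon : ∀ α : σ →₀ ℕ, α.degree ≤ j → P (α.prod fun i n => G i ^ n)) {x : A}
    (hx : x ∈ filt p G j) : P x := by
  obtain ⟨f, hf, rfl⟩ := mem_filt.1 hx
  rw [f.as_sum, map_sum]
  refine Finset.sum_induction _ P (fun x y => hadd x y) h0 fun α hα => ?_
  rw [aeval_monomial, ← Algebra.smul_def]
  exact hsmul _ _ (hmon α ((le_totalDegree hα).trans hf))

theorem finiteDimensional_filt [Finite σ] (j : ℕ) : FiniteDimensional (ZMod p) (filt p G j) := by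
  have : Module.Finite (ZMod p) (restrictTotalDegree σ (ZMod p) j) := inferInstance
  exact Module.Finite.map _ _

theorem map_filt {B τ : Type*} [CommRing B] [Algebra (ZMod p) B] {H : τ → B} (f : A →ₐ[ZMod p] B)
    (s : B) (d : ℕ) (hs : s ∈ filt p H d) (h : ∀ i, s * f (G i) ∈ filt p H d) {j : ℕ} {x : A}
    (hx : x ∈ filt p G j) : s ^ j * f x ∈ filt p H (d * j) := by
  refine filt_induction (P := fun x => s ^ j * f x ∈ filt p H (d * j)) (by simp)
    (fun x y hx hy => by rw [map_add, mul_add]; exact add_mem hx hy)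
    (fun c x hx => by rw [map_smul, mul_smul_comm]; exact Submodule.smul_mem _ _ hx)
    (fun α hα => ?_) hx
  have key (α : σ →₀ ℕ) :
      s ^ α.degree * f (α.prod fun i n => G i ^ n) ∈ filt p H (d * α.degree) := by
    induction α using Finsupp.induction_linear with
    | zero => simpa using one_mem_filt _
    | add α β hα hβ =>
      classical
      rw [Finsupp.prod_add_index' (by simp) (fun _ _ _ => pow_add _ _ _), map_mul, map_add, mul_add,
        pow_add, mul_mul_mul_comm]
      exact filt_mul hα hβ
    | single i n =>
      rw [Finsupp.degree_single, Finsupp.prod_single_index (by simp), map_pow, ← mul_pow, mul_comm]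
      exact filt_pow (h i) n
  obtain ⟨k, rfl⟩ := Nat.exists_eq_add_of_le hα
  rw [pow_add, mul_right_comm, mul_add, mul_comm d k]
  exact filt_mul (key α) (filt_pow hs k)

/-- A `p`-inverse linear operator is determined up to `p`-th powers by finitely many values. -/
theorem exists_reduced_values [Finite σ] (Λ : A →+ A) (hΛ : ∀ a b, Λ (a ^ p * b) = a * Λ b) :
    ∃ Y : Finset A, (∀ y ∈ Y, ∃ x ∈ Algebra.adjoin (ZMod p) (Set.range G), Λ x = y) ∧
      ∀ {j : ℕ} {x : A}, x ∈ filt p G j →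
      ∀ {δ : A} {c : ℕ}, (∀ y ∈ Y, δ * y ∈ filt p G c) → δ * Λ x ∈ filt p G (j / p + c) := by
  have := Fintype.ofFinite σ
  have hfin : {α : σ →₀ ℕ | ∀ i, α i < p}.Finite :=
    (Set.Finite.pi' fun _ : σ => Set.finite_lt_nat p).preimage DFunLike.coe_injective.injOn
  refine ⟨(hfin.image fun α : σ →₀ ℕ => Λ (α.prod fun i n => G i ^ n)).toFinset, ?_, ?_⟩
  · intro y hy
    obtain ⟨α, -, rfl⟩ := (Set.Finite.mem_toFinset _).1 hy
    exact ⟨_, exists_mem_filt.1 ⟨_, monomial_mem_filt le_rfl⟩, rfl⟩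
  intro j x hx δ c hδ
  refine filt_induction (P := fun x => δ * Λ x ∈ filt p G (j / p + c)) (by simp)
    (fun x y hx hy => by rw [map_add, mul_add]; exact add_mem hx hy)
    (fun c x hx => by
      rw [← AddMonoidHom.coe_toZModLinearMap p Λ, map_smul, mul_smul_comm]
      exact Submodule.smul_mem _ _ hx)
    (fun α hα => ?_) hx
  let q : σ →₀ ℕ := α.mapRange (· / p) (by simp)
  let r : σ →₀ ℕ := α.mapRange (· % p) (by simp)
  have hα' : α = p • q + r := by
    ext i
    simp only [q, r, Finsupp.add_apply, Finsupp.smul_apply, Finsupp.mapRange_apply, smul_eq_mul]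
    exact (Nat.div_add_mod _ _).symm
  have hq : q.degree ≤ j / p := by
    rw [Nat.le_div_iff_mul_le hp.out.pos]
    refine le_trans ?_ hα
    rw [hα', map_add, map_nsmul, smul_eq_mul, mul_comm]
    exact Nat.le_add_right _ _
  have hprod : (α.prod fun i n => G i ^ n) =
      (q.prod fun i n => G i ^ n) ^ p * r.prod fun i n => G i ^ n := by
    classical
    conv_lhs => rw [hα', Finsupp.prod_add_index' (by simp) (fun _ _ _ => pow_add _ _ _)]
    congr 1
    rw [Finsupp.prod_fintype _ _ (by simp), Finsupp.prod_fintype _ _ (by simp), ← Finset.prod_pow]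
    refine Finset.prod_congr rfl fun i _ => ?_
    rw [Finsupp.smul_apply, smul_eq_mul, mul_comm, pow_mul]
  rw [hprod, hΛ, mul_left_comm]
  refine filt_mul (monomial_mem_filt hq) (hδ _ ?_)
  simp only [Set.Finite.mem_toFinset]
  exact ⟨r, fun i => Nat.mod_lt _ hp.out.pos, rfl⟩

end Filt

section BuildCartierData

variable {p : ℕ} [hp : Fact p.Prime] {K : Type*} [Field K]

theorem exists_pow_mul_mem_of_adjoin {k A : Type*} [CommRing k] [CommRing A] [Algebra k A]
    {A₀ : Subalgebra k A} {δ : A} (hδ : δ ∈ A₀) {S : Set A} (hS : ∀ z ∈ S, ∃ n, δ ^ n * z ∈ A₀)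
    {x : A} (hx : x ∈ Algebra.adjoin k S) : ∃ n, δ ^ n * x ∈ A₀ := by
  induction hx using Algebra.adjoin_induction with
  | mem x hx => exact hS x hx
  | algebraMap c => exact ⟨0, by simp⟩
  | add x y _ _ hx hy =>
    obtain ⟨n, hn⟩ := hx
    obtain ⟨m, hm⟩ := hy
    refine ⟨n + m, ?_⟩
    rw [show δ ^ (n + m) * (x + y) = δ ^ m * (δ ^ n * x) + δ ^ n * (δ ^ m * y) by ring]
    exact add_mem (mul_mem (pow_mem hδ _) hn) (mul_mem (pow_mem hδ _) hm)
  | mul x y _ _ hx hy =>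
    obtain ⟨n, hn⟩ := hx
    obtain ⟨m, hm⟩ := hy
    refine ⟨n + m, ?_⟩
    rw [show δ ^ (n + m) * (x * y) = (δ ^ n * x) * (δ ^ m * y) by ring]
    exact mul_mem hn hm

theorem exists_fraction_of_essFiniteType (k K : Type*) [CommRing k] [Field K] [Algebra k K]
    [Algebra.EssFiniteType k K] : ∃ S : Finset K, ∀ z : K,
      ∃ a ∈ Algebra.adjoin k (S : Set K), ∃ b ∈ Algebra.adjoin k (S : Set K), b ≠ 0 ∧ b * z = a := by
  obtain ⟨S, hS⟩ := Algebra.EssFiniteType.cond (R := k) (S := K)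
  refine ⟨S, fun z => ?_⟩
  obtain ⟨⟨a, b⟩, h⟩ := IsLocalization.surj
    ((IsUnit.submonoid K).comap (algebraMap (Algebra.adjoin k (S : Set K)) K)) z
  refine ⟨a, a.2, (b : Algebra.adjoin k (S : Set K)), Subtype.property _, ?_, ?_⟩
  · exact IsUnit.ne_zero b.2
  · rw [mul_comm]
    exact h

/-- Finitely many fractions have a common denominator. -/
theorem exists_common_denominator {k K : Type*} [CommRing k] [Field K] [Algebra k K]
    {A : Subalgebra k K} (hA : ∀ z : K, ∃ b ∈ A, b ≠ 0 ∧ b * z ∈ A) (Y : Finset K) :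
    ∃ δ ∈ A, δ ≠ 0 ∧ ∀ y ∈ Y, δ * y ∈ A := by
  choose b hb hb0 hbz using hA
  refine ⟨∏ y ∈ Y, b y, prod_mem fun y _ => hb y, Finset.prod_ne_zero_iff.2 fun y _ => hb0 y, ?_⟩
  intro y hy
  classical
  rw [← Finset.mul_prod_erase Y b hy, mul_right_comm]
  exact mul_mem (hbz y) (prod_mem fun y _ => hb y)

variable [Algebra (ZMod p) K]

theorem map_mem_of_localization {A₀ A₁ : Subalgebra (ZMod p) K} (h01 : A₀ ≤ A₁) (Λ : K →+ K)
    (hΛ : ∀ a b, Λ (a ^ p * b) = a * Λ b) {δ : K} (hδ : δ ∈ A₀) (hδ0 : δ ≠ 0) (hδ1 : δ⁻¹ ∈ A₁)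
    (h0 : ∀ x ∈ A₀, δ * Λ x ∈ A₀) (h1 : ∀ x ∈ A₁, ∃ n, δ ^ n * x ∈ A₀) {x : K} (hx : x ∈ A₁) :
    Λ x ∈ A₁ := by
  obtain ⟨n, hn⟩ := h1 x hx
  have hn' : δ ^ (p * n) * x ∈ A₀ := by
    obtain ⟨q, hq⟩ := Nat.exists_eq_add_of_le (Nat.le_mul_of_pos_left n hp.out.pos)
    rw [hq, pow_add, mul_right_comm]
    exact mul_mem hn (pow_mem hδ _)
  have h := h0 _ hn'
  rw [mul_comm p, pow_mul, hΛ] at h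
  have : Λ x = (δ⁻¹) ^ (n + 1) * (δ * (δ ^ n * Λ x)) := by
    rw [pow_succ, inv_pow]
    field_simp
  rw [this]
  exact mul_mem (pow_mem hδ1 _) (h01 h)

theorem exists_uniform_filt {σ A : Type*} [CommRing A] [Algebra (ZMod p) A] {G : σ → A}
    (Y : Finset A) (hY : ∀ y ∈ Y, y ∈ Algebra.adjoin (ZMod p) (Set.range G)) :
    ∃ c, ∀ y ∈ Y, y ∈ filt p G c := by
  have h (y : Y) : ∃ c, (y : A) ∈ filt p G c := exists_mem_filt.2 (hY y y.2)
  choose c hc using h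
  refine ⟨Y.attach.sup c, fun y hy => ?_⟩
  exact filt_mono (Finset.le_sup (f := c) (Finset.mem_attach Y ⟨y, hy⟩)) (hc ⟨y, hy⟩)

theorem exists_filt_bound {σ : Type*} [Finite σ] {G : σ → K} (Λ : K →+ K)
    (hΛ : ∀ a b, Λ (a ^ p * b) = a * Λ b)
    (h : ∀ x ∈ Algebra.adjoin (ZMod p) (Set.range G), Λ x ∈ Algebra.adjoin (ZMod p) (Set.range G)) :
    ∃ c, ∀ {j x}, x ∈ filt p G j → Λ x ∈ filt p G (j / p + c) := by
  obtain ⟨Y, hY, hY'⟩ := exists_reduced_values (G := G) Λ hΛ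
  obtain ⟨c, hc⟩ := exists_uniform_filt (G := G) Y (by
    intro y hy
    obtain ⟨x, hx, rfl⟩ := hY y hy
    exact h x hx)
  refine ⟨c, fun hx => ?_⟩
  have := hY' hx (δ := 1) (c := c) (by simpa using hc)
  simpa using this

theorem exists_denominator_values {S : Finset K} (Λ : K →+ K)
    (hΛ : ∀ a b, Λ (a ^ p * b) = a * Λ b) :
    ∃ Y : Finset K, ∀ δ, (∀ y ∈ Y, δ * y ∈ Algebra.adjoin (ZMod p) (S : Set K)) →
      ∀ x ∈ Algebra.adjoin (ZMod p) (S : Set K), δ * Λ x ∈ Algebra.adjoin (ZMod p) (S : Set K) := by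
  have hr : Set.range (Subtype.val : S → K) = S := Subtype.range_coe
  obtain ⟨Y, -, hY'⟩ := exists_reduced_values (G := (Subtype.val : S → K)) Λ hΛ
  classical
  refine ⟨Y, fun δ hδ x hx => ?_⟩
  rw [← hr] at hx hδ ⊢
  obtain ⟨j, hj⟩ := exists_mem_filt.2 hx
  obtain ⟨c, hc⟩ := exists_uniform_filt (G := (Subtype.val : S → K)) (Y.image (δ * ·)) (by
    intro y hy
    obtain ⟨x, hx, rfl⟩ := Finset.mem_image.1 hy
    exact hδ x hx)
  exact exists_mem_filt.1 ⟨_, hY' hj fun y hy => hc _ (Finset.mem_image_of_mem _ hy)⟩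

end BuildCartierData

section BuildCartierData

variable {p : ℕ} [hp : Fact p.Prime] {K L : Type*} [Field K] [Field L] [Algebra (ZMod p) K]
  [Algebra (ZMod p) L]

/-- The iterated Frobenius, as a morphism of algebras over the prime field. -/
def powAlgHom (p : ℕ) [hp : Fact p.Prime] (K : Type*) [Field K] [Algebra (ZMod p) K] (r : ℕ) :
    K →ₐ[ZMod p] K where
  toFun x := x ^ p ^ r
  map_one' := one_pow _
  map_mul' x y := mul_pow x y _
  map_zero' := zero_pow (pow_pos hp.out.pos r).ne'
  map_add' x y := by
    have : CharP K p := charP_of_injective_algebraMap (algebraMap (ZMod p) _).injective p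
    exact add_pow_char_pow x y p r
  commutes' c := by rw [← map_pow, ZMod.pow_card_pow]

theorem powAlgHom_apply (r : ℕ) (x : K) : powAlgHom p K r x = x ^ p ^ r := rfl

/-- The finitely generated rings on which the operators of a `CartierData` act. -/
theorem exists_stable_generators (i : L →ₐ[ZMod p] K) {r : ℕ} (τ : K →ₐ[ZMod p] L)
    (hτ : ∀ a, i (τ a) = a ^ p ^ r)
    (R : K →+ K) (hR : ∀ a b, R (a ^ p * b) = a * R b) (RL : L →+ L)
    (hRL : ∀ a b, RL (a ^ p * b) = a * RL b) [Algebra.EssFiniteType (ZMod p) K]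
    [Algebra.EssFiniteType (ZMod p) L] (X : Finset K) (Y : Finset L) :
    ∃ (TK : Finset K) (TL : Finset L), X ⊆ TK ∧ Y ⊆ TL ∧ (∀ l ∈ TL, i l ∈ TK) ∧
      (∀ z ∈ TK, τ z ∈ TL ∨ ∃ l ∈ TL, i l = z) ∧
      (∀ z : L, ∃ b ∈ Algebra.adjoin (ZMod p) (TL : Set L), b ≠ 0 ∧
        b * z ∈ Algebra.adjoin (ZMod p) (TL : Set L)) ∧
      (∀ x ∈ Algebra.adjoin (ZMod p) (TK : Set K), R x ∈ Algebra.adjoin (ZMod p) (TK : Set K)) ∧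
      ∀ x ∈ Algebra.adjoin (ZMod p) (TL : Set L), RL x ∈ Algebra.adjoin (ZMod p) (TL : Set L) := by
  classical
  obtain ⟨SL, hSL⟩ := exists_fraction_of_essFiniteType (ZMod p) L
  obtain ⟨SK, hSK⟩ := exists_fraction_of_essFiniteType (ZMod p) K
  let TL0 := SL ∪ Y
  let TK0 := X ∪ SK ∪ TL0.image i
  let TL1 := TL0 ∪ TK0.image τ
  set A0 := Algebra.adjoin (ZMod p) (TK0 : Set K) with hA0
  set A1 := Algebra.adjoin (ZMod p) (TL1 : Set L) with hA1
  have hfrac : ∀ z : L, ∃ b ∈ A1, b ≠ 0 ∧ b * z ∈ A1 := fun z => by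
    obtain ⟨a, ha, b, hb, hb0, h⟩ := hSL z
    have hle : Algebra.adjoin (ZMod p) (SL : Set L) ≤ A1 := Algebra.adjoin_mono (by
      intro z hz; simp only [TL1, TL0, Finset.coe_union]; exact Or.inl (Or.inl hz))
    exact ⟨b, hle hb, hb0, h ▸ hle ha⟩
  have hτA : ∀ a ∈ A0, τ a ∈ A1 := fun a ha => by
    have : A0.map τ ≤ A1 := by
      rw [hA0, AlgHom.map_adjoin]
      refine Algebra.adjoin_mono ?_
      rintro _ ⟨z, hz, rfl⟩
      exact Finset.mem_union_right _ (Finset.mem_image_of_mem _ hz)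
    exact this ⟨a, ha, rfl⟩
  have hiA : ∀ l ∈ A1, i l ∈ A0 := fun l hl => by
    have : A1.map i ≤ A0 := by
      rw [hA1, AlgHom.map_adjoin, Algebra.adjoin_le_iff]
      rintro _ ⟨z, hz, rfl⟩
      rcases Finset.mem_union.1 hz with hz | hz
      · exact Algebra.subset_adjoin (Finset.mem_union_right _ (Finset.mem_image_of_mem _ hz))
      · obtain ⟨y, hy, rfl⟩ := Finset.mem_image.1 hz
        rw [hτ]
        exact pow_mem (Algebra.subset_adjoin hy) _
    exact this ⟨l, hl, rfl⟩
  have hfracK : ∀ z : K, ∃ b ∈ A1, b ≠ 0 ∧ i b * z ∈ A0 := fun z => by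
    obtain ⟨a, ha, b, hb, hb0, h⟩ := hSK z
    have hle : Algebra.adjoin (ZMod p) (SK : Set K) ≤ A0 := Algebra.adjoin_mono (by
      intro z hz; simp only [TK0, Finset.coe_union]; exact Or.inl (Or.inr hz))
    refine ⟨τ b, hτA _ (hle hb), (map_ne_zero τ).2 hb0, ?_⟩
    obtain ⟨q, hq⟩ := Nat.exists_eq_succ_of_ne_zero (pow_pos hp.out.pos r).ne'
    rw [hτ, hq, pow_succ, mul_assoc, h]
    exact mul_mem (pow_mem (hle hb) _) (hle ha)
  obtain ⟨YL, hYL⟩ := exists_denominator_values (S := TL1) RL hRL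
  obtain ⟨YK, hYK⟩ := exists_denominator_values (S := TK0) R hR
  obtain ⟨δ₁, hδ₁, hδ₁0, hδ₁Y⟩ := exists_common_denominator hfrac YL
  choose b hb hb0 hbz using hfracK
  let δ := δ₁ * ∏ y ∈ YK, b y
  have hprod : ∏ y ∈ YK, b y ∈ A1 := prod_mem fun y _ => hb y
  have hδ : δ ∈ A1 := mul_mem hδ₁ hprod
  have hδ0 : δ ≠ 0 := mul_ne_zero hδ₁0 (Finset.prod_ne_zero_iff.2 fun y _ => hb0 y)
  have hδL : ∀ y ∈ YL, δ * y ∈ A1 := fun y hy => by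
    simp only [δ]
    rw [mul_right_comm]
    exact mul_mem (hδ₁Y y hy) hprod
  have hδK : ∀ y ∈ YK, i δ * y ∈ A0 := fun y hy => by
    simp only [δ]
    rw [← Finset.mul_prod_erase YK b hy, map_mul, map_mul, mul_assoc, mul_right_comm]
    exact mul_mem (hiA _ hδ₁) (mul_mem (hbz y) (hiA _ (prod_mem fun y _ => hb y)))
  let TL := insert δ⁻¹ TL1
  let TK := TK0 ∪ TL.image i
  have hLle : A1 ≤ Algebra.adjoin (ZMod p) (TL : Set L) :=
    Algebra.adjoin_mono (by simp only [TL, Finset.coe_insert]; exact Set.subset_insert _ _)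
  have hKle : A0 ≤ Algebra.adjoin (ZMod p) (TK : Set K) :=
    Algebra.adjoin_mono (by simp only [TK, Finset.coe_union]; exact Set.subset_union_left)
  refine ⟨TK, TL, ?_, ?_, ?_, ?_, ?_, ?_, ?_⟩
  · exact fun x hx => Finset.mem_union_left _ (Finset.mem_union_left _ (Finset.mem_union_left _ hx))
  · exact fun x hx => Finset.mem_insert_of_mem (Finset.mem_union_left _ (Finset.mem_union_right _ hx))
  · exact fun l hl => Finset.mem_union_right _ (Finset.mem_image_of_mem _ hl)
  · intro z hz
    rcases Finset.mem_union.1 hz with hz | hz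
    · exact Or.inl (Finset.mem_insert_of_mem
        (Finset.mem_union_right _ (Finset.mem_image_of_mem _ hz)))
    · obtain ⟨l, hl, rfl⟩ := Finset.mem_image.1 hz
      exact Or.inr ⟨l, hl, rfl⟩
  · intro z
    obtain ⟨b, hb, hb0, h⟩ := hfrac z
    exact ⟨b, hLle hb, hb0, hLle h⟩
  · intro x hx
    refine map_mem_of_localization hKle R hR (hiA _ hδ) ((map_ne_zero i).2 hδ0) ?_ (hYK _ hδK) ?_ hx
    · rw [← map_inv₀]
      exact Algebra.subset_adjoin (Finset.mem_union_right _
        (Finset.mem_image_of_mem _ (Finset.mem_insert_self _ _)))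
    · intro x hx
      refine exists_pow_mul_mem_of_adjoin (hiA _ hδ) ?_ hx
      intro z hz
      rcases Finset.mem_union.1 hz with hz | hz
      · exact ⟨0, by simpa using Algebra.subset_adjoin hz⟩
      · obtain ⟨l, hl, rfl⟩ := Finset.mem_image.1 hz
        rcases Finset.mem_insert.1 hl with rfl | hl
        · exact ⟨1, by rw [pow_one, ← map_mul, mul_inv_cancel₀ hδ0, map_one]; exact one_mem _⟩
        · exact ⟨0, by simpa using hiA _ (Algebra.subset_adjoin hl)⟩
  · intro x hx
    refine map_mem_of_localization hLle RL hRL hδ hδ0 ?_ (hYL _ hδL) ?_ hx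
    · exact Algebra.subset_adjoin (Finset.mem_insert_self _ _)
    · intro x hx
      refine exists_pow_mul_mem_of_adjoin hδ ?_ hx
      intro l hl
      rcases Finset.mem_insert.1 hl with rfl | hl
      · exact ⟨1, by rw [pow_one, mul_inv_cancel₀ hδ0]; exact one_mem _⟩
      · exact ⟨0, by simpa using Algebra.subset_adjoin hl⟩

theorem exists_cartierData [Algebra.EssFiniteType (ZMod p) K]
    [Algebra.EssFiniteType (ZMod p) L] (i : L →ₐ[ZMod p] K) {r : ℕ} (τ : K →ₐ[ZMod p] L)
    (hτ : ∀ a, i (τ a) = a ^ p ^ r) (hτ' : ∀ l, τ (i l) = l ^ p ^ r)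
    (R : K →+ K) (hR : ∀ a b, R (a ^ p * b) = a * R b) (hR1 : R 1 = 1) (X : Finset K)
    (hX : ∀ f ≠ 0, ∃ m, ∃ e ∈ Algebra.adjoin (ZMod p) ((X : Set K) ∪ {f}), R^[m] (e * f) = 1)
    (φ : K →ₐ[ZMod p] L) (RL : L →+ L)
    (hRL : ∀ a b, RL (a ^ p * b) = a * RL b) (hφ : ∀ a, RL (φ a) = φ (R a)) (G : Finset K) :
    ∃ D : CartierData p K L, D.i = i ∧ D.φ = φ ∧ ∀ b ∈ G, ∃ j, b ∈ D.W j := by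
  classical
  have hRit (n : ℕ) (a b : K) : R^[n] (a ^ p ^ n * b) = a * R^[n] b := by
    induction n generalizing a b with
    | zero => simp
    | succ n ih => rw [Function.iterate_succ_apply, Function.iterate_succ_apply, pow_succ, pow_mul,
        hR, ih]
  have hRit1 (n : ℕ) : R^[n] 1 = 1 := Function.iterate_fixed hR1 n
  let R' : Module.End (ZMod p) K := R.toZModLinearMap p
  have hR' (n : ℕ) (x : K) : (R' ^ n) x = R^[n] x := Module.End.pow_apply _ _ _
  obtain ⟨g, hg⟩ := exists_duality i (r + 1) ((powAlgHom p L 1).comp τ) (by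
      intro a
      simp [hτ, pow_succ, pow_mul, powAlgHom_apply])
    (R' ^ (r + 1)).toAddMonoidHom (by
      intro a b
      change (R' ^ (r + 1)) _ = a * (R' ^ (r + 1)) b
      rw [hR', hR', AlgHom.comp_apply, powAlgHom_apply, map_pow, hτ, ← pow_mul, pow_one, ← pow_succ,
        hRit]) (by
      change (R' ^ (r + 1)) 1 = 1
      rw [hR', hRit1])
    ((R' ^ r).toAddMonoidHom.comp (i.toRingHom.toAddMonoidHom.comp RL)) (by
      intro a b
      change (R' ^ r) (i (RL _)) = a * (R' ^ r) (i (RL b))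
      rw [hR', hR', AlgHom.comp_apply, powAlgHom_apply, pow_one, hRL, map_mul, hτ, hRit])
  obtain ⟨TK, TL, hXG, hgG, hiG, hτG, hfrac, hRG, hRLG⟩ :=
    exists_stable_generators i τ hτ R hR RL hRL (X ∪ G) {g}
  let gK : TK → K := Subtype.val
  let gL : TL → L := Subtype.val
  have hgK : Set.range gK = TK := Subtype.range_coe
  have hgL : Set.range gL = TL := Subtype.range_coe
  rw [← hgK] at hRG
  rw [← hgL] at hRLG
  obtain ⟨cR, hcR⟩ := exists_filt_bound R hR hRG
  obtain ⟨cL, hcL⟩ := exists_filt_bound RL hRL hRLG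
  obtain ⟨s, hs, hs0, hsφ⟩ := exists_common_denominator hfrac (TK.image φ)
  obtain ⟨cs, hcs⟩ := exists_uniform_filt (G := gL) (insert s ((TK.image φ).image (s * ·))) (by
    rw [hgL]
    intro y hy
    rcases Finset.mem_insert.1 hy with rfl | hy
    · exact hs
    · obtain ⟨z, hz, rfl⟩ := Finset.mem_image.1 hy
      exact hsφ z hz)
  have hτW {j : ℕ} {x : K} (hx : x ∈ filt p gK j) : τ x ∈ filt p gL (j * p ^ r) := by
    have := map_filt (H := gL) τ 1 (p ^ r) (one_mem_filt _) (fun z => ?_) hx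
    · simpa [mul_comm] using this
    · rw [one_mul]
      rcases hτG z z.2 with h | ⟨l, hl, h⟩
      · exact filt_mono (pow_pos hp.out.pos r) (gen_mem_filt (G := gL) ⟨_, h⟩)
      · change τ (z : K) ∈ _
        rw [← h, hτ']
        simpa using filt_pow (gen_mem_filt (G := gL) ⟨l, hl⟩) (p ^ r)
  have hUW {j : ℕ} {x : L} (hx : x ∈ filt p gL j) : i x ∈ filt p gK j := by
    have := map_filt (H := gK) i 1 1 (one_mem_filt _) (fun z => ?_) hx
    · simpa using this
    · rw [one_mul]
      exact gen_mem_filt (G := gK) ⟨_, hiG z z.2⟩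
  have hmK : ∀ x ∈ TK, x ∈ filt p gK 1 := fun x hx => gen_mem_filt (G := gK) ⟨x, hx⟩
  refine ⟨{
    i := i
    φ := φ
    R := R'
    RL := RL.toZModLinearMap p
    R_mul := hR
    RL_mul := hRL
    RL_φ := hφ
    g := g
    m₀ := r
    R_g := hg
    U := filt p gL
    W := filt p gK
    U_fin := finiteDimensional_filt
    U_mono := filt_mono
    U_one := one_mem_filt _
    U_mul := filt_mul
    W_mono := filt_mono
    U_le_W := hUW
    cR := cR
    R_mem' := hcR
    cL := cL
    RL_mem := hcL
    s := s
    s_ne := hs0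
    cs := cs
    s_mem := fun hx => map_filt φ s cs (hcs _ (Finset.mem_insert_self _ _)) (fun z =>
      hcs _ (Finset.mem_insert_of_mem (Finset.mem_image_of_mem _ (Finset.mem_image_of_mem _ z.2)))) hx
    rP := r
    W_pow := fun {j x} hx => ⟨τ x, hτW hx, hτ x⟩
    dg := 1
    g_mem := gen_mem_filt (G := gL) ⟨g, hgG (Finset.mem_singleton_self g)⟩
    exists_inv := ?_ }, rfl, rfl, fun b hb => ⟨1, hmK b (hXG (Finset.mem_union_right _ hb))⟩⟩
  intro j f hf hf0
  obtain ⟨m, e, he, hm⟩ := hX (i f) ((map_ne_zero i).2 hf0)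
  have he' : e ∈ Algebra.adjoin (ZMod p) (Set.range gK) := by
    refine Algebra.adjoin_le (Set.union_subset (fun x hx => ?_) ?_) he
    · exact exists_mem_filt.1 ⟨1, hmK x (hXG (Finset.mem_union_left _ hx))⟩
    · rintro _ rfl
      exact exists_mem_filt.1 ⟨j, hUW hf⟩
  obtain ⟨j', hj'⟩ := exists_mem_filt.2 he'
  obtain ⟨q, hq⟩ := Nat.exists_eq_succ_of_ne_zero (pow_pos hp.out.pos r).ne'
  refine ⟨_, m + r, τ e * f ^ q, filt_mul (hτW hj') (filt_pow hf q), fun n hn => ?_⟩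
  obtain ⟨l, rfl⟩ := Nat.exists_eq_add_of_le hn
  have : i (τ e * f ^ q * f) = (e * i f) ^ p ^ r * 1 := by
    rw [mul_assoc, ← pow_succ, map_mul, hτ, map_pow, mul_one, mul_pow, hq]
  rw [hR', this, show m + r + l = l + (m + r) by ring, Function.iterate_add_apply,
    Function.iterate_add_apply, hRit, hRit1, mul_one, hm, hRit1]

end BuildCartierData

/-- Periodic points over finite fields of an endomorphism of a finitely generated field. -/
theorem exists_finite_points {p : ℕ} [hp : Fact p.Prime] {K : Type u} [Field K]
    [Algebra (ZMod p) K] [Algebra.EssFiniteType (ZMod p) K] (φ : K →ₐ[ZMod p] K)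
    (B : Subalgebra (ZMod p) K) (hB : B.FG) :
    ∃ (F : Type u) (_ : Field F) (_ : Finite F) (N : ℕ) (χ : ℕ → B →+* F), 0 < N ∧
      (∀ i (b c : B), (c : K) = φ b → χ (i + 1) b = χ i c) ∧ ∀ i, χ (i + N) = χ i := by
  obtain ⟨G, hG⟩ := hB
  obtain ⟨R, X, hR, hR1, hX⟩ := exists_cartier_field p K
  obtain ⟨L, φ', RL, r, hφ', hr, hL, hRL, hRLφ⟩ := exists_separable_subfield φ R hR
  let τ : K →ₐ[ZMod p] L := (powAlgHom p K r).codRestrict L.toSubalgebra hr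
  obtain ⟨D, hi, hφ, hD⟩ := exists_cartierData L.val τ (fun _ => rfl) (fun _ => rfl) R hR hR1 X hX φ'
    RL hRL hRLφ G
  obtain ⟨F, h1, h2, N, χ, hN, hχ, hχN⟩ := D.exists_points B G hG hD
  refine ⟨F, h1, h2, N, χ, hN, fun i b c h => hχ i b c ?_, hχN⟩
  rw [h, hi, hφ, ← hφ']
  rfl

section Descent

open Filter Polynomial

/-- The ring generated by finitely many constants. -/
abbrev coeffRing {k : Type*} [Field k] (T : Finset k) : Subalgebra ℤ k := Algebra.adjoin ℤ (T : Set k)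

variable {k K : Type*} [Field k] [Field K] [Algebra k K]

theorem eventually_mem_coeffRing (a : k) : ∀ᶠ T : Finset k in atTop, a ∈ coeffRing T := by
  filter_upwards [eventually_ge_atTop {a}] with T hT
  exact Algebra.subset_adjoin (hT (Finset.mem_singleton_self a))

theorem eventually_mem_adjoin {S : Set K} {z : K} (hz : z ∈ Algebra.adjoin k S) :
    ∀ᶠ T : Finset k in atTop, z ∈ Algebra.adjoin (coeffRing T) S := by
  induction hz using Algebra.adjoin_induction with
  | mem x hx => exact Eventually.of_forall fun T => Algebra.subset_adjoin hx
  | algebraMap c =>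
    filter_upwards [eventually_mem_coeffRing c] with T hT
    exact Subalgebra.algebraMap_mem _ (⟨c, hT⟩ : coeffRing T)
  | add x y _ _ hx hy =>
    filter_upwards [hx, hy] with T h1 h2 using add_mem h1 h2
  | mul x y _ _ hx hy =>
    filter_upwards [hx, hy] with T h1 h2 using mul_mem h1 h2

theorem isIntegral_subalgebra_iff {R : Type*} [CommRing R] [Algebra R K] {B : Subalgebra R K}
    {z : K} : IsIntegral B z ↔ ∃ p : K[X], p.Monic ∧ p.eval z = 0 ∧ ∀ i, p.coeff i ∈ B := by
  constructor
  · rintro ⟨p, hp, h⟩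
    refine ⟨p.map (algebraMap B K), hp.map _, by rwa [Polynomial.eval_map], fun i => ?_⟩
    rw [coeff_map]
    exact (p.coeff i).2
  · rintro ⟨p, hp, h, hB⟩
    have : p ∈ lifts (algebraMap B K) := (lifts_iff_coeff_lifts _).2 fun i => ⟨⟨_, hB i⟩, rfl⟩
    obtain ⟨q, rfl, -, hq⟩ := lifts_and_natDegree_eq_and_monic this hp
    exact ⟨q, hq, by rwa [Polynomial.eval_map] at h⟩

theorem eventually_isIntegral {S : Set K} {z : K} (hz : IsIntegral (Algebra.adjoin k S) z) :
    ∀ᶠ T : Finset k in atTop, IsIntegral (Algebra.adjoin (coeffRing T) S) z := by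
  obtain ⟨p, hp, h, hB⟩ := isIntegral_subalgebra_iff.1 hz
  have : ∀ᶠ T : Finset k in atTop, ∀ i ∈ p.support, p.coeff i ∈ Algebra.adjoin (coeffRing T) S :=
    (Finset.eventually_all p.support).2 fun i _ => eventually_mem_adjoin (hB i)
  filter_upwards [this] with T hT
  refine isIntegral_subalgebra_iff.2 ⟨p, hp, h, fun i => ?_⟩
  by_cases hi : i ∈ p.support
  · exact hT i hi
  · rw [notMem_support_iff.1 hi]
    exact zero_mem _

/-- If every valuation ring contains one of the sets `c α`, the inverses of the elements in any
choice generate the unit ideal. -/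
theorem exists_inv_sum_eq_one {ι : Type*} (c : ι → Finset K) (h0 : ∀ α, 0 ∉ c α)
    (hV : ∀ O : ValuationSubring K, (∀ r : k, algebraMap k K r ∈ O) → ∃ α, ∀ z ∈ c α, z ∈ O)
    (j : ι → K) (hj : ∀ α, j α ∈ c α) : ∃ q : ι →₀ K,
      (∀ α, q α ∈ Algebra.adjoin k (Set.range fun β => (j β)⁻¹)) ∧
        (q.sum fun α a => a * (j α)⁻¹) = 1 := by
  set B := Algebra.adjoin k (Set.range fun β => (j β)⁻¹) with hBdef
  let w (α : ι) : B.toSubring := ⟨(j α)⁻¹, Algebra.subset_adjoin ⟨α, rfl⟩⟩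
  have htop : Ideal.span (Set.range w) = ⊤ := by
    by_contra hne
    obtain ⟨O, hO, hI⟩ := Ideal.image_subset_nonunits_valuationSubring _ hne
    obtain ⟨α, hα⟩ := hV O fun r => hO (B.algebraMap_mem r)
    have h1 : (j α)⁻¹ ∈ O.nonunits := hI ⟨w α, Ideal.subset_span ⟨α, rfl⟩, rfl⟩
    rcases O.inv_mem_nonunits_iff.1 h1 with h | h
    · exact h0 α (h ▸ hj α)
    · exact h (hα _ (hj α))
  have h1 : (1 : B.toSubring) ∈ Ideal.span (Set.range w) := htop ▸ Submodule.mem_top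
  obtain ⟨q, hq⟩ := (Finsupp.mem_ideal_span_range_iff_exists_finsupp).1 h1
  refine ⟨q.mapRange (fun b : B.toSubring => (b : K)) rfl, fun α => (q α).2, ?_⟩
  rw [Finsupp.sum_mapRange_index (by simp)]
  have := congrArg B.toSubring.subtype hq
  rw [Finsupp.sum, map_sum] at this
  simp only [map_mul, map_one] at this
  exact this

end Descent

section Isolated

variable {R K : Type*} [CommRing R] [Field K] [Algebra R K]

/-- A periodic sequence of points of `A'` compatible with `φ : A → A'`. -/
structure IsOrbit (A A' : Subalgebra R K) (φ : K → K) {E : Type*} [CommRing E]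
    (ρ : ℕ → A' →+* E) (N : ℕ) : Prop where
  pos : 0 < N
  periodic : ∀ i, ρ (i + N) = ρ i
  step : ∀ i (a b : A'), (a : K) ∈ A → (b : K) = φ a → ρ (i + 1) a = ρ i b

theorem IsOrbit.algebraMap_eq {A A' : Subalgebra R K} {φ : K →ₐ[R] K} {E : Type*} [CommRing E]
    {ρ : ℕ → A' →+* E} {N : ℕ} (h : IsOrbit A A' φ ρ N) (i : ℕ) (r : R) :
    ρ i (algebraMap R A' r) = ρ 0 (algebraMap R A' r) := by
  induction i with
  | zero => rfl
  | succ i ih =>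
    rw [← ih]
    exact h.step i _ _ (A.algebraMap_mem r) (φ.commutes r).symm

/-- The algebraic relations witnessing properness and positivity. -/
structure PolarData (A A' : Subalgebra R K) (φ : K →ₐ[R] K) where
  le : A ≤ A'
  map_mem : ∀ a ∈ A, φ a ∈ A'
  ι : Type
  c : ι → Finset K
  c_mem : ∀ α, ∀ z ∈ c α, z ≠ 0 ∧ z ∈ A ∧ z⁻¹ ∈ A
  q : ∀ j : ι → K, (∀ α, j α ∈ c α) → ∃ q : ι →₀ K,
      (∀ α, q α ∈ Algebra.adjoin R (Set.range fun β => (j β)⁻¹)) ∧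
        (q.sum fun α a => a * (j α)⁻¹) = 1
  t : ι → K
  t_ne : ∀ α, t α ≠ 0
  t_mem : ∀ α, t α ∈ A
  t_inv : ∀ α, (t α)⁻¹ ∈ A
  g : K
  g_ne : g ≠ 0
  g_mem : g ∈ A
  g_inv : g⁻¹ ∈ A
  e : Finset K
  e_mem : ∀ l ∈ e, l ∈ A
  m : ℕ
  n : ℕ
  int : ∀ α β, IsIntegral (Algebra.adjoin R ((c α : Set K) ∪ φ '' c β))
    (φ (t β) ^ m * (t α)⁻¹ ^ m * g)
  int_e : ∀ α β, ∀ l ∈ e, IsIntegral (Algebra.adjoin R ((c α : Set K) ∪ φ '' c β))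
    (l * (φ (t β) ^ m * (t α)⁻¹ ^ m * g) ^ n)

variable {E : Type*} [Field E] {A A' : Subalgebra R K} {φ : K →ₐ[R] K}

theorem map_adjoin_mem {B : Subring E} (ρ : A' →+* E) (hB : ∀ r, ρ (algebraMap R A' r) ∈ B)
    {S : Set K} (hS : ∀ z ∈ S, ∃ h : z ∈ A', ρ ⟨z, h⟩ ∈ B) {a : A'}
    (ha : (a : K) ∈ Algebra.adjoin R S) : ρ a ∈ B := by
  let C : Subalgebra R A' :=
    { (B.comap ρ).toSubsemiring with algebraMap_mem' := hB }
  have hle : Algebra.adjoin R S ≤ C.map A'.val := Algebra.adjoin_le fun z hz => by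
    obtain ⟨h, hz'⟩ := hS z hz
    exact ⟨⟨z, h⟩, hz', rfl⟩
  obtain ⟨b, hb, hba⟩ := hle ha
  rwa [← Subtype.ext (a1 := b) (a2 := a) hba]

theorem map_isIntegral (B : Subring E) (ρ : A' →+* E) (hB : ∀ r, ρ (algebraMap R A' r) ∈ B)
    {S : Set K} (hS : ∀ z ∈ S, ∃ h : z ∈ A', ρ ⟨z, h⟩ ∈ B) {a : A'}
    (ha : IsIntegral (Algebra.adjoin R S) (a : K)) : IsIntegral B (ρ a) := by
  have hle : Algebra.adjoin R S ≤ A' := Algebra.adjoin_le fun z hz => (hS z hz).1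
  let _ : Algebra (Algebra.adjoin R S) A' := (Subalgebra.inclusion hle).toRingHom.toAlgebra
  let j : A' →ₐ[Algebra.adjoin R S] K := { A'.val.toRingHom with commutes' := fun _ => rfl }
  have h1 : IsIntegral (Algebra.adjoin R S) a :=
    (isIntegral_algHom_iff j Subtype.val_injective).1 ha
  let f : Algebra.adjoin R S →+* B :=
    (ρ.comp (Subalgebra.inclusion hle).toRingHom).codRestrict B fun b =>
      map_adjoin_mem ρ hB hS b.2
  exact h1.map_of_comp_eq f ρ rfl

theorem map_mem_of_isIntegral (O : ValuationSubring E) (ρ : A' →+* E)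
    (hO : ∀ r, ρ (algebraMap R A' r) ∈ O) {S : Set K} (hS : ∀ z ∈ S, ∃ h : z ∈ A', ρ ⟨z, h⟩ ∈ O)
    {a : A'} (ha : IsIntegral (Algebra.adjoin R S) (a : K)) : ρ a ∈ O := by
  have h2 : IsIntegral O (ρ a) := map_isIntegral O.toSubring ρ hO hS ha
  obtain ⟨y, hy⟩ := IsIntegrallyClosed.isIntegral_iff.1 h2
  rw [← hy]
  exact y.2

theorem isIntegral_subfield_iff (F : Subfield E) {x : E} :
    IsIntegral F x ↔ ∀ O : ValuationSubring E, (F : Set E) ⊆ O → x ∈ O := by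
  constructor
  · intro h O hO
    let f : F →+* O := F.subtype.codRestrict O.toSubring fun b => hO b.2
    have h2 : IsIntegral O (RingHom.id E x) := h.map_of_comp_eq f (RingHom.id E) rfl
    obtain ⟨y, hy⟩ := IsIntegrallyClosed.isIntegral_iff.1 h2
    rw [RingHom.id_apply] at hy
    rw [← hy]
    exact y.2
  · intro h
    have h1 : x ∈ (⨅ V : {V : ValuationSubring E // (F : Set E) ⊆ V.toSubring}, V.1.toSubring) :=
      Subring.mem_iInf.2 fun V => h V.1 V.2
    rw [iInf_valuationSubring_superset] at h1
    obtain ⟨p, hp, hx⟩ := h1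
    let f : Subring.closure (F : Set E) →+* F :=
      (Subring.closure (F : Set E)).subtype.codRestrict F.toSubring fun b =>
        (Subring.closure_le (t := F.toSubring)).2 le_rfl b.2
    have h3 : IsIntegral (Subring.closure (F : Set E)) x := ⟨p, hp, hx⟩
    exact h3.map_of_comp_eq f (RingHom.id E) rfl

/-- Coordinates of periodic points are algebraic over the field of definition. -/
theorem PolarData.isIntegral (D : PolarData A A' φ) {ρ : ℕ → A' →+* E} {N : ℕ}
    (h : IsOrbit A A' φ ρ N) (F : Subfield E) (hF : ∀ r, ρ 0 (algebraMap R A' r) ∈ F)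
    (i : ℕ) {l : A'} (hl : (l : K) ∈ D.e) : IsIntegral F (ρ i l) := by
  have hF' (i r) : ρ i (algebraMap R A' r) ∈ F := by
    rw [h.algebraMap_eq]
    exact hF r
  let T (α : D.ι) : A' := ⟨D.t α, D.le (D.t_mem α)⟩
  let Ti (α : D.ι) : A' := ⟨(D.t α)⁻¹, D.le (D.t_inv α)⟩
  let φT (α : D.ι) : A' := ⟨φ (D.t α), D.map_mem _ (D.t_mem α)⟩
  let G : A' := ⟨D.g, D.le D.g_mem⟩
  have hTTi (α) : T α * Ti α = 1 := Subtype.ext (mul_inv_cancel₀ (D.t_ne α))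
  let H (α β : D.ι) : A' := φT β ^ D.m * Ti α ^ D.m * G
  have hchart (O : ValuationSubring E) (hO : (F : Set E) ⊆ O) (i : ℕ) :
      ∃ α, ∀ z ∈ D.c α, ∃ h : z ∈ A', ρ i ⟨z, h⟩ ∈ O := by
    by_contra! hcon
    choose j hj hj' using hcon
    obtain ⟨q, hq, hq1⟩ := D.q j hj
    have hjm (α) : (j α)⁻¹ ∈ A' := D.le (D.c_mem α _ (hj α)).2.2
    have hjn (α) : ρ i ⟨_, hjm α⟩ ∈ O.nonunits := by
      have h1 := hj' α (D.le (D.c_mem α _ (hj α)).2.1)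
      have h2 : ρ i ⟨_, hjm α⟩ = (ρ i ⟨_, D.le (D.c_mem α _ (hj α)).2.1⟩)⁻¹ := by
        refine eq_inv_of_mul_eq_one_left ?_
        rw [← map_mul, ← map_one (ρ i)]
        exact congrArg _ (Subtype.ext (inv_mul_cancel₀ (D.c_mem α _ (hj α)).1))
      rw [h2]
      exact O.inv_mem_nonunits_iff.2 (Or.inr h1)
    have hS : ∀ z ∈ Set.range fun β => (j β)⁻¹, ∃ h : z ∈ A', ρ i ⟨z, h⟩ ∈ O.toSubring := by
      rintro _ ⟨β, rfl⟩
      exact ⟨hjm β, O.nonunits_subset (hjn β)⟩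
    have hle : Algebra.adjoin R (Set.range fun β => (j β)⁻¹) ≤ A' :=
      Algebra.adjoin_le fun z hz => (hS z hz).1
    have h1 : (∑ α ∈ q.support, ρ i ⟨q α, hle (hq α)⟩ * ρ i ⟨_, hjm α⟩) = 1 := by
      simp_rw [← map_mul, ← map_sum]
      rw [← map_one (ρ i)]
      refine congrArg _ (Subtype.ext ?_)
      exact (map_sum A'.val _ _).trans hq1
    have h2 : (∑ α ∈ q.support, ρ i ⟨q α, hle (hq α)⟩ * ρ i ⟨_, hjm α⟩) ∈ O.nonunits := by
      rw [← SetLike.mem_coe, ← O.image_maximalIdeal]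
      refine ⟨∑ α ∈ q.support, ⟨ρ i ⟨q α, hle (hq α)⟩, map_adjoin_mem (B := O.toSubring) (ρ i)
        (fun r => hO (hF' i r)) hS (hq α)⟩ * ⟨ρ i ⟨_, hjm α⟩, O.nonunits_subset (hjn α)⟩,
        sum_mem fun α _ => Ideal.mul_mem_left _ _ ?_, ?_⟩
      · have := hjn α
        rw [← SetLike.mem_coe, ← O.image_maximalIdeal] at this
        obtain ⟨y, hy, hy'⟩ := this
        have h3 : y = ⟨ρ i ⟨_, hjm α⟩, O.nonunits_subset (hjn α)⟩ := Subtype.ext hy'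
        exact h3 ▸ hy
      · exact map_sum O.subtype _ _
    rw [h1] at h2
    exact absurd h2 (by simp [ValuationSubring.mem_nonunits_iff])
  have hmod (i) : ρ (i % N) = ρ i := by
    conv_rhs => rw [← Nat.mod_add_div i N]
    induction i / N with
    | zero => simp
    | succ n ih => rw [mul_add, ← add_assoc, mul_one, h.periodic, ih]
  have hH (O : ValuationSubring E) (hO : (F : Set E) ⊆ O) : ∃ α : ℕ → D.ι,
      (∀ i, α (i + N) = α i) ∧ ∀ i, ρ i (H (α i) (α (i + 1))) ∈ O ∧
        ∀ l : A', (l : K) ∈ D.e → ρ i (l * H (α i) (α (i + 1)) ^ D.n) ∈ O := by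
    choose α hα using hchart O hO
    refine ⟨fun i => α (i % N), fun i => by simp, fun i => ?_⟩
    have h1 : ∀ z ∈ ((D.c (α (i % N)) : Set K) ∪ φ '' D.c (α ((i + 1) % N))),
        ∃ h : z ∈ A', ρ i ⟨z, h⟩ ∈ O := by
      rintro z (hz | ⟨z, hz, rfl⟩)
      · rw [← hmod i]
        exact hα _ z hz
      · obtain ⟨h1, h2⟩ := hα _ z hz
        have hzA := (D.c_mem _ z hz).2.1
        refine ⟨D.map_mem _ hzA, ?_⟩
        rwa [hmod, h.step i _ ⟨φ z, D.map_mem _ hzA⟩ hzA rfl] at h2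
    exact ⟨map_mem_of_isIntegral O (ρ i) (fun r => hO (hF' i r)) h1 (D.int _ _),
      fun l hl => map_mem_of_isIntegral O (ρ i) (fun r => hO (hF' i r)) h1 (D.int_e _ _ _ hl)⟩
  have hprod (α : ℕ → D.ι) (hα : ∀ i, α (i + N) = α i) :
      ∏ i ∈ Finset.range N, ρ i (H (α i) (α (i + 1))) = ∏ i ∈ Finset.range N, ρ i G := by
    have h1 (i) : ρ i (H (α i) (α (i + 1))) =
        (ρ (i + 1) (T (α (i + 1)))) ^ D.m * (ρ i (Ti (α i))) ^ D.m * ρ i G := by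
      rw [map_mul, map_mul, map_pow, map_pow, h.step i _ (φT (α (i + 1))) (D.t_mem _) rfl]
    simp_rw [h1, Finset.prod_mul_distrib]
    have h2 : ∏ i ∈ Finset.range N, ρ (i + 1) (T (α (i + 1))) ^ D.m =
        ∏ i ∈ Finset.range N, ρ i (T (α i)) ^ D.m := by
      obtain ⟨n, rfl⟩ := Nat.exists_eq_succ_of_ne_zero h.pos.ne'
      rw [Finset.prod_range_succ, Finset.prod_range_succ' (fun i => ρ i (T (α i)) ^ D.m)]
      congr 2
      have h3 := h.periodic 0
      have h4 := hα 0
      rw [zero_add] at h3 h4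
      rw [← h3, ← h4]
    rw [h2, ← Finset.prod_mul_distrib, Finset.prod_congr rfl (g := fun _ => 1), Finset.prod_const_one,
      one_mul]
    intro i _
    rw [← mul_pow, ← map_mul, hTTi, map_one, one_pow]
  set γ := ∏ i ∈ Finset.range N, ρ i G with hγ
  have hγ0 : γ ≠ 0 := Finset.prod_ne_zero_iff.2 fun i _ h0 => by
    have h1 : ρ i (G * ⟨D.g⁻¹, D.le D.g_inv⟩) = 1 := by
      rw [← map_one (ρ i)]
      exact congrArg _ (Subtype.ext (mul_inv_cancel₀ D.g_ne))
    rw [map_mul, h0, zero_mul] at h1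
    exact zero_ne_one h1
  have hγF : IsIntegral F γ := (isIntegral_subfield_iff F).2 fun O hO => by
    obtain ⟨α, hα, h1⟩ := hH O hO
    rw [← hprod α hα]
    exact prod_mem fun i _ => (h1 i).1
  refine (isIntegral_subfield_iff F).2 fun O hO => ?_
  have hγi : γ⁻¹ ∈ O := (isIntegral_subfield_iff F).1 hγF.inv O hO
  obtain ⟨α, hα, h1⟩ := hH O hO
  rw [← hprod α hα] at hγi hγ0
  rw [← hmod i]
  have hi : i % N ∈ Finset.range N := Finset.mem_range.2 (Nat.mod_lt _ h.pos)
  generalize i % N = i at hi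
  set x := ρ i (H (α i) (α (i + 1))) with hx
  rw [← Finset.mul_prod_erase _ _ hi, ← hx] at hγi hγ0
  have hxi : x⁻¹ ∈ O := by
    have : x⁻¹ = (x * ∏ i ∈ (Finset.range N).erase i, ρ i (H (α i) (α (i + 1))))⁻¹ *
        ∏ i ∈ (Finset.range N).erase i, ρ i (H (α i) (α (i + 1))) := by
      rw [mul_inv, mul_assoc, inv_mul_cancel₀ (right_ne_zero_of_mul hγ0), mul_one]
    rw [this]
    exact mul_mem hγi (prod_mem fun i _ => (h1 i).1)
  have h2 := (h1 i).2 l hl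
  rw [map_mul, map_pow, ← hx] at h2
  have h3 := mul_mem h2 (pow_mem hxi D.n)
  rwa [mul_assoc, ← mul_pow, mul_inv_cancel₀ (left_ne_zero_of_mul hγ0), one_pow, mul_one] at h3

end Isolated

section Heights

theorem Ideal.isMaximal_of_finite_quotient {R : Type*} [CommRing R] (I : Ideal R) [I.IsPrime]
    [Finite (R ⧸ I)] : I.IsMaximal :=
  Ideal.Quotient.maximal_of_isField _ (Finite.isField_of_domain _)

theorem Ideal.finite_quotient_comap {R S : Type*} [CommRing R] [CommRing S] (f : R →+* S)
    (I : Ideal S) [Finite (S ⧸ I)] : Finite (R ⧸ I.comap f) :=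
  Finite.of_injective (Ideal.quotientMap I f le_rfl) Ideal.quotientMap_injective

theorem MvPolynomial.height_fin_eq {R : Type*} [CommRing R] [IsNoetherianRing R] (n : ℕ)
    (P : Ideal (MvPolynomial (Fin n) R)) [P.IsPrime] [Finite (MvPolynomial (Fin n) R ⧸ P)] :
    P.height = (P.comap MvPolynomial.C).height + n := by
  induction n with
  | zero =>
    let e := (MvPolynomial.isEmptyRingEquiv R (Fin 0)).symm
    have h1 := e.height_comap P
    have h2 : (e : R →+* MvPolynomial (Fin 0) R) = MvPolynomial.C := rfl
    rw [Nat.cast_zero, add_zero, ← h1]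
    rfl
  | succ n ih =>
    let e := (MvPolynomial.finSuccEquiv R n).symm.toRingEquiv
    let Q := P.comap (e : Polynomial (MvPolynomial (Fin n) R) →+* _)
    have hQ : Finite (Polynomial (MvPolynomial (Fin n) R) ⧸ Q) := Ideal.finite_quotient_comap _ _
    let Q' := Q.comap (Polynomial.C : MvPolynomial (Fin n) R →+* _)
    have hQ' : Finite (MvPolynomial (Fin n) R ⧸ Q') := Ideal.finite_quotient_comap _ _
    have : Q.IsMaximal := Q.isMaximal_of_finite_quotient
    have : Q.LiesOver Q' := ⟨rfl⟩
    have h1 : Q.height = P.height := e.height_comap P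
    rw [← h1, Polynomial.height_eq_height_add_one Q' Q, ih Q', Nat.cast_succ, add_assoc]
    congr 2
    ext r
    simp only [Q', Q, Ideal.mem_comap, e]
    have : (MvPolynomial.finSuccEquiv R n).symm (Polynomial.C (MvPolynomial.C r)) =
        MvPolynomial.C r := by
      rw [AlgEquiv.symm_apply_eq, MvPolynomial.finSuccEquiv_apply]
      simp
    exact iff_of_eq (congrArg (· ∈ P) this)

theorem MvPolynomial.height_eq {R σ : Type*} [CommRing R] [IsNoetherianRing R] [Fintype σ]
    (P : Ideal (MvPolynomial σ R)) [P.IsPrime] [Finite (MvPolynomial σ R ⧸ P)] :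
    P.height = (P.comap MvPolynomial.C).height + Fintype.card σ := by
  let e := (MvPolynomial.renameEquiv R (Fintype.equivFin σ)).symm.toRingEquiv
  let Q := P.comap (e : MvPolynomial (Fin (Fintype.card σ)) R →+* _)
  have hQ : Finite (MvPolynomial (Fin (Fintype.card σ)) R ⧸ Q) := Ideal.finite_quotient_comap _ _
  have h1 : Q.height = P.height := e.height_comap P
  rw [← h1, MvPolynomial.height_fin_eq]
  congr 2
  ext r
  simp only [Q, Ideal.mem_comap, e]
  exact iff_of_eq (congrArg (· ∈ P) ((MvPolynomial.renameEquiv R _).symm.commutes r))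

theorem Ideal.height_add_card_le_of_flat {R σ C : Type*} [CommRing R] [IsNoetherianRing R]
    [Fintype σ] [CommRing C] [IsNoetherianRing C] [Algebra (MvPolynomial σ R) C]
    [Module.Flat (MvPolynomial σ R) C] (P : Ideal C) [P.IsPrime] [Finite (C ⧸ P)] :
    (P.comap ((algebraMap (MvPolynomial σ R) C).comp MvPolynomial.C)).height + Fintype.card σ ≤
      P.height := by
  let Q := P.comap (algebraMap (MvPolynomial σ R) C)
  have hQ : Finite (MvPolynomial σ R ⧸ Q) := Ideal.finite_quotient_comap _ _
  have h1 := MvPolynomial.height_eq Q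
  have : P.LiesOver Q := ⟨rfl⟩
  rw [Ideal.height_eq_height_add_of_liesOver_of_hasGoingDown Q P, h1]
  exact le_self_add

/-- A nonzero element of a prime of positive height is part of a system of parameters. -/
theorem Ideal.exists_finset_mem_minimalPrimes_insert {R : Type*} [CommRing R] [IsDomain R]
    [IsNoetherianRing R] (m : Ideal R) [hm : m.IsPrime] {a : R} (ha : a ∈ m) (ha0 : a ≠ 0) :
    ∃ b : Finset R, (b : Set R) ⊆ m ∧ ((b.card + 1 : ℕ) : ℕ∞) ≤ m.height ∧
      ∀ q : Ideal R, q.IsPrime → q ≤ m → a ∈ q → (b : Set R) ⊆ q → q = m := by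
  classical
  let f := Ideal.Quotient.mk (Ideal.span {a})
  have hle : Ideal.span {a} ≤ m := (Ideal.span_singleton_le_iff_mem m).2 ha
  let m' := m.map f
  have hm' : m'.IsPrime := Ideal.map_isPrime_of_surjective Ideal.Quotient.mk_surjective
    (by rwa [Ideal.mk_ker])
  have hcm : m'.comap f = m := by
    rw [Ideal.comap_map_of_surjective _ Ideal.Quotient.mk_surjective, ← RingHom.ker_eq_comap_bot,
      Ideal.mk_ker, sup_eq_left.2 hle]
  obtain ⟨s, hs, hcard⟩ := m'.exists_finset_card_eq_height_of_isNoetherianRing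
  have hsurj : Function.Surjective f := Ideal.Quotient.mk_surjective
  refine ⟨s.image (Function.surjInv hsurj), ?_, ?_, fun q hq hqm haq hbq => ?_⟩
  · rw [Finset.coe_image, Set.image_subset_iff]
    intro z hz
    have h1 : Function.surjInv hsurj z ∈ m'.comap f := by
      rw [Ideal.mem_comap, Function.surjInv_eq hsurj z]
      exact hs.1.2 (Ideal.subset_span hz)
    rwa [hcm] at h1
  · have h1 : m'.height + 1 ≤ m.height := by
      obtain ⟨l, hl, hlen⟩ := m'.exists_ltSeries_length_eq_height
      let l' := l.map (PrimeSpectrum.comap f) (RingHom.strictMono_comap_of_surjective hsurj)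
      have hhead : (⊥ : PrimeSpectrum R) < l'.head := by
        refine bot_lt_iff_ne_bot.2 fun h0 => ha0 ?_
        have h2 : a ∈ l'.head.asIdeal := by
          change f a ∈ l.head.asIdeal
          rw [Ideal.Quotient.eq_zero_iff_mem.2 (Ideal.mem_span_singleton_self a)]
          exact zero_mem _
        rw [h0] at h2
        exact h2
      rw [← hlen, (⟨m, hm⟩ : PrimeSpectrum R).height_eq_orderHeight]
      have h3 : (l'.cons ⊥ hhead).length = l.length + 1 := by
        simp [l', RelSeries.cons, RelSeries.append, add_comm]
      rw [← Nat.cast_one, ← Nat.cast_add, ← h3]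
      refine Order.length_le_height ?_
      rw [RelSeries.last_cons, LTSeries.last_map, hl]
      exact hcm.le
    refine le_trans ?_ h1
    rw [← hcard]
    push_cast
    gcongr
    exact Finset.card_image_le
  · have hq' : (q.map f).IsPrime := Ideal.map_isPrime_of_surjective hsurj
      (by rwa [Ideal.mk_ker, Ideal.span_singleton_le_iff_mem])
    have hsq : Ideal.span (s : Set (R ⧸ Ideal.span {a})) ≤ q.map f := Ideal.span_le.2 fun z hz => by
      rw [← Function.surjInv_eq hsurj z]
      exact Ideal.mem_map_of_mem f (hbq (Finset.mem_image_of_mem _ hz))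
    have h2 : m' ≤ q.map f := hs.2 ⟨hq', hsq⟩ (Ideal.map_mono hqm)
    refine le_antisymm hqm ?_
    have h3 := Ideal.comap_mono (f := f) h2
    rwa [hcm, Ideal.comap_map_of_surjective _ hsurj, ← RingHom.ker_eq_comap_bot,
      Ideal.mk_ker, sup_eq_left.2 ((Ideal.span_singleton_le_iff_mem q).2 haq)] at h3

/-- An isolated point of the special fibre of an intersection of `d` hypersurfaces lifts to the
generic fibre. -/
theorem exists_isPrime_comap_eq_bot {R Λ : Type*} [CommRing R] [IsDomain R] [IsNoetherianRing R]
    [CommRing Λ] [IsNoetherianRing Λ] (f : R →+* Λ) (M : Ideal Λ) [hM : M.IsPrime]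
    (S : Finset Λ) (hS : (S : Set Λ) ⊆ M) (hht : (M.comap f).height + S.card ≤ M.height)
    (hiso : ∀ Q : Ideal Λ, Q.IsPrime → Q ≤ M → (S : Set Λ) ⊆ Q → M.comap f ≤ Q.comap f → Q = M) :
    ∃ Q : Ideal Λ, Q.IsPrime ∧ (S : Set Λ) ⊆ Q ∧ Q.comap f = ⊥ := by
  classical
  by_contra! hcon
  have h1 : ∀ Q : (Ideal.span (S : Set Λ)).minimalPrimes, ∃ a : R, f a ∈ Q.1 ∧ a ≠ 0 := fun Q => by
    by_contra! h
    refine hcon Q.1 Q.2.1.1 (Ideal.span_le.1 Q.2.1.2) ?_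
    exact (eq_bot_iff).2 fun a ha => h a ha
  choose a ha ha0 using h1
  have hfin := Ideal.finite_minimalPrimes_of_isNoetherianRing Λ (Ideal.span (S : Set Λ))
  have : Fintype (Ideal.span (S : Set Λ)).minimalPrimes := hfin.fintype
  have hA (Q : Ideal Λ) (hQ : Q.IsPrime) (hSQ : (S : Set Λ) ⊆ Q) : f (∏ Q, a Q) ∈ Q := by
    obtain ⟨Q', hQ', hle⟩ := Ideal.exists_minimalPrimes_le (Ideal.span_le.2 hSQ)
    rw [map_prod]
    exact hle (Ideal.mem_of_dvd _ (Finset.dvd_prod_of_mem _ (Finset.mem_univ ⟨Q', hQ'⟩)) (ha ⟨Q', hQ'⟩))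
  obtain ⟨b, hbM, hb, hb'⟩ := Ideal.exists_finset_mem_minimalPrimes_insert (M.comap f) (a := ∏ Q, a Q)
    (hA M hM hS) (Finset.prod_ne_zero_iff.2 fun Q _ => ha0 Q)
  have hmin : M ∈ (Ideal.span ((S ∪ b.image f : Finset Λ) : Set Λ)).minimalPrimes := by
    refine ⟨⟨hM, Ideal.span_le.2 ?_⟩, fun Q hQ hle => ?_⟩
    · rw [Finset.coe_union, Finset.coe_image]
      exact Set.union_subset hS (Set.image_subset_iff.2 hbM)
    · have hsub := Ideal.span_le.1 hQ.2
      rw [Finset.coe_union, Finset.coe_image, Set.union_subset_iff, Set.image_subset_iff] at hsub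
      have := hQ.1
      exact (hiso Q hQ.1 hle hsub.1 (hb' (Q.comap f) inferInstance (Ideal.comap_mono hle)
        (hA Q hQ.1 hsub.1) hsub.2).ge).ge
  have h2 := Ideal.height_le_card_of_mem_minimalPrimes_span_finset hmin
  have h3 : ((S ∪ b.image f).card : ℕ∞) ≤ S.card + b.card := by
    exact_mod_cast (Finset.card_union_le _ _).trans (Nat.add_le_add_left Finset.card_image_le _)
  have h4 := ((add_le_add_left hb _).trans hht).trans (h2.trans h3)
  norm_cast at h4
  omega

end Heights

theorem AlgebraicIndependent.of_isAlgebraic_adjoin {F E σ : Type*} [Field F] [Field E] [Algebra F E]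
    [Finite σ] {u v : σ → E} (hu : AlgebraicIndependent F u)
    (h : ∀ i, IsAlgebraic (Algebra.adjoin F (Set.range v)) (u i)) : AlgebraicIndependent F v := by
  let B := Algebra.adjoin F (Set.range v)
  let M := (Subalgebra.algebraicClosure B E).restrictScalars F
  let u' (i : σ) : M := ⟨u i, h i⟩
  let v' (i : σ) : M := ⟨v i, isAlgebraic_algebraMap (⟨v i, Algebra.subset_adjoin ⟨i, rfl⟩⟩ : B)⟩
  have hu' : AlgebraicIndependent F u' := AlgebraicIndependent.of_comp M.val hu
  have hB : B = (Algebra.adjoin F (Set.range v')).map M.val := by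
    rw [AlgHom.map_adjoin, ← Set.range_comp]
    rfl
  have halg : Algebra.IsAlgebraic (Algebra.adjoin F (Set.range v')) M := by
    refine ⟨fun z => ?_⟩
    obtain ⟨p, hp, hpz⟩ := z.2
    let e : (Algebra.adjoin F (Set.range v')) ≃ₐ[F] B :=
      ((Algebra.adjoin F (Set.range v')).equivMapOfInjective M.val Subtype.val_injective).trans
        (Subalgebra.equivOfEq _ _ hB.symm)
    refine ⟨p.map e.symm.toRingEquiv.toRingHom, ?_, ?_⟩
    · rwa [Polynomial.map_ne_zero_iff e.symm.injective]
    · refine Subtype.val_injective (?_ : M.val _ = M.val 0)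
      rw [map_zero, ← hpz, Polynomial.aeval_def, Polynomial.aeval_def, Polynomial.eval₂_map]
      refine (Polynomial.hom_eval₂ p _ M.val.toRingHom z).trans ?_
      congr 1
      ext b
      exact congrArg Subtype.val (e.apply_symm_apply b)
  have hv' := Algebra.IsAlgebraic.isTranscendenceBasis_of_lift_le_trdeg_of_finite (R := F) v'
    hu'.lift_cardinalMk_le_trdeg
  exact hv'.1.map' (f := M.val) Subtype.val_injective

section SpecialFibre

/-- The prime of polynomials vanishing at the generic point of the special fibre. -/
def genericIdeal {R : Type*} (σ : Type*) [CommRing R] (m : Ideal R) : Ideal (MvPolynomial σ R) :=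
  RingHom.ker (MvPolynomial.map (σ := σ) (Ideal.Quotient.mk m))

theorem mem_genericIdeal {R σ : Type*} [CommRing R] {m : Ideal R} {p : MvPolynomial σ R} :
    p ∈ genericIdeal σ m ↔ ∀ i, p.coeff i ∈ m := by
  rw [genericIdeal, RingHom.mem_ker, MvPolynomial.ext_iff]
  simp [MvPolynomial.coeff_map, Ideal.Quotient.eq_zero_iff_mem]

instance {R σ : Type*} [CommRing R] (m : Ideal R) [m.IsPrime] : (genericIdeal σ m).IsPrime :=
  RingHom.ker_isPrime _

variable {R σ S' C : Type*} [CommRing R] [CommRing S'] [CommRing C] [Algebra (MvPolynomial σ R) S']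
  [Algebra (MvPolynomial σ R) C] [Algebra S' C] [IsScalarTower (MvPolynomial σ R) S' C]

theorem exists_isPrime_comap_eq_genericIdeal (Q : MvPolynomial σ R) [IsLocalization.Away Q S']
    [Algebra.IsIntegral S' C] (hinj : Function.Injective (algebraMap S' C)) (m : Ideal R)
    [m.IsPrime] (hQ : Q ∉ genericIdeal σ m) :
    ∃ q : Ideal C, q.IsPrime ∧ q.comap (algebraMap (MvPolynomial σ R) C) = genericIdeal σ m := by
  have hd : Disjoint (Submonoid.powers Q : Set (MvPolynomial σ R)) (genericIdeal σ m) :=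
    (Ideal.disjoint_powers_iff_notMem_of_isPrime _ ).2 hQ
  have h1 := IsLocalization.isPrime_of_isPrime_disjoint (Submonoid.powers Q) S' (genericIdeal σ m)
    inferInstance hd
  have h2 := IsLocalization.under_map_of_isPrime_disjoint (Submonoid.powers Q) S'
    (inferInstance : (genericIdeal σ m).IsPrime) hd
  obtain ⟨q, -, hq, hq'⟩ := Ideal.exists_ideal_over_prime_of_isIntegral
    ((genericIdeal σ m).map (algebraMap (MvPolynomial σ R) S')) (⊥ : Ideal C) (by
      rw [← RingHom.ker_eq_comap_bot, (RingHom.injective_iff_ker_eq_bot _).1 hinj]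
      exact bot_le)
  refine ⟨q, hq, ?_⟩
  rw [IsScalarTower.algebraMap_eq (MvPolynomial σ R) S' C, ← Ideal.comap_comap, hq']
  exact h2

theorem finite_isPrime_comap_eq (Q : MvPolynomial σ R) [IsLocalization.Away Q S']
    [Module.Finite S' C] (P : Ideal (MvPolynomial σ R)) :
    {q : Ideal C | q.IsPrime ∧ q.comap (algebraMap (MvPolynomial σ R) C) = P}.Finite := by
  have : Algebra.QuasiFinite (MvPolynomial σ R) S' := .of_isLocalization (.powers Q)
  have : Algebra.QuasiFinite (MvPolynomial σ R) C := .trans _ S' _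
  exact (Algebra.QuasiFinite.finite_primesOver (S := C) P).subset fun q hq => ⟨hq.1, ⟨hq.2.symm⟩⟩

end SpecialFibre

section Extension

variable {R K E : Type*} [CommRing R] [Field K] [Algebra R K] [Field E] {A A' : Subalgebra R K}

/-- Extension of a ring homomorphism to a ring of fractions. -/
theorem exists_extend_fractions (ρ : A →+* E)
    (h : ∀ z ∈ A', ∃ b a : A, ρ b ≠ 0 ∧ (b : K) * z = a) :
    ∃ ρ' : A' →+* E, ∀ (a : A) (b : A'), (b : K) = a → ρ' b = ρ a := by
  choose! b a hb hab using h
  have key (z : K) (hz : z ∈ A') (c d : A) (hcd : (c : K) * z = d) :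
      ρ (a z) / ρ (b z) * ρ c = ρ d := by
    have h1 : a z * c = d * b z := Subtype.ext (by
      push_cast
      rw [← hab z hz, ← hcd]
      ring)
    rw [div_mul_eq_mul_div, div_eq_iff (hb z hz), ← map_mul, ← map_mul, h1]
  have hmul {z : K} (hz : z ∈ A') : ρ (a z) / ρ (b z) * ρ (b z) = ρ (a z) :=
    div_mul_cancel₀ _ (hb z hz)
  refine ⟨{ toFun := fun z => ρ (a z) / ρ (b z), map_one' := ?_, map_mul' := fun z w => ?_,
            map_zero' := ?_, map_add' := fun z w => ?_ }, fun a' b' h' => ?_⟩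
  · have := key 1 (one_mem _) 1 1 (by simp)
    simpa using this
  · have h1 := key (z * w) (mul_mem z.2 w.2) (b z * b w) (a z * a w) (by
      push_cast
      rw [← hab z z.2, ← hab w w.2]
      ring)
    refine mul_right_cancel₀ (mul_ne_zero (hb z z.2) (hb w w.2)) ?_
    rw [← map_mul, MulMemClass.coe_mul, h1, map_mul, map_mul]
    nth_rewrite 1 [← hmul z.2, ← hmul w.2]
    ring
  · have := key 0 (zero_mem _) 1 0 (by simp)
    simpa using this
  · have h1 := key (z + w) (add_mem z.2 w.2) (b z * b w) (a z * b w + a w * b z) (by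
      push_cast
      rw [← hab z z.2, ← hab w w.2]
      ring)
    refine mul_right_cancel₀ (mul_ne_zero (hb z z.2) (hb w w.2)) ?_
    rw [← map_mul, AddMemClass.coe_add, h1, map_add, map_mul, map_mul, map_mul]
    nth_rewrite 1 [← hmul z.2, ← hmul w.2]
    ring
  · have := key b' b'.2 1 a' (by simp [h'])
    simpa using this

theorem ringHom_ext_fractions {ρ ρ' : A' →+* E} (hle : A ≤ A')
    (h : ∀ z ∈ A', ∃ b a : A, ρ ⟨b, hle b.2⟩ ≠ 0 ∧ (b : K) * z = a)
    (heq : ∀ a : A, ρ ⟨a, hle a.2⟩ = ρ' ⟨a, hle a.2⟩) : ρ = ρ' := by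
  ext z
  obtain ⟨b, a, hb, hab⟩ := h z z.2
  have h1 : (⟨b, hle b.2⟩ : A') * z = ⟨a, hle a.2⟩ := Subtype.ext hab
  refine mul_left_cancel₀ hb ?_
  rw [← map_mul, h1, heq b, ← map_mul, h1, heq a]

end Extension

section SpecialFibre

/-- Integral models `A ⊆ A'` of a field with an endomorphism, together with an algebraically
independent family that stays so on special fibres. -/
structure ArithModel {R K : Type*} [CommRing R] [Field K] [Algebra R K] (A A' : Subalgebra R K)
    (φ : K →ₐ[R] K) (σ : Type*) where
  le : A ≤ A'
  map_mem : ∀ a ∈ A, φ a ∈ A'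
  x : σ → K
  x_mem : ∀ i, x i ∈ A
  s : MvPolynomial σ R
  s_ne : MvPolynomial.aeval x s ≠ 0
  s_inv : (MvPolynomial.aeval x s)⁻¹ ∈ A'
  away : ∀ z ∈ A', ∃ n : ℕ, MvPolynomial.aeval x s ^ n * z ∈ A
  q : σ → K
  q_mem : ∀ i, q i ∈ Algebra.adjoin R (Set.range (φ ∘ x))
  q_ne : ∀ i, q i ≠ 0
  q_inv : ∀ i, (q i)⁻¹ ∈ A'
  q_int : ∀ i, IsIntegral (Algebra.adjoin R (Set.range (φ ∘ x))) (q i * x i)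

variable {R K E σ : Type*} [CommRing R] [Field K] [Algebra R K] [Field E] {A A' : Subalgebra R K}
  {φ : K →ₐ[R] K}

theorem algebraicIndependent_iff_ker_eq (m : Ideal R) [Algebra (R ⧸ m) E]
    (f : MvPolynomial σ R →+* E)
    (hf : ∀ r, f (MvPolynomial.C r) = algebraMap (R ⧸ m) E (Ideal.Quotient.mk m r)) :
    AlgebraicIndependent (R ⧸ m) (fun i => f (MvPolynomial.X i)) ↔
      RingHom.ker f = genericIdeal σ m := by
  have h1 : f = (MvPolynomial.aeval (R := R ⧸ m) (fun i => f (MvPolynomial.X i))).toRingHom.comp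
      (MvPolynomial.map (Ideal.Quotient.mk m)) := by
    refine MvPolynomial.ringHom_ext (fun r => ?_) fun i => ?_
    · simp [hf]
    · simp
  have hsurj : Function.Surjective (MvPolynomial.map (σ := σ) (Ideal.Quotient.mk m)) :=
    MvPolynomial.map_surjective _ Ideal.Quotient.mk_surjective
  rw [algebraicIndependent_iff_injective_aeval]
  constructor
  · intro h
    ext p
    rw [genericIdeal, RingHom.mem_ker, RingHom.mem_ker, h1]
    exact map_eq_zero_iff _ h
  · intro h
    refine (injective_iff_map_eq_zero _).2 fun p hp => ?_
    obtain ⟨p, rfl⟩ := hsurj p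
    have h2 : p ∈ RingHom.ker f := by
      rw [RingHom.mem_ker, h1]
      exact hp
    rw [h] at h2
    exact h2

namespace ArithModel

variable (D : ArithModel A A' φ σ)

/-- The parametrisation of polynomials by coordinates. -/
def coordA : MvPolynomial σ R →ₐ[R] A := MvPolynomial.aeval fun i => ⟨D.x i, D.x_mem i⟩

/-- The parametrisation of polynomials by coordinates in the larger model. -/
def coord : MvPolynomial σ R →ₐ[R] A' := (Subalgebra.inclusion D.le).comp D.coordA

theorem coe_coordA (p : MvPolynomial σ R) : (D.coordA p : K) = MvPolynomial.aeval D.x p := by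
  change (A.val.comp D.coordA) p = _
  congr 1
  ext i
  simp [coordA]

theorem coe_coord (p : MvPolynomial σ R) : (D.coord p : K) = MvPolynomial.aeval D.x p :=
  D.coe_coordA p

theorem aeval_mem (p : MvPolynomial σ R) : MvPolynomial.aeval D.x p ∈ A := by
  rw [← coe_coordA]
  exact (D.coordA p).2

theorem exists_mul_mem {ρ : A →+* E} (h : ρ ⟨_, D.aeval_mem D.s⟩ ≠ 0) (z : K) (hz : z ∈ A') :
    ∃ b a : A, ρ b ≠ 0 ∧ (b : K) * z = a := by
  obtain ⟨n, hn⟩ := D.away z hz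
  refine ⟨⟨_, D.aeval_mem D.s⟩ ^ n, ⟨_, hn⟩, ?_, rfl⟩
  rw [map_pow]
  exact pow_ne_zero _ h

theorem ext_ringHom {ρ ρ' : A' →+* E}
    (heq : ∀ a (ha : a ∈ A), ρ ⟨a, D.le ha⟩ = ρ' ⟨a, D.le ha⟩) : ρ = ρ' := by
  refine ringHom_ext_fractions D.le (fun z hz => ?_) fun a => heq a a.2
  refine D.exists_mul_mem (ρ := ρ.comp (Subalgebra.inclusion D.le).toRingHom) ?_ z hz
  intro h0
  have h1 : ρ ⟨_, D.le (D.aeval_mem D.s)⟩ * ρ ⟨_, D.s_inv⟩ = 1 := by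
    rw [← map_mul, ← map_one ρ]
    exact congrArg _ (Subtype.ext (mul_inv_cancel₀ D.s_ne))
  have h2 : ρ ⟨_, D.le (D.aeval_mem D.s)⟩ = 0 := h0
  rw [h2, zero_mul] at h1
  exact zero_ne_one h1

/-- The next generic point of the special fibre. -/
theorem exists_next [Finite σ] (m : Ideal R) [m.IsMaximal] (hs : D.s ∉ genericIdeal σ m)
    (ρ : A' →+* E) (hρ : RingHom.ker (ρ.comp D.coord.toRingHom) = genericIdeal σ m) :
    ∃ ρ' : A' →+* E, RingHom.ker (ρ'.comp D.coord.toRingHom) = genericIdeal σ m ∧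
      ∀ a b : A', (a : K) ∈ A → (b : K) = φ a → ρ' a = ρ b := by
  have hm : ∀ r ∈ m, (ρ.comp (algebraMap R A')) r = 0 := fun r hr => by
    have : MvPolynomial.C r ∈ RingHom.ker (ρ.comp D.coord.toRingHom) := by
      rw [hρ]
      simp [genericIdeal, RingHom.mem_ker, Ideal.Quotient.eq_zero_iff_mem.2 hr]
    rw [RingHom.mem_ker] at this
    rw [← this]
    exact congrArg ρ (D.coord.commutes r).symm
  let _ : Field (R ⧸ m) := Ideal.Quotient.field m
  let _ : Algebra (R ⧸ m) E := (Ideal.Quotient.lift m _ hm).toAlgebra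
  have hF (r : R) : algebraMap (R ⧸ m) E (Ideal.Quotient.mk m r) = ρ (algebraMap R A' r) := rfl
  have hu := (algebraicIndependent_iff_ker_eq m (ρ.comp D.coord.toRingHom)
    fun r => congrArg ρ (D.coord.commutes r)).2 hρ
  have hmem (i) : φ (D.x i) ∈ A' := D.map_mem _ (D.x_mem i)
  let v (i : σ) : E := ρ ⟨_, hmem i⟩
  let B := Algebra.adjoin (R ⧸ m) (Set.range v)
  have hle : Algebra.adjoin R (Set.range (φ ∘ D.x)) ≤ A' := Algebra.adjoin_le (by
    rintro _ ⟨i, rfl⟩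
    exact hmem i)
  have hBmem (a : A') (ha : (a : K) ∈ Algebra.adjoin R (Set.range (φ ∘ D.x))) : ρ a ∈ B := by
    refine map_adjoin_mem (B := B.toSubring) ρ (fun r => ?_) (S := Set.range (φ ∘ D.x)) ?_ ha
    · rw [← hF]
      exact B.algebraMap_mem _
    · rintro _ ⟨i, rfl⟩
      exact ⟨hmem i, Algebra.subset_adjoin ⟨i, rfl⟩⟩
  have hv : AlgebraicIndependent (R ⧸ m) v := by
    refine hu.of_isAlgebraic_adjoin fun i => ?_
    let qi : A' := ⟨D.q i, hle (D.q_mem i)⟩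
    let xi : A' := ⟨D.x i, D.le (D.x_mem i)⟩
    have hq0 : ρ qi ≠ 0 := fun h0 => by
      have h1 : ρ qi * ρ ⟨_, D.q_inv i⟩ = 1 := by
        rw [← map_mul, ← map_one ρ]
        exact congrArg _ (Subtype.ext (mul_inv_cancel₀ (D.q_ne i)))
      rw [h0, zero_mul] at h1
      exact zero_ne_one h1
    have h2 : IsIntegral B (ρ (qi * xi)) := by
      refine map_isIntegral B.toSubring ρ (fun r => ?_) (S := Set.range (φ ∘ D.x)) ?_ (D.q_int i)
      · rw [← hF]
        exact B.algebraMap_mem _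
      · rintro _ ⟨i, rfl⟩
        exact ⟨hmem i, Algebra.subset_adjoin ⟨i, rfl⟩⟩
    rw [map_mul] at h2
    let b : B := ⟨ρ qi, hBmem qi (D.q_mem i)⟩
    have hxi : (ρ.comp D.coord.toRingHom) (MvPolynomial.X i) = ρ xi :=
      congrArg ρ (Subtype.ext ((D.coe_coord _).trans (MvPolynomial.aeval_X _ _)))
    rw [hxi]
    exact IsAlgebraic.of_mul (mem_nonZeroDivisors_of_ne_zero hq0)
      (isAlgebraic_algebraMap b) h2.isAlgebraic
  have hv' := (algebraicIndependent_iff_ker_eq m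
    (MvPolynomial.eval₂Hom (ρ.comp (algebraMap R A')) v) fun r => by simp [hF]).1 (by simpa using hv)
  let ρ₀ : A →+* E := ρ.comp ((φ.comp A.val).codRestrict A' fun a => D.map_mem _ a.2).toRingHom
  have hρ₀ (p) : ρ₀ ⟨_, D.aeval_mem p⟩ = MvPolynomial.eval₂Hom (ρ.comp (algebraMap R A')) v p := by
    have h3 : (⟨_, D.aeval_mem p⟩ : A) = D.coordA p := Subtype.ext (D.coe_coordA p).symm
    rw [h3]
    change (ρ₀.comp D.coordA.toRingHom) p = _
    congr 1
    refine MvPolynomial.ringHom_ext (fun r => ?_) fun i => ?_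
    · simp only [MvPolynomial.coe_eval₂Hom, MvPolynomial.eval₂_C]
      refine congrArg ρ (Subtype.ext ?_)
      refine (congrArg φ (congrArg Subtype.val (D.coordA.commutes r))).trans (φ.commutes r)
    · simp only [MvPolynomial.coe_eval₂Hom, MvPolynomial.eval₂_X]
      refine congrArg ρ (Subtype.ext ?_)
      refine congrArg φ ?_
      exact (D.coe_coordA _).trans (MvPolynomial.aeval_X _ _)
  obtain ⟨ρ', hρ'⟩ := exists_extend_fractions ρ₀ (D.exists_mul_mem (by
    rw [hρ₀]
    rwa [← hv', RingHom.mem_ker] at hs))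
  refine ⟨ρ', ?_, fun a b ha hb => ?_⟩
  · rw [← hv']
    ext p
    rw [RingHom.mem_ker, RingHom.mem_ker, ← hρ₀]
    exact iff_of_eq (congrArg (· = 0) (hρ' _ _ (D.coe_coord p)))
  · rw [hρ' ⟨a, ha⟩ a rfl]
    exact congrArg ρ (Subtype.ext hb.symm)

end ArithModel

end SpecialFibre

section FiniteOrbit

variable {R : Type*} {K : Type u} [CommRing R] [Field K] [Algebra R K] {A A' : Subalgebra R K}
  {φ : K →ₐ[R] K}

theorem map_mem_of_adjoin_eq_top {E : Type*} [Field E] {S : Finset A'}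
    (hS : Algebra.adjoin R (S : Set A') = ⊤) (ρ : A' →+* E) (B : Subring E)
    (hB : ∀ r, ρ (algebraMap R A' r) ∈ B) (hSB : ∀ z ∈ S, ρ z ∈ B) (a : A') : ρ a ∈ B := by
  let C : Subalgebra R A' :=
    { (B.comap ρ).toSubsemiring with algebraMap_mem' := hB }
  have hle : Algebra.adjoin R (S : Set A') ≤ C := Algebra.adjoin_le hSB
  rw [hS] at hle
  exact hle (Algebra.mem_top (x := a))

theorem exists_residueField {C : Type u} [CommRing C] (q : Ideal C) [q.IsPrime] :
    ∃ (E : Type u) (_ : Field E) (π : C →+* E), RingHom.ker π = q ∧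
      (∀ z, ∃ a b, π b ≠ 0 ∧ z = π a / π b) ∧
      ∀ (L : Type u) [Field L] (f : C →+* L), RingHom.ker f = q →
        ∃ θ : E →+* L, ∀ a, θ (π a) = f a := by
  let E := FractionRing (C ⧸ q)
  have hinj := IsFractionRing.injective (C ⧸ q) E
  refine ⟨E, inferInstance, (algebraMap (C ⧸ q) E).comp (Ideal.Quotient.mk q), ?_, fun z => ?_,
    fun L _ f hf => ?_⟩
  · rw [← RingHom.comap_ker, (RingHom.injective_iff_ker_eq_bot _).1 hinj]
    exact Ideal.mk_ker
  · obtain ⟨c, d, hd, rfl⟩ := IsFractionRing.div_surjective (A := C ⧸ q) z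
    obtain ⟨c, rfl⟩ := Ideal.Quotient.mk_surjective c
    obtain ⟨d, rfl⟩ := Ideal.Quotient.mk_surjective d
    exact ⟨c, d, IsFractionRing.to_map_ne_zero_of_mem_nonZeroDivisors (R := C ⧸ q) (K := E) hd, rfl⟩
  · have hle : ∀ a ∈ q, f a = 0 := fun a ha => by rwa [← hf] at ha
    have hinj' : Function.Injective (Ideal.Quotient.lift q f hle) := by
      rw [injective_iff_map_eq_zero]
      intro z
      obtain ⟨z, rfl⟩ := Ideal.Quotient.mk_surjective z
      rw [Ideal.Quotient.lift_mk]
      intro hz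
      rw [Ideal.Quotient.eq_zero_iff_mem, ← hf]
      exact hz
    exact ⟨IsFractionRing.lift hinj', fun a => IsFractionRing.lift_algebraMap hinj' _⟩

/-- A self-map of the special fibre has periodic points over a finite field. -/
theorem exists_isOrbit_of_comp {p : ℕ} [Fact p.Prime] {E : Type u} [Field E] [Algebra (ZMod p) E]
    {S : Finset A'} (hS : Algebra.adjoin R (S : Set A') = ⊤) (ρ : ℕ → A' →+* E)
    (hstep : ∀ i (a b : A'), (a : K) ∈ A → (b : K) = φ a → ρ (i + 1) a = ρ i b)
    (hR : ∀ i r, ρ i (algebraMap R A' r) = ρ 0 (algebraMap R A' r))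
    (hfin : (Set.range fun r => ρ 0 (algebraMap R A' r)).Finite)
    (hE : ∀ z, ∃ a b : A', ρ 0 b ≠ 0 ∧ z = ρ 0 a / ρ 0 b)
    (ψ : E →ₐ[ZMod p] E) (b : ℕ) (hb : 0 < b) (hψ : ∀ a, ψ (ρ 0 a) = ρ b a) :
    ∃ (F : Type u) (_ : Field F) (_ : Finite F) (N : ℕ) (P : ℕ → A' →+* F),
      IsOrbit A A' φ P N ∧ ∀ r, ρ 0 (algebraMap R A' r) = 0 → P 0 (algebraMap R A' r) = 0 := by
  classical
  let G : Finset E := hfin.toFinset ∪ (Finset.range (b + 1)).biUnion fun i => S.image (ρ i)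
  let B := Algebra.adjoin (ZMod p) (G : Set E)
  have hBR (i : ℕ) (r : R) : ρ i (algebraMap R A' r) ∈ B := by
    refine Algebra.subset_adjoin (Finset.mem_coe.2 (Finset.mem_union_left _ ?_))
    rw [hfin.mem_toFinset, hR]
    exact ⟨r, rfl⟩
  have hmem (i : ℕ) (hi : i ≤ b) (a : A') : ρ i a ∈ B := by
    refine map_mem_of_adjoin_eq_top hS (ρ i) B.toSubring (hBR i) (fun z hz => ?_) a
    refine Algebra.subset_adjoin (Finset.mem_coe.2 (Finset.mem_union_right _ ?_))
    rw [Finset.mem_biUnion]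
    exact ⟨i, Finset.mem_range.2 (Nat.lt_succ_of_le hi), Finset.mem_image_of_mem _ hz⟩
  have hess : Algebra.EssFiniteType (ZMod p) E := by
    rw [← IntermediateField.fg_top_iff]
    refine ⟨G, top_le_iff.1 fun z _ => ?_⟩
    obtain ⟨c, d, -, rfl⟩ := hE z
    exact div_mem (IntermediateField.algebra_adjoin_le_adjoin _ _ (hmem 0 hb.le c))
      (IntermediateField.algebra_adjoin_le_adjoin _ _ (hmem 0 hb.le d))
  obtain ⟨F, hF, hFfin, N, χ, hN, hχ, hper⟩ := exists_finite_points ψ B ⟨G, rfl⟩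
  let τ (i : ℕ) (hi : i ≤ b) : A' →+* B := (ρ i).codRestrict B (hmem i hi)
  have hlt (n : ℕ) : n % b ≤ b := (Nat.mod_lt n hb).le
  refine ⟨F, hF, hFfin, b * N, fun n => (χ (n / b)).comp (τ (n % b) (hlt n)),
    ⟨Nat.mul_pos hb hN, fun i => ?_, fun i a c ha hc => ?_⟩, fun r hr => ?_⟩
  · have h1 : (i + b * N) / b = i / b + N := by
      rw [Nat.add_mul_div_left _ _ hb]
    have h2 : (i + b * N) % b = i % b := by simp
    simp only [h1, h2, hper]
  · have hib := Nat.mod_lt i hb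
    by_cases h : i % b + 1 = b
    · have h1 : (i + 1) / b = i / b + 1 := by
        rw [Nat.succ_div_of_dvd]
        exact ⟨i / b + 1, by rw [mul_add, mul_one]; have := Nat.div_add_mod i b; omega⟩
      have h2 : (i + 1) % b = 0 := by
        rw [Nat.add_mod]
        by_cases h1b : b = 1
        · simp [h1b, Nat.mod_one]
        · rw [Nat.mod_eq_of_lt (show 1 < b by omega), h, Nat.mod_self]
      simp only [h1, h2, RingHom.comp_apply]
      refine hχ _ _ _ ?_
      change ρ (i % b) c = ψ (ρ 0 a)
      rw [hψ, ← hstep _ a c ha hc, h]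
    · have hl : i % b + 1 < b := by omega
      have h2 : (i + 1) % b = i % b + 1 := by
        rw [Nat.add_mod, Nat.mod_eq_of_lt (show 1 < b by omega), Nat.mod_eq_of_lt hl]
      have h1 : (i + 1) / b = i / b := by
        rw [Nat.succ_div_of_not_dvd]
        rw [Nat.dvd_iff_mod_eq_zero, h2]
        omega
      simp only [h1, h2, RingHom.comp_apply]
      refine congrArg _ (Subtype.ext ?_)
      exact hstep _ a c ha hc
  · simp only [RingHom.comp_apply]
    have : τ (0 % b) (hlt 0) (algebraMap R A' r) = 0 := by
      refine Subtype.ext ?_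
      change ρ (0 % b) _ = 0
      rw [hR, hr]
    rw [this, map_zero]

namespace ArithModel

variable {σ : Type*}

theorem exists_seq [Finite σ] (D : ArithModel A A' φ σ) {E : Type*} [Field E] (m : Ideal R) [m.IsMaximal]
    (hs : D.s ∉ genericIdeal σ m)
    (ρ₀ : A' →+* E) (hρ : RingHom.ker (ρ₀.comp D.coord.toRingHom) = genericIdeal σ m) :
    ∃ ρ : ℕ → A' →+* E, ρ 0 = ρ₀ ∧
      (∀ i, RingHom.ker ((ρ i).comp D.coord.toRingHom) = genericIdeal σ m) ∧
      ∀ i (a b : A'), (a : K) ∈ A → (b : K) = φ a → ρ (i + 1) a = ρ i b := by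
  let Y := {ρ : A' →+* E // RingHom.ker (ρ.comp D.coord.toRingHom) = genericIdeal σ m}
  choose! nx h1 h2 using fun ρ : Y => D.exists_next m hs ρ.1 ρ.2
  let seq : ℕ → Y := fun n => Nat.rec ⟨ρ₀, hρ⟩ (fun _ y => ⟨nx y, h1 y⟩) n
  exact ⟨fun n => (seq n).1, rfl, fun i => (seq i).2, fun i => h2 (seq i)⟩

theorem eq_of_step (D : ArithModel A A' φ σ) {E : Type*} [Field E] {ρ ρ' : ℕ → A' →+* E}
    (h : ∀ i (a b : A'), (a : K) ∈ A → (b : K) = φ a → ρ (i + 1) a = ρ i b)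
    (h' : ∀ i (a b : A'), (a : K) ∈ A → (b : K) = φ a → ρ' (i + 1) a = ρ' i b)
    (h0 : ρ 0 = ρ' 0) (i : ℕ) : ρ i = ρ' i := by
  induction i with
  | zero => exact h0
  | succ i ih =>
    refine D.ext_ringHom fun a ha => ?_
    rw [h i ⟨a, D.le ha⟩ ⟨φ a, D.map_mem a ha⟩ ha rfl,
      h' i ⟨a, D.le ha⟩ ⟨φ a, D.map_mem a ha⟩ ha rfl, ih]

theorem exists_isOrbit [Finite σ] (D : ArithModel A A' φ σ) (m : Ideal R) [m.IsMaximal] [Finite (R ⧸ m)]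
    (hs : D.s ∉ genericIdeal σ m) {S : Finset A'} (hS : Algebra.adjoin R (S : Set A') = ⊤)
    (hex : ∃ q : Ideal A', q.IsPrime ∧ q.comap D.coord.toRingHom = genericIdeal σ m)
    (hfin : {q : Ideal A' | q.IsPrime ∧ q.comap D.coord.toRingHom = genericIdeal σ m}.Finite) :
    ∃ (F : Type u) (_ : Field F) (_ : Finite F) (N : ℕ) (P : ℕ → A' →+* F),
      IsOrbit A A' φ P N ∧ ∀ r ∈ m, P 0 (algebraMap R A' r) = 0 := by
  obtain ⟨q₀, hq₀, hq₀m⟩ := hex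
  obtain ⟨E₀, _, π₀, hπ₀, -, -⟩ := exists_residueField q₀
  obtain ⟨ρ, -, hgen, hstep⟩ := D.exists_seq m hs π₀ (by rw [← RingHom.comap_ker, hπ₀, hq₀m])
  have hfin' := hfin.to_subtype
  obtain ⟨i, j, hij, hijker⟩ := Finite.exists_ne_map_eq_of_infinite
    (fun i : ℕ => (⟨RingHom.ker (ρ i), RingHom.ker_isPrime _, by
      rw [RingHom.comap_ker, hgen]⟩ :
      {q : Ideal A' | q.IsPrime ∧ q.comap D.coord.toRingHom = genericIdeal σ m}))
  obtain ⟨a, b, hb, hab⟩ : ∃ a b, 0 < b ∧ RingHom.ker (ρ (a + b)) = RingHom.ker (ρ a) := by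
    have := congrArg Subtype.val hijker
    rcases lt_or_gt_of_ne hij with h | h
    · exact ⟨i, j - i, by omega, by rw [Nat.add_sub_cancel' h.le]; exact this.symm⟩
    · exact ⟨j, i - j, by omega, by rw [Nat.add_sub_cancel' h.le]; exact this⟩
  let q := RingHom.ker (ρ a)
  have hqp : q.IsPrime := RingHom.ker_isPrime _
  obtain ⟨E, _, π, hπ, hEπ, hlift⟩ := exists_residueField q
  obtain ⟨θ, hθ⟩ := hlift E₀ (ρ a) rfl
  obtain ⟨ρ', hρ'0, hgen', hstep'⟩ := D.exists_seq m hs π (by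
    rw [← RingHom.comap_ker, hπ]
    exact (RingHom.comap_ker _ _).trans (hgen a))
  have hθρ (j : ℕ) : θ.comp (ρ' j) = ρ (a + j) := by
    refine D.eq_of_step (ρ := fun j => θ.comp (ρ' j)) (ρ' := fun j => ρ (a + j)) ?_ ?_ ?_ j
    · exact fun i c d hc hd => congrArg θ (hstep' i c d hc hd)
    · exact fun i c d hc hd => hstep (a + i) c d hc hd
    · ext c
      rw [RingHom.comp_apply, hρ'0, hθ]
      rfl
  obtain ⟨ψ, hψ⟩ := hlift E (ρ' b) (by
    refine Eq.trans ?_ hab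
    rw [← hθρ, ← RingHom.comap_ker, (RingHom.injective_iff_ker_eq_bot _).1 θ.injective]
    rfl)
  have hm0 : ∀ r ∈ m, ((ρ' 0).comp (algebraMap R A')) r = 0 := fun r hr => by
    have h1 : MvPolynomial.C r ∈ RingHom.ker ((ρ' 0).comp D.coord.toRingHom) := by
      rw [hgen']
      simp [genericIdeal, RingHom.mem_ker, Ideal.Quotient.eq_zero_iff_mem.2 hr]
    rw [RingHom.mem_ker] at h1
    rw [← h1]
    exact congrArg (ρ' 0) (D.coord.commutes r).symm
  let _ : Field (R ⧸ m) := Ideal.Quotient.field m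
  let f := Ideal.Quotient.lift m _ hm0
  obtain ⟨p, hp⟩ := CharP.exists (R ⧸ m)
  have : Fact p.Prime := ⟨CharP.char_is_prime (R ⧸ m) p⟩
  have : CharP E p := charP_of_injective_ringHom f.injective p
  let _ : Algebra (ZMod p) E := ZMod.algebra E p
  obtain ⟨F, hF, hFfin, N, P, hP, hP0⟩ := exists_isOrbit_of_comp (p := p) hS ρ' hstep'
    (fun i r => by
      induction i with
      | zero => rfl
      | succ i ih => exact (hstep' i _ _ (A.algebraMap_mem r) (φ.commutes r).symm).trans ih)
    ((Set.finite_range f).subset (by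
      rintro _ ⟨r, rfl⟩
      exact ⟨Ideal.Quotient.mk m r, rfl⟩))
    (fun z => by
      rw [hρ'0]
      exact hEπ z)
    (AlgHom.mk ψ fun r => RingHom.congr_fun
      (Subsingleton.elim (ψ.comp (algebraMap (ZMod p) E)) (algebraMap (ZMod p) E)) r) b hb
    (fun c => by
      rw [hρ'0]
      exact hψ c)
  exact ⟨F, hF, hFfin, N, P, hP, fun r hr => hP0 r (hm0 r hr)⟩

end ArithModel

end FiniteOrbit

section Lifting

/-- A generically étale presentation of `A'`, together with denominators. -/
structure EtaleData {R K σ : Type*} [CommRing R] [Field K] [Algebra R K] (A' : Subalgebra R K)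
    (x : σ → K) (e : Finset K) where
  y : K
  y_mem : y ∈ A'
  δ : K
  δ_mem : δ ∈ Algebra.adjoin R (Set.range x)
  δ_ne : δ ≠ 0
  δ_inv : δ⁻¹ ∈ A'
  le_adjoin : A' ≤ Algebra.adjoin R (insert y (insert δ⁻¹ (Set.range x)))
  p : Polynomial K
  p_mem : ∀ i, p.coeff i ∈ Algebra.adjoin R (insert δ⁻¹ (Set.range x))
  p_eval : p.eval y = 0
  p_deriv : p.derivative.eval y ≠ 0
  p_deriv_inv : (p.derivative.eval y)⁻¹ ∈ A'
  b : K
  b_mem : b ∈ Algebra.adjoin R (e : Set K)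
  b_ne : b ≠ 0
  b_inv : b⁻¹ ∈ A'
  b_mul_x : ∀ i, b * x i ∈ Algebra.adjoin R (e : Set K)
  b_mul_y : b * y ∈ Algebra.adjoin R (e : Set K)

variable {R K F : Type*} [CommRing R] [Field K] [Algebra R K] [Field F] {A A' : Subalgebra R K}
  {φ : K →ₐ[R] K}

/-- The element `z` of the fraction field is regular at `ρ` with value `v`. -/
def HasValueAt (ρ : A' →+* F) (z : K) (v : F) : Prop :=
  ∃ a b : A', ρ b ≠ 0 ∧ z * b = a ∧ v * ρ b = ρ a

theorem coe_ne_zero_of_map_ne_zero {ρ : A' →+* F} {b : A'} (hb : ρ b ≠ 0) : (b : K) ≠ 0 :=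
  fun h => hb (by rw [Subtype.ext h (a2 := (0 : A')), map_zero])

namespace HasValueAt

variable {ρ : A' →+* F} {z w : K} {v v' : F}

theorem coe (ρ : A' →+* F) (a : A') : HasValueAt ρ (a : K) (ρ a) :=
  ⟨a, 1, by simp, by simp, by simp⟩

theorem mul (h : HasValueAt ρ z v) (h' : HasValueAt ρ w v') : HasValueAt ρ (z * w) (v * v') := by
  obtain ⟨a, b, hb, h1, h2⟩ := h
  obtain ⟨a', b', hb', h1', h2'⟩ := h'
  refine ⟨a * a', b * b', by simp [hb, hb'], ?_, ?_⟩
  · push_cast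
    rw [← h1, ← h1']
    ring
  · rw [map_mul, map_mul, ← h2, ← h2']
    ring

theorem add (h : HasValueAt ρ z v) (h' : HasValueAt ρ w v') : HasValueAt ρ (z + w) (v + v') := by
  obtain ⟨a, b, hb, h1, h2⟩ := h
  obtain ⟨a', b', hb', h1', h2'⟩ := h'
  refine ⟨a * b' + a' * b, b * b', by simp [hb, hb'], ?_, ?_⟩
  · push_cast
    rw [← h1, ← h1']
    ring
  · rw [map_mul, map_add, map_mul, map_mul, ← h2, ← h2']
    ring

theorem unique (h : HasValueAt ρ z v) (h' : HasValueAt ρ z v') : v = v' := by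
  obtain ⟨a, b, hb, h1, h2⟩ := h
  obtain ⟨a', b', hb', h1', h2'⟩ := h'
  have h3 : a * b' = a' * b := Subtype.ext (by
    push_cast
    rw [← h1, ← h1']
    ring)
  have h4 := congrArg ρ h3
  rw [map_mul, map_mul, ← h2, ← h2'] at h4
  refine mul_right_cancel₀ (mul_ne_zero hb hb') ?_
  linear_combination h4

theorem inv (h : HasValueAt ρ z v) (hv : v ≠ 0) : HasValueAt ρ z⁻¹ v⁻¹ := by
  obtain ⟨a, b, hb, h1, h2⟩ := h
  have ha : ρ a ≠ 0 := by
    rw [← h2]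
    exact mul_ne_zero hv hb
  have hz : z ≠ 0 := by
    rintro rfl
    rw [zero_mul] at h1
    exact coe_ne_zero_of_map_ne_zero ha h1.symm
  refine ⟨b, a, ha, ?_, ?_⟩
  · rw [← h1, inv_mul_cancel_left₀ hz]
  · rw [← h2, inv_mul_cancel_left₀ hv]

theorem step {σ : Type*} (D : ArithModel A A' φ σ) {P : ℕ → A' →+* F} {N : ℕ}
    (hP : IsOrbit A A' φ P N) {i : ℕ} (h : HasValueAt (P (i + 1)) z v) :
    HasValueAt (P i) (φ z) v := by
  obtain ⟨a, b, hb, h1, h2⟩ := h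
  obtain ⟨n, hn⟩ := D.away a a.2
  obtain ⟨n', hn'⟩ := D.away b b.2
  let s : A' := ⟨_, D.le (D.aeval_mem D.s)⟩
  have hs : P (i + 1) s ≠ 0 := fun h0 => by
    have h3 : P (i + 1) s * P (i + 1) ⟨_, D.s_inv⟩ = 1 := by
      rw [← map_mul, ← map_one (P (i + 1))]
      exact congrArg _ (Subtype.ext (mul_inv_cancel₀ D.s_ne))
    rw [h0, zero_mul] at h3
    exact zero_ne_one h3
  have hsA : (s : K) ∈ A := D.aeval_mem D.s
  have ha' : ((s ^ (n + n') * a : A') : K) ∈ A := by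
    have : ((s ^ (n + n') * a : A') : K) = (s : K) ^ n' * ((s : K) ^ n * a) := by
      push_cast
      ring
    rw [this]
    exact mul_mem (pow_mem hsA _) hn
  have hb' : ((s ^ (n + n') * b : A') : K) ∈ A := by
    have : ((s ^ (n + n') * b : A') : K) = (s : K) ^ n * ((s : K) ^ n' * b) := by
      push_cast
      ring
    rw [this]
    exact mul_mem (pow_mem hsA _) hn'
  have e1 := hP.step i _ ⟨_, D.map_mem _ ha'⟩ ha' rfl
  have e2 := hP.step i _ ⟨_, D.map_mem _ hb'⟩ hb' rfl
  refine ⟨⟨_, D.map_mem _ ha'⟩, ⟨_, D.map_mem _ hb'⟩, ?_, ?_, ?_⟩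
  · rw [← e2, map_mul, map_pow]
    exact mul_ne_zero (pow_ne_zero _ hs) hb
  · rw [← map_mul]
    congr 1
    push_cast
    rw [← h1]
    ring
  · rw [← e1, ← e2, map_mul, map_mul, ← h2]
    ring

theorem iterate {σ : Type*} (D : ArithModel A A' φ σ) {P : ℕ → A' →+* F} {N : ℕ}
    (hP : IsOrbit A A' φ P N) {i : ℕ} (h : HasValueAt (P i) z v) :
    HasValueAt (P 0) (φ^[i] z) v := by
  induction i generalizing z with
  | zero => exact h
  | succ i ih => exact ih (h.step D hP)

end HasValueAt

/-- The local ring at a point. -/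
def locAt (ρ : A' →+* F) : Subalgebra R K where
  carrier := {z | ∃ v, HasValueAt ρ z v}
  mul_mem' := fun ⟨_, h⟩ ⟨_, h'⟩ => ⟨_, h.mul h'⟩
  add_mem' := fun ⟨_, h⟩ ⟨_, h'⟩ => ⟨_, h.add h'⟩
  algebraMap_mem' := fun r => ⟨_, HasValueAt.coe ρ (algebraMap R A' r)⟩

theorem le_locAt (ρ : A' →+* F) : A' ≤ locAt ρ := fun a ha => ⟨_, HasValueAt.coe ρ ⟨a, ha⟩⟩

/-- Evaluation on the local ring at a point. -/
def locEval (ρ : A' →+* F) : locAt ρ →+* F where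
  toFun z := z.2.choose
  map_one' := z_eq (by simpa using HasValueAt.coe ρ 1)
  map_mul' z w := z_eq (z.2.choose_spec.mul w.2.choose_spec)
  map_zero' := z_eq (by simpa using HasValueAt.coe ρ 0)
  map_add' z w := z_eq (z.2.choose_spec.add w.2.choose_spec)
where
  z_eq {z : locAt ρ} {v : F} (h : HasValueAt ρ (z : K) v) : z.2.choose = v :=
    z.2.choose_spec.unique h

theorem locEval_eq {ρ : A' →+* F} {z : locAt ρ} {v : F} (h : HasValueAt ρ (z : K) v) :
    locEval ρ z = v :=
  z.2.choose_spec.unique h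

theorem hasValueAt_locEval {ρ : A' →+* F} (z : locAt ρ) : HasValueAt ρ (z : K) (locEval ρ z) :=
  z.2.choose_spec

/-- The algebra structure of the local ring. -/
instance locAtAlgebra (ρ : A' →+* F) : Algebra A' (locAt ρ) :=
  (Subalgebra.inclusion (le_locAt ρ)).toRingHom.toAlgebra

theorem locEval_algebraMap (ρ : A' →+* F) (a : A') : locEval ρ (algebraMap A' _ a) = ρ a :=
  locEval_eq (HasValueAt.coe ρ a)

theorem isUnit_of_locEval_ne_zero {ρ : A' →+* F} {z : locAt ρ} (h : locEval ρ z ≠ 0) :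
    IsUnit z := by
  have h1 := (hasValueAt_locEval z).inv h
  have hz : (z : K) ≠ 0 := fun h0 => h (by
    rw [Subtype.ext h0 (a2 := (0 : locAt ρ)), map_zero])
  exact IsUnit.of_mul_eq_one ⟨_, _, h1⟩ (Subtype.ext (mul_inv_cancel₀ hz))

instance ker_isPrime_of_field (ρ : A' →+* F) : (RingHom.ker ρ).IsPrime := RingHom.ker_isPrime ρ

instance locAt_isLocalization (ρ : A' →+* F) :
    IsLocalization.AtPrime (locAt ρ) (RingHom.ker ρ) where
  map_units y := isUnit_of_locEval_ne_zero (by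
    rw [locEval_algebraMap]
    exact y.2)
  surj z := by
    obtain ⟨v, a, b, hb, h1, h2⟩ := z.2
    exact ⟨(a, ⟨b, hb⟩), Subtype.ext h1⟩
  exists_of_eq {a b} h := ⟨1, by
    have : (a : K) = b := congrArg (Subtype.val : locAt ρ → K) h
    rw [Subtype.ext this]⟩

end Lifting

section Shift

variable {R K F E σ : Type*} [CommRing R] [Field K] [Algebra R K] [Field F] [Field E]
  {A A' : Subalgebra R K} {φ : K →ₐ[R] K} (D : ArithModel A A' φ σ) {P : ℕ → A' →+* F} {N : ℕ}
  (hP : IsOrbit A A' φ P N)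

theorem HasValueAt.iterate_period (D : ArithModel A A' φ σ) {P : ℕ → A' →+* F} {N : ℕ}
    (hP : IsOrbit A A' φ P N) {z : K} {v : F} (h : HasValueAt (P 0) z v) :
    HasValueAt (P 0) ((φ ^ N) z) v := by
  rw [← hP.periodic 0, zero_add] at h
  rw [AlgHom.coe_pow]
  exact h.iterate D hP

/-- The endomorphism of the local ring induced by a period of the orbit. -/
def shift : locAt (P 0) →ₐ[R] locAt (P 0) :=
  ((φ ^ N).comp (locAt (P 0)).val).codRestrict _ fun z =>
    ⟨_, (hasValueAt_locEval z).iterate_period D hP⟩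

theorem locEval_shift (z : locAt (P 0)) : locEval (P 0) (shift D hP z) = locEval (P 0) z :=
  locEval_eq ((hasValueAt_locEval z).iterate_period D hP)

/-- A point of the local ring fixed by the shift along coordinates is fixed. -/
theorem comp_shift_eq {e : Finset K} (ed : EtaleData A' D.x e) (f : locAt (P 0) →+* E)
    (hf : ∀ i, f (shift D hP ⟨D.x i, le_locAt _ (D.le (D.x_mem i))⟩) =
      f ⟨D.x i, le_locAt _ (D.le (D.x_mem i))⟩) :
    f.comp (shift D hP).toRingHom = f := by
  let T₀ : Subalgebra R (locAt (P 0)) :=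
    { (RingHom.eqLocus (f.comp (shift D hP).toRingHom) f).toSubsemiring with
      algebraMap_mem' := fun r => congrArg f ((shift D hP).commutes r) }
  let T := T₀.map (locAt (P 0)).val
  have hT (z : locAt (P 0)) : (z : K) ∈ T ↔ f (shift D hP z) = f z := by
    constructor
    · rintro ⟨w, hw, hwz⟩
      rw [← Subtype.ext (a1 := w) (a2 := z) hwz]
      exact hw
    · exact fun h => ⟨z, h, rfl⟩
  have hinv {z : K} (hz : z ∈ T) (h0 : z ≠ 0) (hz' : z⁻¹ ∈ locAt (P 0)) : z⁻¹ ∈ T := by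
    obtain ⟨w, hw, rfl⟩ := hz
    let w' : locAt (P 0) := ⟨_, hz'⟩
    refine (hT w').2 ?_
    have h1 : w * w' = 1 := Subtype.ext (mul_inv_cancel₀ h0)
    have h2 : f w * f w' = 1 := by rw [← map_mul, h1, map_one]
    have h3 : f (shift D hP w) * f (shift D hP w') = 1 := by
      rw [← map_mul, ← map_mul, h1, map_one, map_one]
    have h4 : f (shift D hP w) = f w := hw
    rw [h4] at h3
    exact mul_left_cancel₀ (left_ne_zero_of_mul_eq_one h2) (h3.trans h2.symm)
  have hx : Algebra.adjoin R (Set.range D.x) ≤ T := Algebra.adjoin_le (by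
    rintro _ ⟨i, rfl⟩
    exact (hT ⟨D.x i, le_locAt _ (D.le (D.x_mem i))⟩).2 (hf i))
  have hδ : ed.δ⁻¹ ∈ T := hinv (hx ed.δ_mem) ed.δ_ne (le_locAt _ ed.δ_inv)
  have hδx : Algebra.adjoin R (insert ed.δ⁻¹ (Set.range D.x)) ≤ T := Algebra.adjoin_le (by
    rintro _ (rfl | ⟨i, rfl⟩)
    · exact hδ
    · exact hx (Algebra.subset_adjoin ⟨i, rfl⟩))
  have hy : ed.y ∈ T := by
    let y : locAt (P 0) := ⟨ed.y, le_locAt _ ed.y_mem⟩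
    let ι : locAt (P 0) →+* K := (locAt (P 0)).val.toRingHom
    have hι : Function.Injective ι := Subtype.val_injective
    obtain ⟨q, hq⟩ : ∃ q : Polynomial T₀, q.map (ι.comp T₀.val.toRingHom) = ed.p := by
      have : ed.p ∈ Polynomial.lifts (ι.comp T₀.val.toRingHom) := by
        rw [Polynomial.lifts_iff_coeff_lifts]
        intro i
        obtain ⟨w, hw, hwz⟩ := hδx (ed.p_mem i)
        exact ⟨⟨w, hw⟩, hwz⟩
      exact this
    let r := q.map T₀.val.toRingHom
    have hr : r.map ι = ed.p := by rw [Polynomial.map_map, hq]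
    have hry : r.eval y = 0 := hι (by
      rw [map_zero, ← ed.p_eval, ← hr]
      exact (Polynomial.eval_map_apply ι y).symm)
    have hdy : IsUnit (r.derivative.eval y) := by
      have h1 : ι (r.derivative.eval y) = ed.p.derivative.eval ed.y := by
        rw [← hr, Polynomial.derivative_map r ι]
        exact (Polynomial.eval_map_apply ι y).symm
      exact IsUnit.of_mul_eq_one ⟨_, le_locAt _ ed.p_deriv_inv⟩ (hι (by
        rw [map_mul, h1, map_one]
        exact mul_inv_cancel₀ ed.p_deriv))
    obtain ⟨k, hk⟩ := Polynomial.binomExpansion r y (shift D hP y - y)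
    rw [add_sub_cancel, hry, zero_add] at hk
    have hzero : f (r.eval (shift D hP y)) = 0 := by
      have h1 : f (r.eval (shift D hP y)) = f (shift D hP (r.eval y)) := by
        have e1 : f (r.eval (shift D hP y)) = (r.map f).eval (f (shift D hP y)) :=
          (Polynomial.eval_map_apply f _).symm
        have e2 : f (shift D hP (r.eval y)) =
            (r.map (f.comp (shift D hP).toRingHom)).eval (f (shift D hP y)) :=
          (Polynomial.eval_map_apply (f.comp (shift D hP).toRingHom) y).symm
        rw [e1, e2, Polynomial.map_map, Polynomial.map_map]
        congr 2
        ext w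
        exact w.2.symm
      rw [h1, hry, map_zero, map_zero]
    have hu : IsUnit (r.derivative.eval y + k * (shift D hP y - y)) := by
      refine isUnit_of_locEval_ne_zero ?_
      rw [map_add, map_mul, map_sub, locEval_shift, sub_self, mul_zero, add_zero]
      exact (hdy.map (locEval (P 0))).ne_zero
    have hfac : r.eval (shift D hP y) =
        (r.derivative.eval y + k * (shift D hP y - y)) * (shift D hP y - y) := by
      rw [hk]
      ring
    rw [hfac, map_mul] at hzero
    refine (hT y).2 (sub_eq_zero.1 ?_)
    rw [← map_sub]
    exact (mul_eq_zero.1 hzero).resolve_left (hu.map f).ne_zero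
  have hA' : A' ≤ T := ed.le_adjoin.trans (Algebra.adjoin_le (by
    rintro _ (rfl | rfl | ⟨i, rfl⟩)
    · exact hy
    · exact hδ
    · exact hx (Algebra.subset_adjoin ⟨i, rfl⟩)))
  ext z
  refine (hT z).1 ?_
  obtain ⟨v, a, b, hb, h1, -⟩ := z.2
  have hb0 := coe_ne_zero_of_map_ne_zero hb
  rw [show (z : K) = a * (b : K)⁻¹ by rw [← h1, mul_inv_cancel_right₀ hb0]]
  exact mul_mem (hA' a.2) (hinv (hA' b.2) hb0 ⟨_, (HasValueAt.coe _ b).inv hb⟩)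

/-- The orbit attached to a point of the local ring fixed by the shift. -/
def pointSeq (f : locAt (P 0) →+* E) (i : ℕ) : A' →+* E :=
  f.comp (((φ ^ i).comp A'.val).codRestrict (locAt (P 0)) fun a => by
    refine ⟨P i a, ?_⟩
    rw [AlgHom.coe_comp, AlgHom.coe_pow]
    exact (HasValueAt.coe (P i) a).iterate D hP).toRingHom

theorem isOrbit_pointSeq (f : locAt (P 0) →+* E) (hf : f.comp (shift D hP).toRingHom = f) :
    IsOrbit A A' φ (pointSeq D hP f) N where
  pos := hP.pos
  periodic i := by
    ext a
    have h : HasValueAt (P 0) ((φ ^ i) (a : K)) (P i a) := by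
      rw [AlgHom.coe_pow]
      exact (HasValueAt.coe (P i) a).iterate D hP
    have h1 := RingHom.congr_fun hf ⟨_, _, h⟩
    refine Eq.trans (congrArg f (Subtype.ext ?_)) h1
    change (φ ^ (i + N)) (a : K) = (φ ^ N) ((φ ^ i) (a : K))
    rw [add_comm, pow_add]
    rfl
  step i a b _ hb := by
    refine congrArg f (Subtype.ext ?_)
    change (φ ^ (i + 1)) (a : K) = (φ ^ i) (b : K)
    rw [pow_succ, hb]
    rfl

end Shift

section Algebraic

variable {R K E σ : Type*} [CommRing R] [Field K] [Algebra R K] [Field E]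
  {A A' : Subalgebra R K} {φ : K →ₐ[R] K}

theorem PolarData.isIntegral_of_isOrbit (D : PolarData A A' φ) {x : σ → K}
    (ed : EtaleData A' x D.e) {ρ : ℕ → A' →+* E} {N : ℕ} (h : IsOrbit A A' φ ρ N) (F : Subfield E)
    (hF : ∀ r, ρ 0 (algebraMap R A' r) ∈ F) (i : ℕ) (a : A') : IsIntegral F (ρ i a) := by
  let B := (integralClosure F E).toSubring
  have hFB (r) : ρ i (algebraMap R A' r) ∈ B := by
    rw [h.algebraMap_eq]
    exact isIntegral_algebraMap (x := (⟨_, hF r⟩ : F))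
  have he (a : A') (ha : (a : K) ∈ Algebra.adjoin R (D.e : Set K)) : ρ i a ∈ B := by
    refine map_adjoin_mem (ρ i) hFB (fun z hz => ⟨D.le (D.e_mem z hz), ?_⟩) ha
    exact D.isIntegral h F hF i hz
  have hinv {z : E} (hz : z ∈ B) : z⁻¹ ∈ B := IsIntegral.inv hz
  have hle : Algebra.adjoin R (D.e : Set K) ≤ A' := Algebra.adjoin_le fun z hz => D.le (D.e_mem z hz)
  let b : A' := ⟨ed.b, hle ed.b_mem⟩
  let b' : A' := ⟨_, ed.b_inv⟩
  have hbb' : b' * b = 1 := Subtype.ext (inv_mul_cancel₀ ed.b_ne)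
  have hb' : ρ i b' ∈ B := by
    have : ρ i b' = (ρ i b)⁻¹ := eq_inv_of_mul_eq_one_left (by rw [← map_mul, hbb', map_one])
    rw [this]
    exact hinv (he b ed.b_mem)
  have hmul (z : A') (hz : ed.b * z ∈ Algebra.adjoin R (D.e : Set K)) : ρ i z ∈ B := by
    have h1 : z = b' * (b * z) := by rw [← mul_assoc, hbb', one_mul]
    rw [h1, map_mul]
    exact mul_mem hb' (he _ hz)
  have hx (a : A') (ha : (a : K) ∈ Algebra.adjoin R (Set.range x)) : ρ i a ∈ B := by
    refine map_adjoin_mem (ρ i) hFB ?_ ha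
    rintro _ ⟨j, rfl⟩
    have hxj : x j ∈ A' := by
      have : x j = (b' : K) * (ed.b * x j) := (inv_mul_cancel_left₀ ed.b_ne _).symm
      rw [this]
      exact mul_mem b'.2 (hle (ed.b_mul_x j))
    exact ⟨hxj, hmul ⟨_, hxj⟩ (ed.b_mul_x j)⟩
  have hxA : Algebra.adjoin R (Set.range x) ≤ A' := Algebra.adjoin_le (by
    rintro _ ⟨j, rfl⟩
    have : x j = (b' : K) * (ed.b * x j) := (inv_mul_cancel_left₀ ed.b_ne _).symm
    rw [this]
    exact mul_mem b'.2 (hle (ed.b_mul_x j)))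
  refine map_adjoin_mem (ρ i) hFB ?_ (ed.le_adjoin a.2)
  rintro _ (rfl | rfl | ⟨j, rfl⟩)
  · exact ⟨ed.y_mem, hmul ⟨_, ed.y_mem⟩ ed.b_mul_y⟩
  · refine ⟨ed.δ_inv, ?_⟩
    let δ : A' := ⟨ed.δ, hxA ed.δ_mem⟩
    have : ρ i ⟨_, ed.δ_inv⟩ = (ρ i δ)⁻¹ := eq_inv_of_mul_eq_one_left (by
      rw [← map_mul, ← map_one (ρ i)]
      exact congrArg _ (Subtype.ext (inv_mul_cancel₀ ed.δ_ne)))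
    rw [this]
    exact hinv (hx δ ed.δ_mem)
  · exact ⟨hxA (Algebra.subset_adjoin ⟨j, rfl⟩),
      hx ⟨x j, hxA (Algebra.subset_adjoin ⟨j, rfl⟩)⟩ (Algebra.subset_adjoin ⟨j, rfl⟩)⟩

end Algebraic

section Lift

variable {R k : Type*} {K : Type u} {F σ : Type*} [CommRing R] [Field k] [Algebra R k] [Field K]
  [Algebra R K] [Field F] {A A' : Subalgebra R K} {φ : K →ₐ[R] K}

theorem exists_isAlgebraic_isOrbit [IsDomain R] [IsNoetherianRing R] [IsNoetherianRing A']
    [Finite F] [Fintype σ] (D : ArithModel A A' φ σ) (pd : PolarData A A' φ)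
    (ed : EtaleData A' D.x pd.e) (hflat : D.coord.toRingHom.Flat) {P : ℕ → A' →+* F} {N : ℕ}
    (hP : IsOrbit A A' φ P N) :
    ∃ (E : Type u) (_ : Field E) (_ : Algebra R E) (ρ : ℕ → A' →+* E), IsOrbit A A' φ ρ N ∧
      Function.Injective (algebraMap R E) ∧
      (∀ i r, ρ i (algebraMap R A' r) = algebraMap R E r) ∧ ∀ i a, IsAlgebraic R (ρ i a) := by
  classical
  let _ : Algebra (MvPolynomial σ R) A' := D.coord.toRingHom.toAlgebra
  have : Module.Flat (MvPolynomial σ R) A' := hflat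
  let Λ := locAt (P 0)
  let M := RingHom.ker (locEval (P 0))
  have hMp : M.IsPrime := RingHom.ker_isPrime _
  let p := RingHom.ker (P 0)
  have : Finite (A' ⧸ p) := Finite.of_injective _ (RingHom.kerLift_injective (P 0))
  let ξ (i : σ) : Λ := ⟨D.x i, le_locAt _ (D.le (D.x_mem i))⟩
  let S : Finset Λ := Finset.univ.image fun i => shift D hP (ξ i) - ξ i
  have hagree (Q : Ideal Λ) (hQS : (S : Set Λ) ⊆ Q) {E : Type u} [Field E] (π : Λ →+* E)
      (hπ : RingHom.ker π = Q) : π.comp (shift D hP).toRingHom = π := by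
    refine comp_shift_eq D hP ed π fun i => ?_
    have h1 : shift D hP (ξ i) - ξ i ∈ RingHom.ker π := by
      rw [hπ]
      exact hQS (Finset.mem_coe.2 (Finset.mem_image_of_mem _ (Finset.mem_univ i)))
    rw [RingHom.mem_ker, map_sub] at h1
    exact sub_eq_zero.1 h1
  have hMA : M.under A' = p := by
    ext a
    exact iff_of_eq (congrArg (· = 0) (locEval_algebraMap (P 0) a))
  have hMR : M.comap (algebraMap R Λ) = p.comap (algebraMap R A') := by
    rw [← hMA]
    rfl
  have : IsNoetherianRing Λ :=
    IsLocalization.isNoetherianRing (RingHom.ker (P 0)).primeCompl Λ inferInstance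
  have hmfin : Finite (R ⧸ p.comap (algebraMap R A')) := Ideal.finite_quotient_comap _ _
  have hmmax : (p.comap (algebraMap R A')).IsMaximal := Ideal.isMaximal_of_finite_quotient _
  obtain ⟨Q, hQp, hSQ, hQR⟩ := exists_isPrime_comap_eq_bot (algebraMap R Λ) M S
    (by
      intro z hz
      obtain ⟨i, -, rfl⟩ := Finset.mem_image.1 (Finset.mem_coe.1 hz)
      change locEval (P 0) (shift D hP (ξ i) - ξ i) = 0
      rw [map_sub, locEval_shift, sub_self])
    (by
      have h1 := Ideal.height_add_card_le_of_flat (σ := σ) (R := R) p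
      have h2 : p.comap ((algebraMap (MvPolynomial σ R) A').comp MvPolynomial.C) =
          p.comap (algebraMap R A') := by
        congr 1
        ext r
        exact congrArg Subtype.val (D.coord.commutes r)
      have h3 : M.height = p.height := by
        rw [← IsLocalization.height_under p.primeCompl M, hMA]
      rw [h2] at h1
      rw [hMR, h3]
      refine le_trans ?_ h1
      gcongr
      exact Finset.card_image_le)
    (by
      intro Q hQp hQM hSQ hmQ
      obtain ⟨E, _, π, hπ, -, -⟩ := exists_residueField Q
      have horb := isOrbit_pointSeq D hP π (hagree Q hSQ π hπ)
      have hk0 : ∀ r ∈ p.comap (algebraMap R A'), (π.comp (algebraMap R Λ)) r = 0 := fun r hr => by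
        rw [← hMR] at hr
        have : algebraMap R Λ r ∈ RingHom.ker π := by
          rw [hπ]
          exact hmQ hr
        exact this
      let _ : Field (R ⧸ p.comap (algebraMap R A')) := Ideal.Quotient.field _
      let F' : Subfield E := (Ideal.Quotient.lift _ _ hk0).fieldRange
      let ρ₀ := pointSeq D hP π 0
      have hinv (a : A') (ha : ρ₀ a ≠ 0) : ∃ c, ρ₀ a * ρ₀ c = 1 := by
        have h1 := pd.isIntegral_of_isOrbit ed horb F' (fun r => ⟨Ideal.Quotient.mk _ r, rfl⟩) 0 a
        let T : Subalgebra F' E :=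
          { ρ₀.range with
            algebraMap_mem' := by
              rintro ⟨_, z, rfl⟩
              obtain ⟨r, rfl⟩ := Ideal.Quotient.mk_surjective z
              exact ⟨algebraMap R A' r, rfl⟩ }
        have h2 : Algebra.adjoin F' {ρ₀ a} ≤ T := Algebra.adjoin_le (by
          rintro _ rfl
          exact ⟨a, rfl⟩)
        obtain ⟨c, hc⟩ := h2 h1.inv_mem_adjoin
        refine ⟨c, ?_⟩
        have hc' : ρ₀ c = (ρ₀ a)⁻¹ := hc
        rw [hc', mul_inv_cancel₀ ha]
      refine le_antisymm hQM fun z hz => ?_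
      obtain ⟨v, a, b, hb, h1, h2⟩ := z.2
      have hzb : z * algebraMap A' Λ b = algebraMap A' Λ a := Subtype.ext h1
      have hbu : IsUnit (algebraMap A' Λ b) := isUnit_of_locEval_ne_zero (by
        rwa [locEval_algebraMap])
      by_contra hzQ
      have ha : ρ₀ a ≠ 0 := by
        change π (algebraMap A' Λ a) ≠ 0
        rw [← hzb, map_mul]
        refine mul_ne_zero (fun h => hzQ ?_) (hbu.map π).ne_zero
        rw [← hπ]
        exact h
      obtain ⟨c, hc⟩ := hinv a ha
      have h3 : algebraMap A' Λ a * algebraMap A' Λ c - 1 ∈ M := hQM (by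
        rw [← hπ, RingHom.mem_ker, map_sub, map_mul, map_one]
        exact sub_eq_zero.2 hc)
      have h4 : algebraMap A' Λ a * algebraMap A' Λ c ∈ M := by
        rw [← hzb, mul_assoc]
        exact M.mul_mem_right _ hz
      exact hMp.ne_top ((Ideal.eq_top_iff_one _).2 (by
        have := M.sub_mem h4 h3
        rwa [sub_sub_cancel] at this)))
  obtain ⟨E, _, π, hπ, -, -⟩ := exists_residueField Q
  have horb := isOrbit_pointSeq D hP π (hagree Q hSQ π hπ)
  let _ : Algebra R E := (π.comp (algebraMap R Λ)).toAlgebra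
  have hinj : Function.Injective (algebraMap R E) := by
    rw [RingHom.injective_iff_ker_eq_bot, ← hQR, ← hπ]
    exact (RingHom.comap_ker _ _).symm
  have hR (i) (r : R) : pointSeq D hP π i (algebraMap R A' r) = algebraMap R E r := by
    rw [horb.algebraMap_eq]
    rfl
  refine ⟨E, _, _, pointSeq D hP π, horb, hinj, hR, fun i a => ?_⟩
  have : FaithfulSMul R E := (faithfulSMul_iff_algebraMap_injective R E).2 hinj
  let _ : Algebra (FractionRing R) E := FractionRing.liftAlgebra R E
  have : IsScalarTower R (FractionRing R) E := FractionRing.isScalarTower_liftAlgebra R E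
  have h1 := pd.isIntegral_of_isOrbit ed horb (algebraMap (FractionRing R) E).fieldRange
    (fun r => ⟨algebraMap R _ r, by
      rw [← IsScalarTower.algebraMap_apply, ← hR 0]⟩) i a
  let e := RingEquiv.ofBijective (algebraMap (FractionRing R) E).rangeRestrictField
    ⟨fun x y h => (algebraMap (FractionRing R) E).injective (congrArg Subtype.val h),
      by
        rintro ⟨_, z, rfl⟩
        exact ⟨z, rfl⟩⟩
  have h2 : IsIntegral (FractionRing R) (pointSeq D hP π i a) :=
    h1.map_of_comp_eq e.symm.toRingHom (RingHom.id E) (by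
      ext z
      exact congrArg Subtype.val (e.apply_symm_apply z))
  exact (IsFractionRing.isAlgebraic_iff R (FractionRing R) E).2 h2.isAlgebraic

theorem exists_algHom_isOrbit [IsDomain R] [IsNoetherianRing R] [IsNoetherianRing A'] [IsAlgClosed k]
    (hRk : Function.Injective (algebraMap R k))
    [Finite F] [Fintype σ] (D : ArithModel A A' φ σ) (pd : PolarData A A' φ)
    (ed : EtaleData A' D.x pd.e) (hflat : D.coord.toRingHom.Flat) {P : ℕ → A' →+* F} {N : ℕ}
    (hP : IsOrbit A A' φ P N) :
    ∃ χ : ℕ → A' →ₐ[R] k, IsOrbit A A' φ (fun i => (χ i).toRingHom) N := by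
  obtain ⟨E, _, _, ρ, hρ, hinj, hR, halg⟩ := exists_isAlgebraic_isOrbit D pd ed hflat hP
  let L := Subalgebra.algebraicClosure R E
  have : Algebra.IsAlgebraic R L := ⟨fun z => by
    obtain ⟨q, hq, hqz⟩ := z.2
    refine ⟨q, hq, Subtype.val_injective ((?_ : L.val _ = L.val 0))⟩
    rw [map_zero, ← hqz]
    exact (Polynomial.aeval_algHom_apply L.val z q).symm⟩
  have : FaithfulSMul R k := (faithfulSMul_iff_algebraMap_injective R k).2 hRk
  have : FaithfulSMul R L := (faithfulSMul_iff_algebraMap_injective R L).2 fun a b h =>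
    hinj (congrArg Subtype.val h)
  let θ : L →ₐ[R] k := IsAlgClosed.lift
  let ρ' (i : ℕ) : A' →ₐ[R] L := AlgHom.mk ((ρ i).codRestrict L.toSubring (halg i)) fun r =>
    Subtype.ext (hR i r)
  refine ⟨fun i => θ.comp (ρ' i), hρ.pos, fun i => ?_, fun i a b ha hb => ?_⟩
  · ext a
    exact congrArg θ (Subtype.ext (RingHom.congr_fun (hρ.periodic i) a))
  · exact congrArg θ (Subtype.ext (hρ.step i a b ha hb))

end Lift

section Jacobson

instance : IsJacobsonRing ℤ := isJacobsonRing_iff_prime_eq.2 fun P hP => by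
  rcases eq_or_ne P ⊥ with rfl | h
  · refine (eq_bot_iff).2 fun x hx => ?_
    have h1 := Int.isUnit_iff.1 (Ideal.mem_jacobson_bot.1 hx (x * 1))
    rw [Ideal.mem_bot]
    by_contra h0
    have h2 := mul_self_pos.2 h0
    grind
  · have := hP.isMaximal h
    exact Ideal.jacobson_eq_self_of_isMaximal

theorem Ideal.IsMaximal.finite_quotient_of_finiteType {R : Type*} [CommRing R]
    [Algebra.FiniteType ℤ R] (m : Ideal R) [m.IsMaximal] : Finite (R ⧸ m) := by
  let _ : Field (R ⧸ m) := Ideal.Quotient.field m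
  have h1 : Module.Finite ℤ (R ⧸ m) := finite_of_finite_type_of_isJacobsonRing ℤ (R ⧸ m)
  have h2 : ¬ Function.Injective (algebraMap ℤ (R ⧸ m)) := fun h =>
    Int.not_isField (isField_of_isIntegral_of_isField h (Field.toIsField (R ⧸ m)))
  have h3 : ∃ n : ℤ, n ≠ 0 ∧ (n : R ⧸ m) = 0 := by
    by_contra! h
    refine h2 ((injective_iff_map_eq_zero _).2 fun n hn => ?_)
    by_contra h0
    exact h n h0 (by simpa using hn)
  obtain ⟨n, hn, hn0⟩ := h3
  refine Module.finite_of_fg_torsion _ fun z => ⟨⟨n, mem_nonZeroDivisors_of_ne_zero hn⟩, ?_⟩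
  change n • z = 0
  rw [zsmul_eq_mul, hn0, zero_mul]

end Jacobson

section Model

open Polynomial

variable {R K σ : Type*} [CommRing R] [Field K] [Algebra R K]

theorem exists_pow_mul_mem_of_mem_adjoin {A : Subalgebra R K} {s : K} (hs : s ∈ A) {S : Set K}
    (hS : ∀ z ∈ S, ∃ n : ℕ, s ^ n * z ∈ A) {z : K} (hz : z ∈ Algebra.adjoin R S) :
    ∃ n : ℕ, s ^ n * z ∈ A := by
  induction hz using Algebra.adjoin_induction with
  | mem z hz => exact hS z hz
  | algebraMap r => exact ⟨0, by simp⟩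
  | add z w _ _ hz hw =>
    obtain ⟨n, hn⟩ := hz
    obtain ⟨m, hm⟩ := hw
    refine ⟨n + m, ?_⟩
    have : s ^ (n + m) * (z + w) = s ^ m * (s ^ n * z) + s ^ n * (s ^ m * w) := by ring
    rw [this]
    exact add_mem (mul_mem (pow_mem hs _) hn) (mul_mem (pow_mem hs _) hm)
  | mul z w _ _ hz hw =>
    obtain ⟨n, hn⟩ := hz
    obtain ⟨m, hm⟩ := hw
    refine ⟨n + m, ?_⟩
    have : s ^ (n + m) * (z * w) = s ^ n * z * (s ^ m * w) := by ring
    rw [this]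
    exact mul_mem hn hm

theorem isLocalization_adjoin_insert_inv {x : σ → K} (hx : AlgebraicIndependent R x)
    (Q : MvPolynomial σ R) (hQ : MvPolynomial.aeval x Q ≠ 0) {S' : Subalgebra R K}
    (hS' : S' = Algebra.adjoin R (insert (MvPolynomial.aeval x Q)⁻¹ (Set.range x)))
    [Algebra (MvPolynomial σ R) S']
    (h : ∀ p, (algebraMap (MvPolynomial σ R) S' p : K) = MvPolynomial.aeval x p) :
    IsLocalization.Away Q S' := by
  have hinv : (MvPolynomial.aeval x Q)⁻¹ ∈ S' := hS' ▸ Algebra.subset_adjoin (Or.inl rfl)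
  refine (isLocalization_iff (S := S') (Submonoid.powers Q)).2 ⟨?_, fun z => ?_, fun {p q} hpq => ?_⟩
  · rintro ⟨_, n, rfl⟩
    rw [map_pow]
    refine IsUnit.pow _ (IsUnit.of_mul_eq_one ⟨_, hinv⟩ (Subtype.ext ?_))
    change (algebraMap (MvPolynomial σ R) S' Q : K) * _ = 1
    rw [h, mul_inv_cancel₀ hQ]
  · obtain ⟨n, hn⟩ := exists_pow_mul_mem_of_mem_adjoin (A := Algebra.adjoin R (Set.range x))
      (s := MvPolynomial.aeval x Q) (S := insert (MvPolynomial.aeval x Q)⁻¹ (Set.range x))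
      (by
        rw [Algebra.adjoin_range_eq_range_aeval]
        exact ⟨Q, rfl⟩) (by
        rintro w (rfl | hw)
        · exact ⟨1, by simp [mul_inv_cancel₀ hQ]⟩
        · exact ⟨0, by simpa using Algebra.subset_adjoin hw⟩) (z := z) (hS' ▸ z.2)
    rw [Algebra.adjoin_range_eq_range_aeval] at hn
    obtain ⟨p, hp⟩ := hn
    refine ⟨⟨p, Q ^ n, n, rfl⟩, Subtype.ext ?_⟩
    change (z : K) * (algebraMap (MvPolynomial σ R) S' (Q ^ n) : K) =
      (algebraMap (MvPolynomial σ R) S' p : K)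
    rw [h, h, map_pow, mul_comm]
    exact hp.symm
  · refine ⟨1, ?_⟩
    have h1 := congrArg Subtype.val hpq
    rw [h, h] at h1
    rw [hx h1]

theorem free_of_coeff_minpoly_mem {F : Subfield K} {y : K} (hy : IsIntegral F y)
    {S' A' : Subalgebra R K} (hS'F : (S' : Set K) ⊆ F)
    (hp : ∀ i, ((minpoly F y).coeff i : K) ∈ S')
    (hyA : y ∈ A') (hA' : ∀ a ∈ A', a ∈ Algebra.adjoin S' {y}) [Algebra S' A']
    (hSA : ∀ s, (algebraMap S' A' s : K) = s) :
    Module.Free S' A' ∧ Module.Finite S' A' := by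
  let _ : Algebra S' F := (Subring.inclusion (S := S'.toSubring) (T := F.toSubring) hS'F).toAlgebra
  have : IsScalarTower S' F K := IsScalarTower.of_algebraMap_eq' rfl
  have : IsScalarTower S' A' K := IsScalarTower.of_algebraMap_eq fun s => (hSA s).symm
  have hlift : minpoly F y ∈ Polynomial.lifts (algebraMap S' F) := by
    rw [Polynomial.lifts_iff_coeff_lifts]
    exact fun i => ⟨⟨_, hp i⟩, rfl⟩
  obtain ⟨f, hf, hfd, hfm⟩ := Polynomial.lifts_and_natDegree_eq_and_monic hlift (minpoly.monic hy)
  have hfy : aeval y f = 0 := by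
    rw [← minpoly.aeval F y, ← hf, aeval_map_algebraMap]
  have hspan := Submodule.span_range_natDegree_eq_adjoin hfm hfy
  have hinj : Function.Injective (algebraMap S' F) := fun a b h =>
    Subtype.ext (congrArg (fun z : F => (z : K)) h)
  have hfaith : FaithfulSMul S' F := (faithfulSMul_iff_algebraMap_injective S' F).2 hinj
  have hli : LinearIndependent S' fun i : Fin (minpoly F y).natDegree => y ^ (i : ℕ) :=
    LinearIndependent.restrict_scalars' S' (linearIndependent_pow (K := F) y)
  let v (i : Fin (minpoly F y).natDegree) : A' := ⟨y ^ (i : ℕ), pow_mem hyA _⟩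
  let ψ : A' →ₗ[S'] K := (IsScalarTower.toAlgHom S' A' K).toLinearMap
  have hv : LinearIndependent S' v := LinearIndependent.of_comp ψ hli
  have hsp : ⊤ ≤ Submodule.span S' (Set.range v) := by
    rintro a -
    have h1 : (a : K) ∈ Submodule.span S' (Set.range (ψ ∘ v)) := by
      classical
      have h2 : (a : K) ∈ Subalgebra.toSubmodule (Algebra.adjoin S' {y}) := hA' a a.2
      rw [← hspan] at h2
      refine Submodule.span_mono ?_ h2
      intro z hz
      obtain ⟨i, hi, rfl⟩ := Finset.mem_image.1 (Finset.mem_coe.1 hz)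
      exact ⟨⟨i, by rw [← hfd]; exact Finset.mem_range.1 hi⟩, rfl⟩
    rw [Set.range_comp, Submodule.span_image] at h1
    obtain ⟨b, hb, hba⟩ := h1
    have : b = a := Subtype.ext hba
    exact this ▸ hb
  let B := Module.Basis.mk hv hsp
  exact ⟨Module.Free.of_basis B, Module.Finite.of_basis B⟩

theorem flat_of_coeff_minpoly_mem {x : σ → K} (hx : AlgebraicIndependent R x)
    (Q : MvPolynomial σ R) (hQ : MvPolynomial.aeval x Q ≠ 0) {F : Subfield K}
    (hxF : ∀ i, x i ∈ F) (hRF : ∀ r, algebraMap R K r ∈ F) {y : K} (hy : IsIntegral F y)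
    (hp : ∀ i, ((minpoly F y).coeff i : K) ∈
      Algebra.adjoin R (insert (MvPolynomial.aeval x Q)⁻¹ (Set.range x)))
    {A' : Subalgebra R K}
    (hA' : A' = Algebra.adjoin R (insert y (insert (MvPolynomial.aeval x Q)⁻¹ (Set.range x))))
    (c : MvPolynomial σ R →ₐ[R] A') (hc : ∀ p, (c p : K) = MvPolynomial.aeval x p) :
    c.toRingHom.Flat ∧
    (∀ m : Ideal R, m.IsPrime → Q ∉ genericIdeal σ m →
      ∃ q : Ideal A', q.IsPrime ∧ q.comap c.toRingHom = genericIdeal σ m) ∧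
    ∀ P : Ideal (MvPolynomial σ R),
      {q : Ideal A' | q.IsPrime ∧ q.comap c.toRingHom = P}.Finite := by
  let S' : Subalgebra R K := Algebra.adjoin R (insert (MvPolynomial.aeval x Q)⁻¹ (Set.range x))
  have hle : S' ≤ A' := hA' ▸ Algebra.adjoin_mono (Set.subset_insert _ _)
  let _ : Algebra S' A' := (Subalgebra.inclusion hle).toRingHom.toAlgebra
  let _ : Algebra (MvPolynomial σ R) A' := c.toRingHom.toAlgebra
  have hxS' (i) : x i ∈ S' := Algebra.subset_adjoin (Or.inr ⟨i, rfl⟩)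
  let j : MvPolynomial σ R →ₐ[R] S' := MvPolynomial.aeval fun i => (⟨x i, hxS' i⟩ : S')
  let _ : Algebra (MvPolynomial σ R) S' := j.toRingHom.toAlgebra
  have hj (p) : (algebraMap (MvPolynomial σ R) S' p : K) = MvPolynomial.aeval x p := by
    change (S'.val.comp j) p = _
    congr 1
    ext i
    simp [j]
  have : IsScalarTower (MvPolynomial σ R) S' A' := IsScalarTower.of_algebraMap_eq fun p =>
    Subtype.ext ((hc p).trans (hj p).symm)
  have hloc : IsLocalization.Away Q S' := isLocalization_adjoin_insert_inv hx Q hQ rfl hj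
  have hRFx : ∀ p, MvPolynomial.aeval x p ∈ F := fun p => by
    induction p using MvPolynomial.induction_on with
    | C r => simpa using hRF r
    | add p q hp hq => simpa using add_mem hp hq
    | mul_X p i hp => simpa using mul_mem hp (hxF i)
  let F' : Subalgebra R K := { F.toSubring with algebraMap_mem' := hRF }
  have hS'F : S' ≤ F' := Algebra.adjoin_le (by
    rintro z (rfl | ⟨i, rfl⟩)
    · exact F.inv_mem (hRFx Q)
    · exact hxF i)
  obtain ⟨hfree, hfin⟩ := free_of_coeff_minpoly_mem (A' := A') hy hS'F hp
    (hA' ▸ Algebra.subset_adjoin (Or.inl rfl)) (fun a ha => by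
      rw [hA'] at ha
      rw [Set.insert_eq, Set.union_comm, Algebra.adjoin_union_eq_adjoin_adjoin] at ha
      exact ha) fun s => rfl
  refine ⟨?_, fun m hm hQm => ?_, fun P => ?_⟩
  · have : Module.Flat (MvPolynomial σ R) S' := IsLocalization.flat S' (Submonoid.powers Q)
    exact Module.Flat.trans (MvPolynomial σ R) S' A'
  · exact exists_isPrime_comap_eq_genericIdeal (S' := S') (C := A') Q
      (Subalgebra.inclusion_injective hle) m hQm
  · exact finite_isPrime_comap_eq (S' := S') (C := A') Q P

end Model

section Descent

open Filter

variable {k K : Type*} [Field k] [Field K] [Algebra k K]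

theorem eventually_notMem_genericIdeal {σ : Type*} {x : σ → K} (hx : AlgebraicIndependent k x)
    {z : K} (hz : z ∈ Algebra.adjoin k (Set.range x)) (hz0 : z ≠ 0) :
    ∀ᶠ T : Finset k in atTop, ∀ p : MvPolynomial σ (coeffRing T), MvPolynomial.aeval x p = z →
      ∀ m : Ideal (coeffRing T), m.IsPrime → p ∉ genericIdeal σ m := by
  rw [Algebra.adjoin_range_eq_range_aeval] at hz
  obtain ⟨P, rfl⟩ := hz
  have hP : P ≠ 0 := fun h => hz0 (by rw [h]; exact map_zero _)
  obtain ⟨i, hi⟩ := MvPolynomial.ne_zero_iff.1 hP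
  filter_upwards [eventually_mem_coeffRing (P.coeff i)⁻¹] with T hT p hp m hm hpm
  have h1 : MvPolynomial.map (algebraMap (coeffRing T) k) p = P := hx (by
    rw [MvPolynomial.aeval_map_algebraMap]
    exact hp)
  have h2 : ((p.coeff i : coeffRing T) : k) = P.coeff i := by
    rw [← h1, MvPolynomial.coeff_map]
    rfl
  refine hm.ne_top (Ideal.eq_top_of_isUnit_mem _ (mem_genericIdeal.1 hpm i)
    (IsUnit.of_mul_eq_one ⟨_, hT⟩ (Subtype.ext ?_)))
  change ((p.coeff i : coeffRing T) : k) * (P.coeff i)⁻¹ = 1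
  rw [h2, mul_inv_cancel₀ hi]

/-- Points of integral models are points of the generic fibre. -/
theorem eventually_exists_extend (S : Finset K) :
    ∀ᶠ T : Finset k in atTop, ∀ (A : Subalgebra (coeffRing T) K),
      A = Algebra.adjoin (coeffRing T) (S : Set K) → ∀ χ : A →ₐ[coeffRing T] k,
      ∃ χ' : Algebra.adjoin k (S : Set K) →ₐ[k] k,
        ∀ (a : A) (b : Algebra.adjoin k (S : Set K)), (b : K) = a → χ' b = χ a := by
  classical
  have hmem (s : S) : (s : K) ∈ Algebra.adjoin k (S : Set K) := Algebra.subset_adjoin s.2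
  let f : MvPolynomial S k →ₐ[k] Algebra.adjoin k (S : Set K) :=
    MvPolynomial.aeval fun s : S => ⟨s, hmem s⟩
  have hf (p) : (f p : K) = MvPolynomial.aeval (fun s : S => (s : K)) p := by
    change ((Subalgebra.val _).comp f) p = _
    congr 1
    ext i
    simp [f]
  have hsurj : Function.Surjective f := by
    rintro ⟨z, hz⟩
    have hz' : z ∈ Algebra.adjoin k (Set.range fun s : S => (s : K)) := by
      rwa [Subtype.range_coe_subtype]
    rw [Algebra.adjoin_range_eq_range_aeval] at hz'
    obtain ⟨p, hp⟩ := hz'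
    exact ⟨p, Subtype.ext ((hf p).trans hp)⟩
  obtain ⟨G, hG⟩ := IsNoetherian.noetherian (RingHom.ker f)
  have hT : ∀ᶠ T : Finset k in atTop, ∀ p ∈ G, ∀ i ∈ p.support, p.coeff i ∈ coeffRing T :=
    (Finset.eventually_all G).2 fun p _ => (Finset.eventually_all p.support).2 fun i _ =>
      eventually_mem_coeffRing _
  filter_upwards [hT] with T hT A hA χ
  have hSA (s : S) : (s : K) ∈ A := hA ▸ Algebra.subset_adjoin s.2
  let f₀ : MvPolynomial S (coeffRing T) →ₐ[coeffRing T] A :=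
    MvPolynomial.aeval fun s : S => ⟨s, hSA s⟩
  have hf₀ (p) : (f₀ p : K) = MvPolynomial.aeval (fun s : S => (s : K)) p := by
    change ((Subalgebra.val _).comp f₀) p = _
    congr 1
    ext i
    simp [f₀]
  let g : MvPolynomial S k →ₐ[k] k := MvPolynomial.aeval fun s : S => χ ⟨s, hSA s⟩
  have hg (p : MvPolynomial S (coeffRing T)) :
      g (MvPolynomial.map (algebraMap (coeffRing T) k) p) = χ (f₀ p) := by
    rw [MvPolynomial.aeval_map_algebraMap]
    change _ = (χ.comp f₀) p
    congr 1
    ext i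
    simp [f₀]
  have hff (p : MvPolynomial S (coeffRing T)) :
      (f (MvPolynomial.map (algebraMap (coeffRing T) k) p) : K) = f₀ p := by
    rw [hf, hf₀, MvPolynomial.aeval_map_algebraMap]
  have hker : ∀ p ∈ RingHom.ker f, g p = 0 := by
    have : RingHom.ker f ≤ RingHom.ker g := by
      rw [← hG]
      refine Ideal.span_le.2 fun p hp => ?_
      have h1 : p ∈ Set.range (MvPolynomial.map (σ := S) (algebraMap (coeffRing T) k)) := by
        rw [MvPolynomial.mem_range_map_iff_coeffs_subset]
        intro a ha
        obtain ⟨i, hi, rfl⟩ := MvPolynomial.mem_coeffs_iff.1 (Finset.mem_coe.1 ha)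
        exact ⟨⟨_, hT p hp i hi⟩, rfl⟩
      obtain ⟨p', rfl⟩ := h1
      have h2 : MvPolynomial.map (algebraMap (coeffRing T) k) p' ∈ RingHom.ker f :=
        hG ▸ Ideal.subset_span hp
      have h3 : f₀ p' = 0 := Subtype.ext (by
        rw [← hff, RingHom.mem_ker.1 h2]
        rfl)
      change g _ = 0
      rw [hg, h3, map_zero]
    exact fun p hp => this hp
  let χ' : Algebra.adjoin k (S : Set K) →ₐ[k] k := (Ideal.Quotient.liftₐ (RingHom.ker f) g hker).comp
    (Ideal.quotientKerAlgEquivOfSurjective hsurj).symm.toAlgHom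
  have hχ' (p) : χ' (f p) = g p := by
    have : (Ideal.quotientKerAlgEquivOfSurjective hsurj).symm (f p) = Ideal.Quotient.mk _ p :=
      (AlgEquiv.symm_apply_eq _).2 rfl
    change Ideal.Quotient.liftₐ (RingHom.ker f) g hker
      ((Ideal.quotientKerAlgEquivOfSurjective hsurj).symm (f p)) = _
    rw [this]
    rfl
  refine ⟨χ', fun a b hab => ?_⟩
  have ha : (a : K) ∈ Algebra.adjoin (coeffRing T) (Set.range fun s : S => (s : K)) := by
    rw [Subtype.range_coe_subtype]
    exact hA ▸ a.2
  rw [Algebra.adjoin_range_eq_range_aeval] at ha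
  obtain ⟨p, hp⟩ := ha
  have h1 : a = f₀ p := Subtype.ext (hp.symm.trans (hf₀ p).symm)
  have h2 : b = f (MvPolynomial.map (algebraMap (coeffRing T) k) p) := Subtype.ext (by
    rw [hab, h1, hff])
  rw [h1, h2, hχ', hg]

end Descent

section Coordinates

variable {k : Type*} {K : Type u} [Field k] [Field K] [Algebra k K]

theorem exists_coordinates (k : Type*) (K : Type u) [Field k] [Field K] [Algebra k K]
    [PerfectField k] [Algebra.EssFiniteType k K] :
    ∃ (σ : Type u) (_ : Fintype σ) (x : σ → K) (y : K) (F : Subfield K), IsTranscendenceBasis k x ∧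
      (∀ z, z ∈ F ↔ ∃ r ∈ Algebra.adjoin k (Set.range x), ∃ s ∈ Algebra.adjoin k (Set.range x),
        z = r / s) ∧
      IsIntegral F y ∧ (minpoly F y).Separable ∧ ∀ z, z ∈ Algebra.adjoin F {y} := by
  obtain ⟨s, hs, hsep⟩ := exists_isTranscendenceBasis_and_isSeparable_of_perfectField k K
  let F := IntermediateField.adjoin k (s : Set K)
  have : Algebra.IsSeparable F K := hsep
  have : Algebra.EssFiniteType F K := Algebra.EssFiniteType.of_comp k F K
  have : FiniteDimensional F K := Algebra.finite_of_essFiniteType_of_isAlgebraic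
  obtain ⟨y, hy⟩ := Field.exists_primitive_element F K
  have hyint : IsIntegral F y := Algebra.IsIntegral.isIntegral y
  refine ⟨s, inferInstance, (↑), y, F.toSubfield, hs, fun z => ?_, hyint,
    Algebra.IsSeparable.isSeparable F y, fun z => ?_⟩
  · rw [Subtype.range_coe_subtype]
    exact IntermediateField.mem_adjoin_iff_div
  · have h1 := IntermediateField.adjoin_simple_toSubalgebra_of_isAlgebraic hyint.isAlgebraic
    have h2 : z ∈ IntermediateField.adjoin F {y} := hy ▸ IntermediateField.mem_top
    have h3 : z ∈ (IntermediateField.adjoin F {y}).toSubalgebra := h2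
    rw [h1] at h3
    exact h3

/-- Finitely many elements become regular after inverting a polynomial in the coordinates. -/
theorem exists_localization {X B : Set K} (hXB : X ⊆ B) (Z : Finset K)
    (hZ : ∀ z ∈ Z, ∃ d ∈ Algebra.adjoin k X, d ≠ 0 ∧ d * z ∈ Algebra.adjoin k B) :
    ∃ d ∈ Algebra.adjoin k X, d ≠ 0 ∧ ∀ s ∈ Algebra.adjoin k X, s ≠ 0 →
      ∀ z ∈ Z, z ∈ Algebra.adjoin k (insert (d * s)⁻¹ B) := by
  classical
  choose! b hb hb0 hbz using hZ
  have hd0 : ∏ y ∈ Z, b y ≠ 0 := Finset.prod_ne_zero_iff.2 hb0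
  refine ⟨∏ y ∈ Z, b y, prod_mem hb, hd0, fun s hs hs0 z hz => ?_⟩
  have h1 : ∏ y ∈ Z, b y = (∏ y ∈ Z.erase z, b y) * b z := (Finset.prod_erase_mul Z b hz).symm
  have h2 : z = ((∏ y ∈ Z, b y) * s)⁻¹ * (s * (∏ y ∈ Z.erase z, b y) * (b z * z)) := by
    rw [h1] at hd0 ⊢
    field_simp
    rw [mul_assoc, mul_div_cancel_right₀ _ hd0]
  have hle : Algebra.adjoin k B ≤ Algebra.adjoin k (insert ((∏ y ∈ Z, b y) * s)⁻¹ B) :=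
    Algebra.adjoin_mono (Set.subset_insert _ _)
  have hle' := Algebra.adjoin_mono (R := k) hXB
  have h3 : ((∏ y ∈ Z, b y) * s)⁻¹ * (s * (∏ y ∈ Z.erase z, b y) * (b z * z)) ∈
      Algebra.adjoin k (insert ((∏ y ∈ Z, b y) * s)⁻¹ B) :=
    mul_mem (Algebra.subset_adjoin (Or.inl rfl)) (hle (mul_mem
      (hle' (mul_mem hs (prod_mem fun w hw => hb w (Finset.mem_of_mem_erase hw)))) (hbz z hz)))
  rwa [← h2] at h3

theorem exists_denominator {X : Set K} {F : Subfield K}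
    (hF : ∀ z, z ∈ F ↔ ∃ r ∈ Algebra.adjoin k X, ∃ s ∈ Algebra.adjoin k X, z = r / s) {y : K}
    {z : K} (hz : z ∈ Algebra.adjoin F {y}) :
    ∃ d ∈ Algebra.adjoin k X, d ≠ 0 ∧ d * z ∈ Algebra.adjoin k (insert y X) := by
  have hle : Algebra.adjoin k X ≤ Algebra.adjoin k (insert y X) :=
    Algebra.adjoin_mono (Set.subset_insert _ _)
  induction hz using Algebra.adjoin_induction with
  | mem z hz => exact ⟨1, one_mem _, one_ne_zero, by
      rw [one_mul]
      exact Algebra.subset_adjoin (Or.inl hz)⟩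
  | algebraMap f =>
    obtain ⟨r, hr, s, hs, h⟩ := (hF f).1 f.2
    change ∃ d ∈ _, d ≠ 0 ∧ d * (f : K) ∈ _
    rcases eq_or_ne s 0 with rfl | hs0
    · exact ⟨1, one_mem _, one_ne_zero, by rw [h, div_zero, mul_zero]; exact zero_mem _⟩
    · exact ⟨s, hs, hs0, by rw [h, mul_div_cancel₀ _ hs0]; exact hle hr⟩
  | add z w _ _ hz hw =>
    obtain ⟨d, hd, hd0, h⟩ := hz
    obtain ⟨d', hd', hd0', h'⟩ := hw
    refine ⟨d * d', mul_mem hd hd', mul_ne_zero hd0 hd0', ?_⟩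
    have : d * d' * (z + w) = d' * (d * z) + d * (d' * w) := by ring
    rw [this]
    exact add_mem (mul_mem (hle hd') h) (mul_mem (hle hd) h')
  | mul z w _ _ hz hw =>
    obtain ⟨d, hd, hd0, h⟩ := hz
    obtain ⟨d', hd', hd0', h'⟩ := hw
    refine ⟨d * d', mul_mem hd hd', mul_ne_zero hd0 hd0', ?_⟩
    have : d * d' * (z * w) = (d * z) * (d' * w) := by ring
    rw [this]
    exact mul_mem h h'

end Coordinates

section CoordModel

/-- Coordinates over `k` in which prescribed elements and an endomorphism are regular. -/
structure CoordModel {k : Type*} {K : Type u} [Field k] [Field K] [Algebra k K] (φ : K →ₐ[k] K)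
    (Z e : Finset K) where
  σ : Type u
  fintype : Fintype σ
  x : σ → K
  basis : IsTranscendenceBasis k x
  y : K
  F : Subfield K
  x_mem_F : ∀ i, x i ∈ F
  map_mem_F : ∀ r, algebraMap k K r ∈ F
  int_y : IsIntegral F y
  d : K
  s : K
  d_mem : d ∈ Algebra.adjoin k (Set.range x)
  s_mem : s ∈ Algebra.adjoin k (Set.range x)
  d_ne : d ≠ 0
  s_ne : s ≠ 0
  coeff_mem : ∀ i, ((minpoly F y).coeff i : K) ∈ Algebra.adjoin k (insert d⁻¹ (Set.range x))
  deriv_ne : ((minpoly F y).map F.subtype).derivative.eval y ≠ 0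
  deriv_inv_mem : (((minpoly F y).map F.subtype).derivative.eval y)⁻¹ ∈
    Algebra.adjoin k (insert y (insert d⁻¹ (Set.range x)))
  b : K
  b_mem : b ∈ Algebra.adjoin k (e : Set K)
  b_ne : b ≠ 0
  b_inv_mem : b⁻¹ ∈ Algebra.adjoin k (insert y (insert d⁻¹ (Set.range x)))
  b_mul_x : ∀ i, b * x i ∈ Algebra.adjoin k (e : Set K)
  b_mul_y : b * y ∈ Algebra.adjoin k (e : Set K)
  mem : ∀ z ∈ Z, z ∈ Algebra.adjoin k (insert y (insert d⁻¹ (Set.range x)))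
  map_x : ∀ i, φ (x i) ∈ Algebra.adjoin k (insert y (insert (d * s)⁻¹ (Set.range x)))
  map_y : φ y ∈ Algebra.adjoin k (insert y (insert (d * s)⁻¹ (Set.range x)))
  map_d_inv : φ d⁻¹ ∈ Algebra.adjoin k (insert y (insert (d * s)⁻¹ (Set.range x)))
  q : σ → K
  q_mem : ∀ i, q i ∈ Algebra.adjoin k (Set.range (φ ∘ x))
  q_ne : ∀ i, q i ≠ 0
  q_inv_mem : ∀ i, (q i)⁻¹ ∈ Algebra.adjoin k (insert y (insert (d * s)⁻¹ (Set.range x)))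
  q_int : ∀ i, IsIntegral (Algebra.adjoin k (Set.range (φ ∘ x))) (q i * x i)

theorem exists_coordModel {k : Type*} {K : Type u} [Field k] [PerfectField k] [Field K]
    [Algebra k K] [Algebra.EssFiniteType k K] (φ : K →ₐ[k] K) (Z e : Finset K)
    (he : ∀ z, ∃ b ∈ Algebra.adjoin k (e : Set K), b ≠ 0 ∧ b * z ∈ Algebra.adjoin k (e : Set K)) :
    Nonempty (CoordModel φ Z e) := by
  classical
  obtain ⟨σ, _, x, y, F, hx, hF, hy, hsep, hall⟩ := exists_coordinates k K
  set X := Set.range x with hX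
  have hden (z : K) := exists_denominator hF (hall z)
  have hXF (z : K) (hz : z ∈ Algebra.adjoin k X) : z ∈ F :=
    (hF z).2 ⟨z, hz, 1, one_mem _, (div_one z).symm⟩
  let p := (minpoly F y).map F.subtype
  have hp : p.derivative.eval y ≠ 0 := by
    have h1 := hsep.aeval_derivative_ne_zero (minpoly.aeval F y)
    rw [Polynomial.aeval_def, ← Polynomial.eval_map] at h1
    change ((minpoly F y).map F.subtype).derivative.eval y ≠ 0
    rw [Polynomial.derivative_map]
    exact h1
  obtain ⟨b, hb, hb0, hbz⟩ := exists_common_denominator he (insert y (Finset.univ.image x))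
  obtain ⟨d₀, hd₀, hd₀0, hd₀z⟩ := exists_localization (k := k) (Set.subset_insert y X)
    (insert (p.derivative.eval y)⁻¹ (insert b⁻¹ Z)) fun z _ => hden z
  obtain ⟨d₁, hd₁, hd₁0, hd₁z⟩ := exists_localization (k := k) (subset_refl X)
    (p.support.image p.coeff) fun z hz => by
      obtain ⟨i, -, rfl⟩ := Finset.mem_image.1 hz
      obtain ⟨r, hr, s, hs, h⟩ := (hF ((minpoly F y).coeff i)).1 ((minpoly F y).coeff i).2
      have h2 : p.coeff i = r / s := by rw [← h]; exact Polynomial.coeff_map _ _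
      rcases eq_or_ne s 0 with rfl | hs0
      · exact ⟨1, one_mem _, one_ne_zero, by rw [h2, div_zero, mul_zero]; exact zero_mem _⟩
      · exact ⟨s, hs, hs0, by rw [h2, mul_div_cancel₀ _ hs0]; exact hr⟩
  have hd0 := mul_ne_zero hd₀0 hd₁0
  have hq (i : σ) : ∃ q ∈ Algebra.adjoin k (Set.range (φ ∘ x)), q ≠ 0 ∧
      IsIntegral (Algebra.adjoin k (Set.range (φ ∘ x))) (q * x i) := by
    obtain ⟨q, hq, h⟩ := ((hx.comp_endomorphism φ).isAlgebraic.isAlgebraic (x i)).exists_integral_multiple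
    exact ⟨q, q.2, fun h0 => hq (Subtype.ext h0), h⟩
  choose q hq hq0 hqi using hq
  obtain ⟨s, hs, hs0, hsz⟩ := exists_localization (k := k) (Set.subset_insert y X)
    (insert (φ y) (insert (φ (d₀ * d₁)⁻¹) (Finset.univ.image (φ ∘ x) ∪
      Finset.univ.image fun i => (q i)⁻¹))) fun z _ => hden z
  have hmem (z : K) (hz : z ∈ insert (p.derivative.eval y)⁻¹ (insert b⁻¹ Z)) :
      z ∈ Algebra.adjoin k (insert y (insert (d₀ * d₁)⁻¹ X)) := by
    rw [Set.insert_comm]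
    exact hd₀z d₁ hd₁ hd₁0 z hz
  have hmem' (z : K) (hz : z ∈ (insert (φ y) (insert (φ (d₀ * d₁)⁻¹)
      (Finset.univ.image (φ ∘ x) ∪ Finset.univ.image fun i => (q i)⁻¹)))) :
      z ∈ Algebra.adjoin k (insert y (insert (d₀ * d₁ * s)⁻¹ X)) := by
    rw [Set.insert_comm, mul_comm _ s]
    exact hsz _ (mul_mem hd₀ hd₁) hd0 z hz
  exact ⟨{
    σ := σ, fintype := inferInstance, x := x, basis := hx, y := y, F := F
    x_mem_F := fun i => hXF _ (Algebra.subset_adjoin ⟨i, rfl⟩)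
    map_mem_F := fun r => hXF _ (Subalgebra.algebraMap_mem _ r)
    int_y := hy, d := d₀ * d₁, s := s, d_mem := mul_mem hd₀ hd₁, s_mem := hs, d_ne := hd0
    s_ne := hs0
    coeff_mem := fun i => by
      have h2 : ((minpoly F y).coeff i : K) = p.coeff i := (Polynomial.coeff_map F.subtype i).symm
      rw [h2]
      by_cases hi : i ∈ p.support
      · rw [mul_comm]
        exact hd₁z d₀ hd₀ hd₀0 _ (Finset.mem_image_of_mem _ hi)
      · rw [Polynomial.notMem_support_iff.1 hi]
        exact zero_mem _
    deriv_ne := hp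
    deriv_inv_mem := hmem _ (Finset.mem_insert_self _ _)
    b := b, b_mem := hb, b_ne := hb0
    b_inv_mem := hmem _ (by simp)
    b_mul_x := fun i => hbz _ (by simp)
    b_mul_y := hbz _ (by simp)
    mem := fun z hz => hmem _ (by simp [hz])
    map_x := fun i => hmem' _ (by simp)
    map_y := hmem' _ (by simp)
    map_d_inv := hmem' _ (by simp)
    q := q, q_mem := hq, q_ne := hq0
    q_inv_mem := fun i => hmem' _ (by simp)
    q_int := hqi }⟩

end CoordModel

section Lefschetz

open Filter

/-- Function field data of a proper variety with an endomorphism `φ` and a line bundle `L` such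
that `φ^*L ⊗ L⁻¹` is ample. -/
structure PolarSystem {k : Type*} {K : Type u} [Field k] [Field K] [Algebra k K] (φ : K →ₐ[k] K)
    where
  ι : Type
  finite : Finite ι
  c : ι → Finset K
  c_ne : ∀ α, 0 ∉ c α
  chart : ∀ O : ValuationSubring K, (∀ r, algebraMap k K r ∈ O) → ∃ α, ∀ z ∈ c α, z ∈ O
  t : ι → K
  t_ne : ∀ α, t α ≠ 0
  g : K
  g_ne : g ≠ 0
  e : Finset K
  frac : ∀ z, ∃ b ∈ Algebra.adjoin k (e : Set K), b ≠ 0 ∧ b * z ∈ Algebra.adjoin k (e : Set K)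
  m : ℕ
  n : ℕ
  int : ∀ α β, IsIntegral (Algebra.adjoin k ((c α : Set K) ∪ φ '' c β))
    (φ (t β) ^ m * (t α)⁻¹ ^ m * g)
  int_e : ∀ α β, ∀ l ∈ e, IsIntegral (Algebra.adjoin k ((c α : Set K) ∪ φ '' c β))
    (l * (φ (t β) ^ m * (t α)⁻¹ ^ m * g) ^ n)

variable {k : Type*} {K : Type u} [Field k] [Field K] [Algebra k K] {φ : K →ₐ[k] K}

theorem essFiniteType_of_frac (e : Finset K)
    (h : ∀ z, ∃ b ∈ Algebra.adjoin k (e : Set K), b ≠ 0 ∧ b * z ∈ Algebra.adjoin k (e : Set K)) :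
    Algebra.EssFiniteType k K := by
  refine (Algebra.essFiniteType_iff k K).2 ⟨e, fun z => ?_⟩
  obtain ⟨b, hb, hb0, hbz⟩ := h z
  exact ⟨b, hb, hb0.isUnit, by rwa [mul_comm]⟩

/-- The spreading out of a coordinate model over a finitely generated ring of coefficients. -/
theorem CoordModel.eventually_arithModel {Z e : Finset K} (M : CoordModel φ Z e) :
    ∀ᶠ T : Finset k in atTop, ∀ A A' : Subalgebra (coeffRing T) K,
      A = Algebra.adjoin (coeffRing T) (insert M.y (insert M.d⁻¹ (Set.range M.x))) →
      A' = Algebra.adjoin (coeffRing T) (insert M.y (insert (M.d * M.s)⁻¹ (Set.range M.x))) →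
      (∀ z ∈ Z, z ∈ A) ∧
      ∃ (D : ArithModel A A' (φ.restrictScalars (coeffRing T)) M.σ) (_ : EtaleData A' D.x e),
        D.coord.toRingHom.Flat ∧ ∀ m : Ideal (coeffRing T), m.IsMaximal →
          D.s ∉ genericIdeal M.σ m ∧
          (∃ q : Ideal A', q.IsPrime ∧ q.comap D.coord.toRingHom = genericIdeal M.σ m) ∧
          {q : Ideal A' | q.IsPrime ∧ q.comap D.coord.toRingHom = genericIdeal M.σ m}.Finite := by
  have := M.fintype
  have hds := mul_ne_zero M.d_ne M.s_ne
  have hp : ∀ᶠ T : Finset k in atTop, ∀ i ∈ (minpoly M.F M.y).support,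
      ((minpoly M.F M.y).coeff i : K) ∈
        Algebra.adjoin (coeffRing T) (insert M.d⁻¹ (Set.range M.x)) :=
    (Finset.eventually_all _).2 fun i _ => eventually_mem_adjoin (M.coeff_mem i)
  filter_upwards [hp, (Finset.eventually_all _).2 fun z hz => eventually_mem_adjoin (M.mem z hz),
    eventually_mem_adjoin M.d_mem, eventually_mem_adjoin M.s_mem,
    eventually_mem_adjoin M.deriv_inv_mem, eventually_mem_adjoin M.b_inv_mem,
    eventually_mem_adjoin M.b_mem, eventually_mem_adjoin M.b_mul_y,
    eventually_all.2 fun i => eventually_mem_adjoin (M.b_mul_x i),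
    eventually_all.2 fun i => eventually_mem_adjoin (M.map_x i), eventually_mem_adjoin M.map_y,
    eventually_mem_adjoin M.map_d_inv, eventually_all.2 fun i => eventually_mem_adjoin (M.q_mem i),
    eventually_all.2 fun i => eventually_mem_adjoin (M.q_inv_mem i),
    eventually_all.2 fun i => eventually_isIntegral (M.q_int i),
    eventually_notMem_genericIdeal M.basis.1 M.s_mem M.s_ne,
    eventually_notMem_genericIdeal M.basis.1 (mul_mem M.d_mem M.s_mem) hds]
    with T hp hZ hd hs hderiv hb' hb hby hbx hφx hφy hφd hq hq' hqi hsm hdsm A A' hA hA'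
  have hXA' : Algebra.adjoin (coeffRing T) (Set.range M.x) ≤ A' := hA' ▸ Algebra.adjoin_mono
    ((Set.subset_insert _ _).trans (Set.subset_insert _ _))
  have hdsA' : (M.d * M.s)⁻¹ ∈ A' := hA' ▸ Algebra.subset_adjoin (Or.inr (Or.inl rfl))
  have hyA' : M.y ∈ A' := hA' ▸ Algebra.subset_adjoin (Or.inl rfl)
  have hdA' : M.d⁻¹ ∈ A' := by
    have : M.d⁻¹ = M.s * (M.d * M.s)⁻¹ := by
      rw [mul_inv_rev, mul_inv_cancel_left₀ M.s_ne]
    rw [this]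
    exact mul_mem (hXA' hs) hdsA'
  have hsA' : (M.s)⁻¹ ∈ A' := by
    have : M.s⁻¹ = M.d * (M.d * M.s)⁻¹ := by
      rw [mul_inv, mul_inv_cancel_left₀ M.d_ne]
    rw [this]
    exact mul_mem (hXA' hd) hdsA'
  have hle : A ≤ A' := hA ▸ Algebra.adjoin_le (by
    rintro z (rfl | rfl | hz)
    · exact hyA'
    · exact hdA'
    · exact hXA' (Algebra.subset_adjoin hz))
  have hXA : Algebra.adjoin (coeffRing T) (Set.range M.x) ≤ A := hA ▸ Algebra.adjoin_mono
    ((Set.subset_insert _ _).trans (Set.subset_insert _ _))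
  have hpd (i) : ((minpoly M.F M.y).coeff i : K) ∈
      Algebra.adjoin (coeffRing T) (insert (M.d * M.s)⁻¹ (Set.range M.x)) := by
    by_cases hi : i ∈ (minpoly M.F M.y).support
    · refine Algebra.adjoin_le ?_ (hp i hi)
      rintro z (rfl | hz)
      · have : M.d⁻¹ = M.s * (M.d * M.s)⁻¹ := by
          rw [mul_inv_rev, mul_inv_cancel_left₀ M.s_ne]
        rw [this]
        exact mul_mem (Algebra.adjoin_mono (Set.subset_insert _ _) hs)
          (Algebra.subset_adjoin (Or.inl rfl))
      · exact Algebra.subset_adjoin (Or.inr hz)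
    · rw [Polynomial.notMem_support_iff.1 hi]
      exact zero_mem _
  have hs' := hs
  have hds' := mul_mem hd hs
  rw [Algebra.adjoin_range_eq_range_aeval] at hs' hds'
  obtain ⟨s, hs'⟩ := hs'
  obtain ⟨Q, hQ⟩ := hds'
  replace hs' : MvPolynomial.aeval M.x s = M.s := hs'
  replace hQ : MvPolynomial.aeval M.x Q = M.d * M.s := hQ
  let D : ArithModel A A' (φ.restrictScalars (coeffRing T)) M.σ :=
    { le := hle
      map_mem := fun a ha => by
        rw [hA] at ha
        have h1 : Algebra.adjoin (coeffRing T) (insert M.y (insert M.d⁻¹ (Set.range M.x))) ≤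
            A'.comap (φ.restrictScalars (coeffRing T)) := Algebra.adjoin_le (by
          rw [hA']
          rintro z (rfl | rfl | ⟨i, rfl⟩)
          · exact hφy
          · exact hφd
          · exact hφx i)
        exact h1 ha
      x := M.x
      x_mem := fun i => hXA (Algebra.subset_adjoin ⟨i, rfl⟩)
      s := s
      s_ne := by rw [hs']; exact M.s_ne
      s_inv := by rw [hs']; exact hsA'
      away := fun z hz => by
        rw [hA'] at hz
        refine exists_pow_mul_mem_of_mem_adjoin (by rw [hs']; exact hXA hs) ?_ hz
        rintro z (rfl | rfl | hz)
        · exact ⟨0, by rw [pow_zero, one_mul, hA]; exact Algebra.subset_adjoin (Or.inl rfl)⟩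
        · refine ⟨1, ?_⟩
          rw [pow_one, hs', mul_inv_rev, mul_inv_cancel_left₀ M.s_ne, hA]
          exact Algebra.subset_adjoin (Or.inr (Or.inl rfl))
        · exact ⟨0, by rw [pow_zero, one_mul]; exact hXA (Algebra.subset_adjoin hz)⟩
      q := M.q
      q_mem := hq
      q_ne := M.q_ne
      q_inv := fun i => hA' ▸ hq' i
      q_int := hqi }
  have hx : AlgebraicIndependent (coeffRing T) M.x :=
    M.basis.1.restrictScalars Subtype.val_injective
  obtain ⟨hflat, hex, hfin⟩ := flat_of_coeff_minpoly_mem hx Q (by rw [hQ]; exact hds) M.x_mem_F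
    (fun r => M.map_mem_F r) M.int_y (by rwa [hQ]) (by rwa [hQ]) D.coord D.coe_coord
  refine ⟨fun z hz => hA ▸ hZ z hz, D, ?_, hflat, fun m hm => ⟨hsm s hs' m hm.isPrime,
    hex m hm.isPrime (hdsm Q hQ m hm.isPrime), hfin _⟩⟩
  exact {
    y := M.y
    y_mem := hyA'
    δ := M.d * M.s
    δ_mem := mul_mem hd hs
    δ_ne := hds
    δ_inv := hdsA'
    le_adjoin := hA'.le
    p := (minpoly M.F M.y).map M.F.subtype
    p_mem := fun i => by
      rw [Polynomial.coeff_map]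
      exact hpd i
    p_eval := by
      rw [Polynomial.eval_map]
      exact minpoly.aeval M.F M.y
    p_deriv := M.deriv_ne
    p_deriv_inv := hle (hA ▸ hderiv)
    b := M.b
    b_mem := hb
    b_ne := M.b_ne
    b_inv := hle (hA ▸ hb')
    b_mul_x := hbx
    b_mul_y := hby }

end Lefschetz

section LefschetzPoints

open Filter

variable {k : Type*} {K : Type u} [Field k] [Field K] [Algebra k K] {φ : K →ₐ[k] K}

/-- The elements whose regularity is required by a polar system. -/
def PolarSystem.elements (S : PolarSystem φ) : Set K :=
  (⋃ α, (S.c α : Set K)) ∪ (⋃ α, (·⁻¹) '' (S.c α : Set K)) ∪ Set.range S.t ∪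
    Set.range (fun α => (S.t α)⁻¹) ∪ {S.g, S.g⁻¹} ∪ S.e

theorem PolarSystem.finite_elements (S : PolarSystem φ) : S.elements.Finite := by
  have := S.finite
  refine Set.Finite.union (Set.Finite.union (Set.Finite.union (Set.Finite.union (Set.Finite.union
    ?_ ?_) ?_) ?_) ?_) ?_
  · exact Set.finite_iUnion fun α => (S.c α).finite_toSet
  · exact Set.finite_iUnion fun α => (S.c α).finite_toSet.image _
  · exact Set.finite_range _
  · exact Set.finite_range _
  · exact Set.toFinite _
  · exact S.e.finite_toSet

theorem PolarSystem.eventually_polarData (S : PolarSystem φ) :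
    ∀ᶠ T : Finset k in atTop, ∀ A A' : Subalgebra (coeffRing T) K, A ≤ A' →
      (∀ a ∈ A, φ a ∈ A') → (∀ z ∈ S.elements, z ∈ A) →
      ∃ pd : PolarData A A' (φ.restrictScalars (coeffRing T)), pd.e = S.e := by
  classical
  have := S.finite
  have := Fintype.ofFinite S.ι
  have hq : ∀ᶠ T : Finset k in atTop, ∀ j ∈ Fintype.piFinset S.c, ∃ q : S.ι →₀ K,
      (∀ α, q α ∈ Algebra.adjoin (coeffRing T) (Set.range fun β => (j β)⁻¹)) ∧
        (q.sum fun α a => a * (j α)⁻¹) = 1 := by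
    refine (Finset.eventually_all _).2 fun j hj => ?_
    obtain ⟨q, hq, hq1⟩ := exists_inv_sum_eq_one S.c S.c_ne S.chart j (Fintype.mem_piFinset.1 hj)
    filter_upwards [eventually_all.2 fun α => eventually_mem_adjoin (hq α)] with T hT
    exact ⟨q, hT, hq1⟩
  filter_upwards [hq, eventually_all.2 fun α => eventually_all.2 fun β =>
      eventually_isIntegral (S.int α β),
    eventually_all.2 fun α => eventually_all.2 fun β => (Finset.eventually_all _).2 fun l hl =>
      eventually_isIntegral (S.int_e α β l hl)] with T hq h1 h2 A A' hle hmap hmem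
  have hc (α) (z) (hz : z ∈ S.c α) : z ∈ A :=
    hmem z (Or.inl (Or.inl (Or.inl (Or.inl (Or.inl (Set.mem_iUnion.2 ⟨α, hz⟩))))))
  have hc' (α) (z) (hz : z ∈ S.c α) : z⁻¹ ∈ A :=
    hmem _ (Or.inl (Or.inl (Or.inl (Or.inl (Or.inr (Set.mem_iUnion.2 ⟨α, z, hz, rfl⟩))))))
  exact ⟨{
    le := hle
    map_mem := hmap
    ι := S.ι
    c := S.c
    c_mem := fun α z hz => ⟨fun h => S.c_ne α (h ▸ hz), hc α z hz, hc' α z hz⟩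
    q := fun j hj => hq j (Fintype.mem_piFinset.2 hj)
    t := S.t
    t_ne := S.t_ne
    t_mem := fun α => hmem _ (Or.inl (Or.inl (Or.inl (Or.inr ⟨α, rfl⟩))))
    t_inv := fun α => hmem _ (Or.inl (Or.inl (Or.inr ⟨α, rfl⟩)))
    g := S.g
    g_ne := S.g_ne
    g_mem := hmem _ (Or.inl (Or.inr (Or.inl rfl)))
    g_inv := hmem _ (Or.inl (Or.inr (Or.inr rfl)))
    e := S.e
    e_mem := fun l hl => hmem l (Or.inr hl)
    m := S.m
    n := S.n
    int := h1
    int_e := h2 }, rfl⟩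

/-- Periodic points exist on every affine open set. -/
theorem PolarSystem.exists_periodic [IsAlgClosed k] (S : PolarSystem φ) (Z : Finset K) :
    ∃ (N : ℕ) (_ : 0 < N) (χ : ℕ → (Algebra.adjoin k (Z : Set K) →ₐ[k] k)),
      (∀ i (a b : Algebra.adjoin k (Z : Set K)), (b : K) = φ a → χ (i + 1) a = χ i b) ∧
      ∀ i, χ (i + N) = χ i := by
  classical
  have := essFiniteType_of_frac S.e S.frac
  obtain ⟨M⟩ := exists_coordModel φ (Z ∪ S.finite_elements.toFinset) S.e S.frac
  have := M.fintype
  have hfin : (insert M.y (insert (M.d * M.s)⁻¹ (Set.range M.x))).Finite :=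
    ((Set.finite_range M.x).insert _).insert _
  have hfinA : (insert M.y (insert M.d⁻¹ (Set.range M.x))).Finite :=
    ((Set.finite_range M.x).insert _).insert _
  have hGZ : ∀ᶠ T : Finset k in atTop, ∀ z ∈ hfinA.toFinset, ∃ w ∈
      Algebra.adjoin (coeffRing T) (insert M.y (insert (M.d * M.s)⁻¹ (Set.range M.x))), w = φ z :=
    by
    refine (Finset.eventually_all _).2 fun z hz => ?_
    rw [Set.Finite.mem_toFinset] at hz
    have h1 : φ z ∈ Algebra.adjoin k (insert M.y (insert (M.d * M.s)⁻¹ (Set.range M.x))) := by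
      rcases hz with rfl | rfl | ⟨i, rfl⟩
      · exact M.map_y
      · exact M.map_d_inv
      · exact M.map_x i
    filter_upwards [eventually_mem_adjoin h1] with T hT using ⟨_, hT, rfl⟩
  obtain ⟨T, hmodel, hpolar, hext, hGZ⟩ := (M.eventually_arithModel.and
    (S.eventually_polarData.and ((eventually_exists_extend hfin.toFinset).and hGZ))).exists
  let A := Algebra.adjoin (coeffRing T) (insert M.y (insert M.d⁻¹ (Set.range M.x)))
  let A' := Algebra.adjoin (coeffRing T) (insert M.y (insert (M.d * M.s)⁻¹ (Set.range M.x)))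
  obtain ⟨hZ, D, ed, hflat, hm⟩ := hmodel A A' rfl rfl
  obtain ⟨pd, hpd⟩ := hpolar A A' D.le D.map_mem fun z hz => hZ z (by simp [hz])
  have hFT : Algebra.FiniteType ℤ (coeffRing T) :=
    (Subalgebra.fg_iff_finiteType _).1 (Subalgebra.fg_adjoin_finset T)
  have hNR : IsNoetherianRing (coeffRing T) := Algebra.FiniteType.isNoetherianRing ℤ _
  have hFTA : Algebra.FiniteType (coeffRing T) A' :=
    (Subalgebra.fg_iff_finiteType _).1 ⟨hfin.toFinset, by rw [Set.Finite.coe_toFinset]⟩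
  have hNA : IsNoetherianRing A' := Algebra.FiniteType.isNoetherianRing (coeffRing T) _
  obtain ⟨m, hmax⟩ := Ideal.exists_maximal (coeffRing T)
  obtain ⟨hs, hex, hfin'⟩ := hm m hmax
  have := Ideal.IsMaximal.finite_quotient_of_finiteType m
  obtain ⟨G, hG⟩ := hFTA.out
  obtain ⟨E, _, _, N, P, hP, -⟩ := D.exists_isOrbit m hs hG hex hfin'
  obtain ⟨χ, hχ⟩ := exists_algHom_isOrbit (k := k) Subtype.val_injective D pd (by rw [hpd]; exact ed)
    hflat hP
  have hcoe : (hfin.toFinset : Set K) = insert M.y (insert (M.d * M.s)⁻¹ (Set.range M.x)) :=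
    hfin.coe_toFinset
  have hext' (i) := hext A' (by rw [hcoe]) (χ i)
  choose χ' hχ' using hext'
  let B := Algebra.adjoin k (insert M.y (insert M.d⁻¹ (Set.range M.x)))
  let B' := Algebra.adjoin k (hfin.toFinset : Set K)
  have hAB' (a : A') : (a : K) ∈ B' := by
    have h1 : A' ≤ B'.restrictScalars (coeffRing T) := Algebra.adjoin_le (by
      rw [← hcoe]
      exact Algebra.subset_adjoin)
    exact h1 a.2
  have hBB' : B ≤ B' := Algebra.adjoin_le fun z hz =>
    hAB' ⟨z, D.le (Algebra.subset_adjoin hz)⟩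
  have hφB : B ≤ B'.comap φ := Algebra.adjoin_le fun z hz => by
    obtain ⟨w, hw, hwz⟩ := hGZ z (hfinA.mem_toFinset.2 hz)
    change φ z ∈ B'
    rw [← hwz]
    exact hAB' ⟨w, hw⟩
  have hstep (i : ℕ) : (χ' (i + 1)).comp (Subalgebra.inclusion hBB') =
      (χ' i).comp ((φ.comp B.val).codRestrict B' fun b => hφB b.2) := by
    refine AlgHom.adjoin_ext fun z hz => ?_
    obtain ⟨w, hw, hwz⟩ := hGZ z (hfinA.mem_toFinset.2 hz)
    have hzA : z ∈ A' := D.le (Algebra.subset_adjoin hz)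
    have h1 := hχ' (i + 1) ⟨z, hzA⟩ ⟨z, hAB' ⟨z, hzA⟩⟩ rfl
    have h2 := hχ' i ⟨w, hw⟩ ⟨φ z, hφB (Algebra.subset_adjoin hz)⟩ hwz.symm
    change χ' (i + 1) ⟨z, _⟩ = χ' i ⟨φ z, _⟩
    rw [h1, h2]
    exact hχ.step i ⟨z, hzA⟩ ⟨w, hw⟩ (Algebra.subset_adjoin hz) hwz
  have hper (i : ℕ) : χ' (i + N) = χ' i := by
    refine AlgHom.adjoin_ext fun z hz => ?_
    have hzA : z ∈ A' := Algebra.subset_adjoin (by rwa [← hcoe])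
    rw [hχ' (i + N) ⟨z, hzA⟩ _ rfl, hχ' i ⟨z, hzA⟩ _ rfl]
    exact DFunLike.congr_fun (hχ.periodic i) _
  have hZB : Algebra.adjoin k (Z : Set K) ≤ B := Algebra.adjoin_le fun z hz =>
    M.mem z (Finset.mem_union_left _ hz)
  refine ⟨N, hP.pos, fun i => (χ' i).comp (Subalgebra.inclusion (hZB.trans hBB')),
    fun i a b hab => ?_, fun i => congrArg (fun f => f.comp (Subalgebra.inclusion (hZB.trans hBB'))) (hper i)⟩
  have h1 := DFunLike.congr_fun (hstep i) ⟨a, hZB a.2⟩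
  refine h1.trans ?_
  change χ' i ⟨φ a, _⟩ = χ' i ⟨b, _⟩
  congr 1
  exact Subtype.ext hab.symm

end LefschetzPoints

section Center

variable {X Y : Scheme.{u}}

/-- Sections near the generic point, as rational functions. -/
def genGerm (X : Scheme.{u}) [IrreducibleSpace X] (V : X.Opens) (h : genericPoint X ∈ V) :
    Γ(X, V) →+* X.functionField :=
  (X.presheaf.germ V (genericPoint X) h).hom

theorem genGerm_sres [IrreducibleSpace X] {V W : X.Opens} (hle : V ≤ W) (h : genericPoint X ∈ V)
    (a : Γ(X, W)) : genGerm X V h (sres X hle a) = genGerm X W (hle h) a :=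
  X.presheaf.germ_res_apply (homOfLE hle) (genericPoint X) h a

theorem genGerm_injective [IsIntegral X] {V : X.Opens} (h : genericPoint X ∈ V) :
    Function.Injective (genGerm X V h) :=
  germ_injective_of_isIntegral X _ h

theorem genericPoint_mem [IrreducibleSpace X] {V : X.Opens} {x : X} (hx : x ∈ V) :
    genericPoint X ∈ V :=
  ((genericPoint_spec X).mem_open_set_iff V.isOpen).2 ⟨x, trivial, hx⟩

theorem map_genericPoint_of_isDominant [IrreducibleSpace X] [IrreducibleSpace Y] (f : X ⟶ Y)
    [IsDominant f] : f (genericPoint X) = genericPoint Y := by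
  apply ((genericPoint_spec Y).eq _).symm
  convert! (genericPoint_spec X).image f.continuous
  rw [Set.image_univ, f.denseRange.closure_range]

variable [IsIntegral X] (O : ValuationSubring X.functionField)

/-- The inclusion of the spectrum of the function field into that of a valuation ring. -/
def specSubring : Spec X.functionField ⟶ Spec (CommRingCat.of O) :=
  Spec.map (CommRingCat.ofHom O.subtype)

variable {O}

/-- A morphism from the spectrum of a valuation ring of the function field extending the inclusion
of the generic point. -/
def IsCenter (l : Spec (CommRingCat.of O) ⟶ X) : Prop :=
  specSubring O ≫ l = X.fromSpecStalk (genericPoint X)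

theorem IsCenter.genGerm_mem {l : Spec (CommRingCat.of O) ⟶ X} (hl : IsCenter l) {V : X.Opens}
    (hV : l (IsLocalRing.closedPoint O) ∈ V) (h : genericPoint X ∈ V) (a : Γ(X, V)) :
    genGerm X V h a ∈ O := by
  have hs : genericPoint X ⤳ l (IsLocalRing.closedPoint O) :=
    (genericPoint_spec X).specializes trivial
  have h1 : Scheme.stalkClosedPointTo l ≫ CommRingCat.ofHom O.subtype =
      X.presheaf.stalkSpecializes hs := by
    apply Spec.map_injective
    rw [← cancel_mono (X.fromSpecStalk (l (IsLocalRing.closedPoint O))),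
      Scheme.SpecMap_stalkSpecializes_fromSpecStalk, Spec.map_comp, Category.assoc,
      Scheme.Spec_stalkClosedPointTo_fromSpecStalk]
    exact hl
  have h2 : X.presheaf.germ V _ hV ≫ X.presheaf.stalkSpecializes hs = X.presheaf.germ V _ h :=
    X.presheaf.germ_stalkSpecializes _ _
  rw [← h1] at h2
  have h3 := congrArg (fun f => f.hom a) h2
  change O.subtype _ = genGerm X V h a at h3
  rw [← h3]
  exact Subtype.property _

theorem exists_isCenter_of_universallyClosed {S : Scheme.{u}} (f : X ⟶ S) [UniversallyClosed f]
    (i : Spec (CommRingCat.of O) ⟶ S)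
    (hi : specSubring O ≫ i = X.fromSpecStalk (genericPoint X) ≫ f) :
    ∃ l : Spec (CommRingCat.of O) ⟶ X, IsCenter l := by
  have h : ValuativeCriterion.Existence f := by
    have : UniversallyClosed f := inferInstance
    rw [UniversallyClosed.eq_valuativeCriterion] at this
    exact this.1
  obtain ⟨⟨l⟩⟩ := h
    { R := O
      K := X.functionField
      i₁ := X.fromSpecStalk (genericPoint X)
      i₂ := i
      commSq := ⟨hi.symm⟩ }
  exact ⟨l.l, l.fac_left⟩

/-- The morphism to an affine open subset whose sections map to `O`. -/
def affineLift {V : X.Opens} (hV : IsAffineOpen V) (f : Γ(X, V) →+* O) :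
    Spec (CommRingCat.of O) ⟶ X :=
  Spec.map (CommRingCat.ofHom f) ≫ hV.fromSpec

theorem affineLift_mem {V : X.Opens} (hV : IsAffineOpen V) (f : Γ(X, V) →+* O)
    (y : Spec (CommRingCat.of O)) : affineLift hV f y ∈ V := by
  have : affineLift hV f y ∈ Set.range hV.fromSpec := ⟨Spec.map (CommRingCat.ofHom f) y, rfl⟩
  rwa [hV.range_fromSpec] at this

theorem specSubring_affineLift {V : X.Opens} (hV : IsAffineOpen V) (f : Γ(X, V) →+* O) :
    specSubring O ≫ affineLift hV f =
      Spec.map (CommRingCat.ofHom (O.subtype.comp f)) ≫ hV.fromSpec := by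
  exact (Category.assoc _ _ _).symm.trans (congrArg (· ≫ hV.fromSpec) (Spec.map_comp _ _).symm)

theorem isCenter_affineLift {V : X.Opens} (hV : IsAffineOpen V) (h : genericPoint X ∈ V)
    (f : Γ(X, V) →+* O) (hf : O.subtype.comp f = genGerm X V h) :
    IsCenter (affineLift hV f) := by
  rw [IsCenter, specSubring_affineLift, hf, ← hV.fromSpecStalk_eq_fromSpecStalk h]
  rfl

instance : IsDominant (specSubring O) := by
  refine ⟨?_⟩
  refine (PrimeSpectrum.denseRange_comap_iff_ker_le_nilRadical O.subtype).2 ?_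
  rw [(RingHom.injective_iff_ker_eq_bot _).1 O.subtype_injective]
  exact bot_le

end Center

section FunctionFieldMap

variable {X : Scheme.{u}} [IsIntegral X] (φ : X ⟶ X) [IsDominant φ]

/-- The endomorphism of the function field induced by a dominant endomorphism. -/
def funMap : X.functionField →+* X.functionField :=
  (X.presheaf.stalkSpecializes (specializes_of_eq (map_genericPoint_of_isDominant φ)) ≫
    φ.stalkMap (genericPoint X)).hom

theorem specMap_funMap : Spec.map (CommRingCat.ofHom (funMap φ)) ≫
    X.fromSpecStalk (genericPoint X) = X.fromSpecStalk (genericPoint X) ≫ φ := by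
  rw [← Scheme.SpecMap_stalkMap_fromSpecStalk,
    ← Scheme.SpecMap_stalkSpecializes_fromSpecStalk
      (specializes_of_eq (map_genericPoint_of_isDominant φ)), ← Spec.map_comp_assoc]
  rfl

theorem funMap_genGerm {V W : X.Opens} (hV : genericPoint X ∈ V) (hW : genericPoint X ∈ W)
    (e : W ≤ φ ⁻¹ᵁ V) (a : Γ(X, V)) :
    funMap φ (genGerm X V hV a) = genGerm X W hW (φ.appLE V W e a) := by
  have h1 : X.presheaf.germ V _ hV ≫ X.presheaf.stalkSpecializes
      (specializes_of_eq (map_genericPoint_of_isDominant φ)) ≫ φ.stalkMap (genericPoint X) =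
      φ.appLE V W e ≫ X.presheaf.germ W _ hW := by
    rw [X.presheaf.germ_stalkSpecializes_assoc, Scheme.Hom.germ_stalkMap, Scheme.Hom.appLE,
      Category.assoc, TopCat.Presheaf.germ_res]
  exact congrArg (fun f => f.hom a) h1

variable {φ} {O : ValuationSubring X.functionField}

theorem exists_isCenter_mem [X.IsSeparated] {V W : X.Opens} (hV : IsAffineOpen V)
    (hW : IsAffineOpen W) (hηV : genericPoint X ∈ V) (hηW : genericPoint X ∈ W)
    (hVO : ∀ a, genGerm X V hηV a ∈ O) (hWO : ∀ a, funMap φ (genGerm X W hηW a) ∈ O) :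
    ∃ l : Spec (CommRingCat.of O) ⟶ X, IsCenter l ∧
      l (IsLocalRing.closedPoint O) ∈ V ⊓ φ ⁻¹ᵁ W := by
  let f : Γ(X, V) →+* O := (genGerm X V hηV).codRestrict O hVO
  let f' : Γ(X, W) →+* O := ((funMap φ).comp (genGerm X W hηW)).codRestrict O hWO
  have hc : IsCenter (affineLift hV f) := isCenter_affineLift hV hηV f rfl
  have h1 : affineLift hV f ≫ φ = affineLift hW f' := by
    refine ext_of_isDominant (specSubring O) ?_
    rw [← Category.assoc, hc, specSubring_affineLift, ← specMap_funMap,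
      ← hW.fromSpecStalk_eq_fromSpecStalk hηW, IsAffineOpen.fromSpecStalk, ← Spec.map_comp_assoc]
    rfl
  refine ⟨_, hc, affineLift_mem hV f _, ?_⟩
  change (affineLift hV f ≫ φ) _ ∈ W
  rw [h1]
  exact affineLift_mem hW f' _

theorem genGerm_mem_of_affine [X.IsSeparated] {V W T : X.Opens} (hV : IsAffineOpen V)
    (hW : IsAffineOpen W) (hηV : genericPoint X ∈ V) (hηW : genericPoint X ∈ W)
    (hVO : ∀ a, genGerm X V hηV a ∈ O) (hWO : ∀ a, funMap φ (genGerm X W hηW a) ∈ O)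
    (hT : V ⊓ φ ⁻¹ᵁ W ≤ T) (hηT : genericPoint X ∈ T) (a : Γ(X, T)) :
    genGerm X T hηT a ∈ O := by
  obtain ⟨l, hl, hmem⟩ := exists_isCenter_mem hV hW hηV hηW hVO hWO
  exact hl.genGerm_mem (hT hmem) hηT a

/-- An element of a field is integral over a subalgebra as soon as it lies in all the valuation
subrings containing it. -/
theorem isIntegral_of_forall_valuationSubring {k K : Type*} [CommRing k] [Field K] [Algebra k K]
    (A : Subalgebra k K) (z : K) (h : ∀ O : ValuationSubring K, (∀ a ∈ A, a ∈ O) → z ∈ O) :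
    _root_.IsIntegral A z := by
  have h1 : z ∈ (⨅ V : {V : ValuationSubring K // (A : Set K) ⊆ V.toSubring}, V.1.toSubring) :=
    Subring.mem_iInf.2 fun V => h V.1 V.2
  rw [iInf_valuationSubring_superset] at h1
  obtain ⟨p, hp, hz⟩ := h1
  let f : Subring.closure (A : Set K) →+* A :=
    (Subring.closure (A : Set K)).subtype.codRestrict A.toSubring fun b =>
      (Subring.closure_le (t := A.toSubring)).2 le_rfl b.2
  have h3 : _root_.IsIntegral (Subring.closure (A : Set K)) z := ⟨p, hp, hz⟩
  exact h3.map_of_comp_eq f (RingHom.id K) rfl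

end FunctionFieldMap

section ProjectiveVariety

attribute [local instance] MvPolynomial.gradedAlgebra

open MvPolynomial in
theorem finiteType_homogeneousSubmodule_zero (k : Type u) [Field k] (N : ℕ) :
    Algebra.FiniteType (homogeneousSubmodule (Fin (N + 1)) k 0) (MvPolynomial (Fin (N + 1)) k) := by
  classical
  refine ⟨⟨Finset.univ.image X, ?_⟩⟩
  refine top_le_iff.1 fun p _ => ?_
  induction p using MvPolynomial.induction_on with
  | C a =>
    exact (Algebra.adjoin (homogeneousSubmodule (Fin (N + 1)) k 0) _).algebraMap_mem
      (degreeZeroInclusion k N a)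
  | add p q hp hq => exact add_mem (hp trivial) (hq trivial)
  | mul_X p i hp => exact mul_mem (hp trivial) (Algebra.subset_adjoin (by simp))

theorem degreeZeroInclusion_bijective (k : Type u) [Field k] (N : ℕ) :
    Function.Bijective (degreeZeroInclusion k N) := by
  refine ⟨fun a b h => MvPolynomial.C_injective _ _ (congrArg Subtype.val h),
    fun ⟨p, hp⟩ => ⟨MvPolynomial.coeff 0 p, ?_⟩⟩
  ext1
  exact (MvPolynomial.totalDegree_eq_zero_iff_eq_C.1
    (MvPolynomial.totalDegree_zero_iff_isHomogeneous _ |>.2 hp)).symm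

theorem ProjSpace.isProper_str (k : Type u) [Field k] (N : ℕ) : IsProper (ProjSpace.str k N) := by
  have := finiteType_homogeneousSubmodule_zero k N
  have : IsIso (CommRingCat.ofHom (degreeZeroInclusion k N)) :=
    (ConcreteCategory.isIso_iff_bijective _).2 (degreeZeroInclusion_bijective k N)
  exact MorphismProperty.comp_mem (W := @IsProper) _ _
    (inferInstanceAs (IsProper (Proj.toSpecZero (MvPolynomial.homogeneousSubmodule _ k))))
    (inferInstanceAs (IsProper (Spec.map (CommRingCat.ofHom (degreeZeroInclusion k N)))))

theorem IsProjectiveVariety.isProper {k : Type u} [Field k] {X : Scheme.{u}}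
    {sX : X ⟶ Spec (CommRingCat.of k)} (h : IsProjectiveVariety sX) : IsProper sX := by
  obtain ⟨-, N, ι, hι, rfl⟩ := h
  have := ProjSpace.isProper_str k N
  infer_instance

variable {k : Type u} [Field k] {X : Scheme.{u}} (sX : X ⟶ Spec (CommRingCat.of k))

/-- The structure map from the base field to the sections of a scheme. -/
def secMap (V : X.Opens) : k →+* Γ(X, V) :=
  (sX.appLE ⊤ V le_top).hom.comp (Scheme.ΓSpecIso (CommRingCat.of k)).inv.hom

theorem eq_toSpecΓ_secMap : sX = X.toSpecΓ ≫ Spec.map (CommRingCat.ofHom (secMap sX ⊤)) := by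
  have h1 : CommRingCat.ofHom (secMap sX ⊤) =
      (Scheme.ΓSpecIso (CommRingCat.of k)).inv ≫ sX.appTop := by
    have h2 : sX.appLE ⊤ ⊤ le_top = sX.appTop := Scheme.Hom.appLE_eq_app ..
    rw [← h2]
    rfl
  rw [h1, Spec.map_comp, ← Scheme.toSpecΓ_naturality_assoc, ← SpecMap_ΓSpecIso_hom,
    ← Spec.map_comp, Iso.inv_hom_id, Spec.map_id, Category.comp_id]

theorem sres_secMap {V W : X.Opens} (h : V ≤ W) (c : k) :
    sres X h (secMap sX W c) = secMap sX V c :=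
  LineBundle.sres_appLE sX (U := ⊤) le_top h ((Scheme.ΓSpecIso (CommRingCat.of k)).inv.hom c)

theorem appLE_secMap {φ : X ⟶ X} (hφ : φ ≫ sX = sX) {V W : X.Opens} (e : W ≤ φ ⁻¹ᵁ V) (c : k) :
    φ.appLE V W e (secMap sX V c) = secMap sX W c := by
  have h : sX.appLE ⊤ V le_top ≫ φ.appLE V W e = sX.appLE ⊤ W le_top :=
    (Scheme.Hom.appLE_comp_appLE ..).trans (by simp only [hφ])
  exact congrArg (fun f => f.hom ((Scheme.ΓSpecIso (CommRingCat.of k)).inv.hom c)) h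

theorem secMap_finiteType [LocallyOfFiniteType sX] {V : X.Opens} (hV : IsAffineOpen V) :
    (secMap sX V).FiniteType :=
  (LocallyOfFiniteType.finiteType_appLE (f := sX) (isAffineOpen_top _) hV le_top).comp
    (.of_surjective _ (ConcreteCategory.bijective_of_isIso
      (Scheme.ΓSpecIso (CommRingCat.of k)).inv).2)

end ProjectiveVariety

section FunctionFieldAlgebra

variable {k : Type u} [Field k] {X : Scheme.{u}} [IsIntegral X] (sX : X ⟶ Spec (CommRingCat.of k))

theorem genericPoint_mem_top : genericPoint X ∈ (⊤ : X.Opens) := trivial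

/-- The algebra structure on the function field is the one induced by the structure morphism. -/
def IsFunAlgebra [Algebra k X.functionField] : Prop :=
  ∀ c, algebraMap k X.functionField c = genGerm X ⊤ genericPoint_mem_top (secMap sX ⊤ c)

theorem exists_isFunAlgebra : ∃ _ : Algebra k X.functionField, IsFunAlgebra sX :=
  ⟨RingHom.toAlgebra ((genGerm X ⊤ genericPoint_mem_top).comp (secMap sX ⊤)), fun _ => rfl⟩

variable {sX} [Algebra k X.functionField]

theorem IsFunAlgebra.genGerm_secMap (hk : IsFunAlgebra sX) {V : X.Opens} (h : genericPoint X ∈ V)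
    (c : k) : genGerm X V h (secMap sX V c) = algebraMap k X.functionField c := by
  rw [hk, ← sres_secMap sX (le_top : V ≤ ⊤), genGerm_sres]

theorem exists_algHom_eq_funMap (hk : IsFunAlgebra sX) {φ : X ⟶ X} [IsDominant φ]
    (hφ : φ ≫ sX = sX) :
    ∃ f : X.functionField →ₐ[k] X.functionField, ∀ z, f z = funMap φ z :=
  ⟨{ funMap φ with
      commutes' := fun c => by
        change funMap φ (algebraMap k X.functionField c) = _
        rw [hk, funMap_genGerm φ (W := ⊤) _ genericPoint_mem_top le_top]
        exact congrArg _ (appLE_secMap sX hφ _ c) }, fun _ => rfl⟩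

theorem exists_finset_adjoin_genGerm (hk : IsFunAlgebra sX) [LocallyOfFiniteType sX] {V : X.Opens}
    (hV : IsAffineOpen V) (h : genericPoint X ∈ V) :
    ∃ c : Finset X.functionField, 0 ∉ c ∧
      (∀ a, genGerm X V h a ∈ Algebra.adjoin k (c : Set X.functionField)) ∧
      ∀ z ∈ Algebra.adjoin k (c : Set X.functionField), ∃ a, genGerm X V h a = z := by
  classical
  let := (secMap sX V).toAlgebra
  have hft : Algebra.FiniteType k Γ(X, V) := secMap_finiteType sX hV
  obtain ⟨S, hS⟩ := hft.1
  let f : Γ(X, V) →ₐ[k] X.functionField :=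
    { genGerm X V h with commutes' := fun c => hk.genGerm_secMap h c }
  have hadj : Algebra.adjoin k (((S.image f).erase 0 : Finset _) : Set X.functionField) =
      f.range := by
    rw [← Algebra.map_top, ← hS, AlgHom.map_adjoin]
    apply le_antisymm
    · exact Algebra.adjoin_mono (by simp)
    · refine Algebra.adjoin_le ?_
      rintro _ ⟨a, ha, rfl⟩
      by_cases h0 : f a = 0
      · rw [h0]
        exact zero_mem _
      · exact Algebra.subset_adjoin (by
          rw [Finset.coe_erase, Finset.coe_image]
          exact ⟨⟨a, ha, rfl⟩, h0⟩)
  refine ⟨(S.image f).erase 0, Finset.notMem_erase _ _, fun a => ?_, fun z hz => ?_⟩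
  · rw [hadj]
    exact ⟨a, rfl⟩
  · rw [hadj] at hz
    exact hz

theorem exists_denominator_of_affine {V : X.Opens} (hV : IsAffineOpen V) (h : genericPoint X ∈ V)
    (z : X.functionField) :
    ∃ a b, genGerm X V h b ≠ 0 ∧ genGerm X V h b * z = genGerm X V h a := by
  have : Nonempty V := ⟨⟨_, h⟩⟩
  have := functionField_isFractionRing_of_isAffineOpen X V hV
  obtain ⟨a, b, hb, rfl⟩ := IsFractionRing.div_surjective (A := Γ(X, V)) z
  have hb0 : genGerm X V h b ≠ 0 := fun h0 =>
    nonZeroDivisors.ne_zero hb (genGerm_injective h (h0.trans (map_zero _).symm))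
  exact ⟨a, b, hb0, mul_div_cancel₀ _ hb0⟩

theorem isIntegral_genGerm [X.IsSeparated] {φ : X ⟶ X} [IsDominant φ]
    {f : X.functionField →ₐ[k] X.functionField} (hf : ∀ z, f z = funMap φ z) {V W T : X.Opens}
    (hV : IsAffineOpen V) (hW : IsAffineOpen W) (hηV : genericPoint X ∈ V)
    (hηW : genericPoint X ∈ W) {c d : Set X.functionField}
    (hc : ∀ a, genGerm X V hηV a ∈ Algebra.adjoin k c)
    (hd : ∀ a, genGerm X W hηW a ∈ Algebra.adjoin k d)
    (hT : V ⊓ φ ⁻¹ᵁ W ≤ T) (hηT : genericPoint X ∈ T) (a : Γ(X, T)) :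
    _root_.IsIntegral (Algebra.adjoin k (c ∪ f '' d)) (genGerm X T hηT a) := by
  refine isIntegral_of_forall_valuationSubring _ _ fun O hO => ?_
  refine genGerm_mem_of_affine (φ := φ) hV hW hηV hηW (fun a => hO _ ?_) (fun a => hO _ ?_) hT hηT a
  · exact Algebra.adjoin_mono Set.subset_union_left (hc a)
  · rw [← hf]
    have h1 : f (genGerm X W hηW a) ∈ (Algebra.adjoin k d).map f := ⟨_, hd a, rfl⟩
    rw [AlgHom.map_adjoin] at h1
    exact Algebra.adjoin_mono Set.subset_union_right h1

theorem IsFunAlgebra.exists_isCenter (hk : IsFunAlgebra sX) [UniversallyClosed sX]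
    (O : ValuationSubring X.functionField) (hO : ∀ r, algebraMap k X.functionField r ∈ O) :
    ∃ l : Spec (CommRingCat.of O) ⟶ X, IsCenter l := by
  refine exists_isCenter_of_universallyClosed sX
    (Spec.map (CommRingCat.ofHom ((algebraMap k X.functionField).codRestrict O hO))) ?_
  have h1 : specSubring O ≫
      Spec.map (CommRingCat.ofHom ((algebraMap k X.functionField).codRestrict O hO)) =
      Spec.map (CommRingCat.ofHom (algebraMap k X.functionField)) :=
    (Spec.map_comp _ _).symm
  rw [h1]
  have h2 : (algebraMap k X.functionField) = (genGerm X ⊤ genericPoint_mem_top).comp (secMap sX ⊤) :=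
    RingHom.ext hk
  rw [h2]
  conv_rhs => rw [eq_toSpecΓ_secMap sX, Scheme.fromSpecStalk_toSpecΓ_assoc]
  exact Spec.map_comp _ _

end FunctionFieldAlgebra

section Polarization

variable {X : Scheme.{u}} [IsIntegral X]

theorem LineBundle.exists_affine_charts [CompactSpace X] (L : LineBundle X) :
    ∃ (n : ℕ) (V : Fin n → X.Opens) (i : Fin n → L.ι), (∀ α, IsAffineOpen (V α)) ∧
      (∀ α, V α ≤ L.U (i α)) ∧ (∀ α, genericPoint X ∈ V α) ∧ ∀ x, ∃ α, x ∈ V α := by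
  have h1 (x : X) : ∃ (V : X.Opens) (i : L.ι), IsAffineOpen V ∧ V ≤ L.U i ∧ x ∈ V := by
    have hx : x ∈ iSup L.U := by
      rw [L.covers]
      exact TopologicalSpace.Opens.mem_top x
    obtain ⟨i, hi⟩ := TopologicalSpace.Opens.mem_iSup.1 hx
    obtain ⟨_, ⟨V, hV, rfl⟩, hxV, hle⟩ := X.isBasis_affineOpens.exists_subset_of_mem_open hi
      (L.U i).isOpen
    exact ⟨V, i, hV, hle, hxV⟩
  choose V i hV hle hmem using h1
  obtain ⟨s, hs⟩ := isCompact_univ.elim_finite_subcover (fun x => (V x : Set X))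
    (fun x => (V x).isOpen) fun x _ => Set.mem_iUnion.2 ⟨x, hmem x⟩
  let e := s.equivFin
  refine ⟨s.card, fun α => V (e.symm α), fun α => i (e.symm α), fun α => hV _, fun α => hle _,
    fun α => genericPoint_mem (hmem (e.symm α)), fun x => ?_⟩
  obtain ⟨y, hy⟩ := Set.mem_iUnion.1 (hs (Set.mem_univ x))
  obtain ⟨hys, hxy⟩ := Set.mem_iUnion.1 hy
  exact ⟨e ⟨y, hys⟩, by simpa using hxy⟩

variable {φ : X ⟶ X} [IsDominant φ]

theorem genericPoint_mem_preimage {V : X.Opens} (h : genericPoint X ∈ V) :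
    genericPoint X ∈ φ ⁻¹ᵁ V := by
  change φ (genericPoint X) ∈ V
  rwa [map_genericPoint_of_isDominant]

/-- The cocycle of a line bundle as rational functions. -/
def LineBundle.ratCocycle (L : LineBundle X) {i j : L.ι} (hi : genericPoint X ∈ L.U i)
    (hj : genericPoint X ∈ L.U j) : X.functionField :=
  genGerm X (L.U i ⊓ L.U j) ⟨hi, hj⟩ (L.t i j)

theorem LineBundle.ratCocycle_ne_zero (L : LineBundle X) {i j : L.ι} (hi : genericPoint X ∈ L.U i)
    (hj : genericPoint X ∈ L.U j) : L.ratCocycle hi hj ≠ 0 :=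
  ((L.t i j).isUnit.map (genGerm X _ _)).ne_zero

/-- The local sections of a global section, as rational functions. -/
def LineBundle.GlobalSec.rat {L : LineBundle X} (σ : L.GlobalSec) {i : L.ι}
    (hi : genericPoint X ∈ L.U i) : X.functionField :=
  genGerm X (L.U i) hi (σ.s i)

theorem LineBundle.GlobalSec.rat_eq {L : LineBundle X} (σ : L.GlobalSec) {i j : L.ι}
    (hi : genericPoint X ∈ L.U i) (hj : genericPoint X ∈ L.U j) :
    σ.rat hi = L.ratCocycle hi hj * σ.rat hj := by
  have h := congrArg (genGerm X (L.U i ⊓ L.U j) ⟨hi, hj⟩) (σ.compat i j)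
  rw [map_mul] at h
  exact (genGerm_sres inf_le_left _ _).symm.trans (h.trans
    (congrArg (L.ratCocycle hi hj * ·) (genGerm_sres inf_le_right _ _)))

theorem LineBundle.GlobalSec.rat_ne_zero {L : LineBundle X} (σ : L.GlobalSec) {i : L.ι}
    (hi : genericPoint X ∈ L.U i) (hσ : genericPoint X ∈ σ.locus) : σ.rat hi ≠ 0 := by
  obtain ⟨j, hj⟩ := TopologicalSpace.Opens.mem_iSup.1 hσ
  have hj' : genericPoint X ∈ L.U j := X.basicOpen_le _ hj
  have h := (Scheme.mem_basicOpen _ _ _ hj').1 hj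
  rw [σ.rat_eq hi hj']
  have : σ.rat hj' ≠ 0 := IsUnit.ne_zero h
  exact mul_ne_zero (L.ratCocycle_ne_zero hi hj') this

theorem LineBundle.ratCocycle_pow (L : LineBundle X) (m : ℕ) {i j : L.ι}
    (hi : genericPoint X ∈ L.U i) (hj : genericPoint X ∈ L.U j) :
    LineBundle.ratCocycle (L.pow m) (i := i) (j := j) hi hj = L.ratCocycle hi hj ^ m :=
  (congrArg (genGerm X (L.U i ⊓ L.U j) ⟨hi, hj⟩) (Units.val_pow_eq_pow_val _ _)).trans
    (map_pow _ _ _)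

theorem LineBundle.ratCocycle_dual (L : LineBundle X) {i j : L.ι}
    (hi : genericPoint X ∈ L.U i) (hj : genericPoint X ∈ L.U j) :
    LineBundle.ratCocycle L.dual (i := i) (j := j) hi hj = (L.ratCocycle hi hj)⁻¹ :=
  map_units_inv (genGerm X (L.U i ⊓ L.U j) ⟨hi, hj⟩) (L.t i j)

theorem LineBundle.ratCocycle_tensor (L M : LineBundle X) {i j : L.ι} {p q : M.ι}
    (hi : genericPoint X ∈ L.U i) (hj : genericPoint X ∈ L.U j)
    (hp : genericPoint X ∈ M.U p) (hq : genericPoint X ∈ M.U q) :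
    LineBundle.ratCocycle (L.tensor M) (i := (i, p)) (j := (j, q)) ⟨hi, hp⟩ ⟨hj, hq⟩ =
      L.ratCocycle hi hj * M.ratCocycle hp hq :=
  (map_mul (genGerm X _ _) _ _).trans (congrArg₂ (· * ·) (genGerm_sres _ _ _)
    (genGerm_sres _ _ _))

theorem LineBundle.ratCocycle_pullbackLB (L : LineBundle X) {i j : L.ι}
    (hi : genericPoint X ∈ L.U i) (hj : genericPoint X ∈ L.U j) :
    LineBundle.ratCocycle (pullbackLB φ L) (i := i) (j := j) (genericPoint_mem_preimage hi)
      (genericPoint_mem_preimage hj) = funMap φ (L.ratCocycle hi hj) :=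
  (funMap_genGerm φ _ _ _ _).symm

theorem LineBundle.ratCocycle_pullback_tensor_dual (L : LineBundle X) (m : ℕ) {p q r : L.ι}
    (hp : genericPoint X ∈ L.U p) (hq : genericPoint X ∈ L.U q) (hr : genericPoint X ∈ L.U r) :
    LineBundle.ratCocycle (((pullbackLB φ L).tensor L.dual).pow m) (i := (p, q)) (j := (r, r))
      ⟨genericPoint_mem_preimage hp, hq⟩ ⟨genericPoint_mem_preimage hr, hr⟩ =
      funMap φ (L.ratCocycle hp hr) ^ m * (L.ratCocycle hq hr)⁻¹ ^ m := by
  have h1 := LineBundle.ratCocycle_pow ((pullbackLB φ L).tensor L.dual) m (i := (p, q))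
    (j := (r, r)) ⟨genericPoint_mem_preimage hp, hq⟩ ⟨genericPoint_mem_preimage hr, hr⟩
  have h2 := LineBundle.ratCocycle_tensor (pullbackLB φ L) L.dual (genericPoint_mem_preimage hp)
    (genericPoint_mem_preimage hr) (p := q) (q := r) hq hr
  rw [← mul_pow, ← L.ratCocycle_dual, ← L.ratCocycle_pullbackLB]
  exact h1.trans (congrArg (· ^ m) h2)

end Polarization

section PolarSystemOfAmple

open Filter

theorem noetherianSpace_of_isProper {k : Type u} [Field k] {X : Scheme.{u}} (sX : X ⟶ Spec (CommRingCat.of k)) [IsProper sX]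
    [CompactSpace X] : TopologicalSpace.NoetherianSpace X := by
  have := LocallyOfFiniteType.isLocallyNoetherian sX
  have : AlgebraicGeometry.IsNoetherian X := {}
  infer_instance

theorem isSeparated_of_isProper {k : Type u} [Field k] {X : Scheme.{u}} (sX : X ⟶ Spec (CommRingCat.of k)) [IsProper sX] :
    X.IsSeparated := by
  have : AlgebraicGeometry.IsSeparated (terminal.from X) := by
    rw [← terminal.comp_from sX]
    infer_instance
  exact ⟨this⟩

variable {X : Scheme.{u}} [IsIntegral X]

theorem eventually_exists_genGerm_eq_mul_pow [TopologicalSpace.NoetherianSpace X] [X.IsSeparated]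
    {T W : X.Opens} (s : Γ(X, T)) (hle : X.basicOpen s ≤ W) (hT : genericPoint X ∈ T)
    (hη : genericPoint X ∈ X.basicOpen s) (hW : genericPoint X ∈ W) (a : Γ(X, W)) :
    ∀ᶠ n in atTop, ∃ y, genGerm X T hT y = genGerm X W hW a * genGerm X T hT s ^ n := by
  obtain ⟨n, y, hy⟩ := exists_eq_pow_mul_of_isCompact_of_isQuasiSeparated X T
    (TopologicalSpace.NoetherianSpace.isCompact _) (.of_quasiSeparatedSpace _) s (sres X hle a)
  have h1 : genGerm X T hT y = genGerm X T hT s ^ n * genGerm X W hW a := by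
    have h2 : sres X (X.basicOpen_le s) y = sres X (X.basicOpen_le s) s ^ n * sres X hle a := hy
    have h3 := congrArg (genGerm X (X.basicOpen s) hη) h2
    rw [map_mul, map_pow] at h3
    rwa [genGerm_sres, genGerm_sres, genGerm_sres] at h3
  filter_upwards [eventually_ge_atTop n] with N hN
  refine ⟨s ^ (N - n) * y, ?_⟩
  rw [map_mul, map_pow, h1, ← mul_assoc, ← pow_add, Nat.sub_add_cancel hN, mul_comm]

variable {k : Type u} [Field k] {sX : X ⟶ Spec (CommRingCat.of k)}

theorem LineBundle.IsAmple.nonempty_polarSystem [IsProper sX] {φ : X ⟶ X} [IsDominant φ]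
    {L : LineBundle X} (hL : ((pullbackLB φ L).tensor L.dual).IsAmple)
    [Algebra k X.functionField] (hk : IsFunAlgebra sX)
    {f : X.functionField →ₐ[k] X.functionField} (hf : ∀ z, f z = funMap φ z) :
    Nonempty (PolarSystem f) := by
  classical
  obtain ⟨hcpt, hample⟩ := hL
  have := noetherianSpace_of_isProper sX
  have := isSeparated_of_isProper sX
  obtain ⟨N, V, i, hV, hle, hη, hcov⟩ := L.exists_affine_charts
  have hi (α) : genericPoint X ∈ L.U (i α) := hle α (hη α)
  obtain ⟨m, -, σ, hσ, hW⟩ := hample (genericPoint X)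
  obtain ⟨α₀, -⟩ := hcov (genericPoint X)
  let r := i α₀
  have hr : genericPoint X ∈ L.U r := hi α₀
  choose c hc0 hc hc' using fun α => exists_finset_adjoin_genGerm hk (hV α) (hη α)
  obtain ⟨e, -, he, he'⟩ := exists_finset_adjoin_genGerm hk hW hσ
  let t (α) : X.functionField := L.ratCocycle (hi α) hr
  let g : X.functionField := σ.rat (i := (r, r)) ⟨genericPoint_mem_preimage hr, hr⟩
  let T (α β) : X.Opens := φ ⁻¹ᵁ L.U (i β) ⊓ L.U (i α)
  have hT (α β) : genericPoint X ∈ T α β := ⟨genericPoint_mem_preimage (hi β), hi α⟩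
  let s (α β) : Γ(X, T α β) := σ.s (i β, i α)
  have hs (α β) : genGerm X (T α β) (hT α β) (s α β) = f (t β) ^ m * (t α)⁻¹ ^ m * g := by
    have h1 := σ.rat_eq (i := (i β, i α)) (j := (r, r)) (hT α β)
      ⟨genericPoint_mem_preimage hr, hr⟩
    rw [hf]
    exact h1.trans (congrArg (· * g) (L.ratCocycle_pullback_tensor_dual m (hi β) (hi α) hr))
  have hbas (α β) : X.basicOpen (s α β) ≤ σ.locus := le_iSup (fun j => X.basicOpen (σ.s j)) (i β, i α)
  have hbη (α β) : genericPoint X ∈ X.basicOpen (s α β) := by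
    refine (Scheme.mem_basicOpen _ _ _ (hT α β)).2 (IsUnit.mk0 _ ?_)
    exact σ.rat_ne_zero (i := (i β, i α)) (hT α β) hσ
  have hint (α β) (a : Γ(X, T α β)) : _root_.IsIntegral
      (Algebra.adjoin k ((c α : Set X.functionField) ∪ f '' c β))
      (genGerm X (T α β) (hT α β) a) :=
    isIntegral_genGerm hf (hV α) (hV β) (hη α) (hη β) (hc α) (hc β)
      (fun x hx => show x ∈ φ ⁻¹ᵁ L.U (i β) ⊓ L.U (i α) from ⟨hle β hx.2, hle α hx.1⟩) _ a
  have hn : ∀ᶠ n in atTop, ∀ α β, ∀ l ∈ e,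
      ∃ y, genGerm X (T α β) (hT α β) y = l * genGerm X (T α β) (hT α β) (s α β) ^ n := by
    refine eventually_all.2 fun α => eventually_all.2 fun β => (Finset.eventually_all e).2
      fun l hl => ?_
    obtain ⟨a, rfl⟩ := he' l (Algebra.subset_adjoin hl)
    exact eventually_exists_genGerm_eq_mul_pow (s α β) (hbas α β) _ (hbη α β) _ a
  obtain ⟨n, hn⟩ := hn.exists
  exact ⟨{
    ι := Fin N
    finite := inferInstance
    c := c
    c_ne := hc0
    chart := fun O hO => by
      obtain ⟨l, hl⟩ := hk.exists_isCenter O hO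
      obtain ⟨α, hα⟩ := hcov (l (IsLocalRing.closedPoint O))
      refine ⟨α, fun z hz => ?_⟩
      obtain ⟨a, rfl⟩ := hc' α z (Algebra.subset_adjoin hz)
      exact hl.genGerm_mem hα (hη α) a
    t := t
    t_ne := fun α => L.ratCocycle_ne_zero _ _
    g := g
    g_ne := σ.rat_ne_zero (i := (r, r)) _ hσ
    e := e
    frac := fun z => by
      obtain ⟨a, b, hb, h⟩ := exists_denominator_of_affine hW hσ z
      refine ⟨_, he b, hb, ?_⟩
      rw [h]
      exact he a
    m := m
    n := n
    int := fun α β => by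
      rw [← hs]
      exact hint α β _
    int_e := fun α β l hl => by
      obtain ⟨y, hy⟩ := hn α β l hl
      rw [← hs, ← hy]
      exact hint α β y }⟩

end PolarSystemOfAmple

section RationalPoints

variable {k : Type u} [Field k] {X : Scheme.{u}}

/-- The `k`-valued point given by a ring homomorphism on an affine open. -/
def affinePoint {V : X.Opens} (hV : IsAffineOpen V) (ψ : Γ(X, V) →+* k) :
    Spec (CommRingCat.of k) ⟶ X :=
  Spec.map (CommRingCat.ofHom ψ) ≫ hV.fromSpec

theorem affinePoint_mem {V : X.Opens} (hV : IsAffineOpen V) (ψ : Γ(X, V) →+* k)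
    (y : Spec (CommRingCat.of k)) : affinePoint hV ψ y ∈ V := by
  have : affinePoint hV ψ y ∈ Set.range hV.fromSpec := ⟨Spec.map (CommRingCat.ofHom ψ) y, rfl⟩
  rwa [hV.range_fromSpec] at this

theorem affinePoint_comp {φ : X ⟶ X} {U V : X.Opens} (hU : IsAffineOpen U) (hV : IsAffineOpen V)
    (hle : V ≤ U) (e : V ≤ φ ⁻¹ᵁ U) {ψ ψ' : Γ(X, V) →+* k}
    (h : ∀ b, ψ (φ.appLE U V e b) = ψ' (sres X hle b)) :
    affinePoint hV ψ ≫ φ = affinePoint hV ψ' := by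
  have h1 : φ.appLE U V e ≫ CommRingCat.ofHom ψ =
      X.presheaf.map (homOfLE hle).op ≫ CommRingCat.ofHom ψ' := by
    ext b
    exact h b
  rw [affinePoint, affinePoint, Category.assoc, ← hU.SpecMap_appLE_fromSpec φ hV e,
    ← hU.map_fromSpec hV (homOfLE hle).op, ← Spec.map_comp_assoc, ← Spec.map_comp_assoc, h1]

theorem affinePoint_comp_structure (sX : X ⟶ Spec (CommRingCat.of k)) {V : X.Opens}
    (hV : IsAffineOpen V) {ψ : Γ(X, V) →+* k} (h : ∀ c, ψ (secMap sX V c) = c) :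
    affinePoint hV ψ ≫ sX = 𝟙 _ := by
  have h1 : CommRingCat.ofHom (secMap sX ⊤) ≫ X.presheaf.map (homOfLE le_top).op ≫
      CommRingCat.ofHom ψ = 𝟙 (CommRingCat.of k) := by
    ext c
    exact (congrArg ψ (sres_secMap sX le_top c)).trans (h c)
  rw [eq_toSpecΓ_secMap sX, affinePoint, Category.assoc, hV.fromSpec_toSpecΓ_assoc,
    ← Spec.map_comp, ← Spec.map_comp, Category.assoc, h1, Spec.map_id]

theorem isClosed_singleton_of_section (sX : X ⟶ Spec (CommRingCat.of k)) [IsSeparated sX]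
    {q : Spec (CommRingCat.of k) ⟶ X} (hq : q ≫ sX = 𝟙 _) (y : Spec (CommRingCat.of k)) :
    IsClosed {q y} := by
  have : IsClosedImmersion (q ≫ sX) := by
    rw [hq]
    infer_instance
  have : IsClosedImmersion q := IsClosedImmersion.of_comp q sX
  have h := q.isClosedEmbedding.isClosedMap {y} (isClosed_discrete _)
  rwa [Set.image_singleton] at h

theorem comp_morphIter {S : Scheme.{u}} {φ : X ⟶ X} (q : ℕ → (S ⟶ X))
    (hq : ∀ i, q i ≫ φ = q (i + 1)) (n : ℕ) : q 0 ≫ morphIter φ n = q n := by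
  induction n with
  | zero => exact Category.comp_id _
  | succ n ih =>
    change q 0 ≫ morphIter φ n ≫ φ = _
    rw [← Category.assoc, ih, hq]

/-- A dominant self-map whose function field carries a polar system has a closed periodic point in
every nonempty open set. -/
theorem dense_periodic_of_polarSystem [IsAlgClosed k] [IsIntegral X]
    {sX : X ⟶ Spec (CommRingCat.of k)} [IsProper sX] {φ : X ⟶ X} [IsDominant φ]
    [Algebra k X.functionField] (hk : IsFunAlgebra sX)
    {f : X.functionField →ₐ[k] X.functionField} (hf : ∀ z, f z = funMap φ z) (S : PolarSystem f) :
    Dense {x : X | (∃ m : ℕ, 0 < m ∧ (morphIter φ m).base x = x) ∧ IsClosed ({x} : Set X)} := by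
  refine dense_iff_inter_open.2 fun O hO ⟨x₀, hx₀⟩ => ?_
  have hηO : genericPoint X ∈ (⟨O, hO⟩ : X.Opens) := genericPoint_mem (x := x₀) hx₀
  obtain ⟨_, ⟨U, hU, rfl⟩, hηU, hUO⟩ := X.isBasis_affineOpens.exists_subset_of_mem_open hηO hO
  have hηU' : genericPoint X ∈ U ⊓ φ ⁻¹ᵁ U := ⟨hηU, genericPoint_mem_preimage hηU⟩
  obtain ⟨_, ⟨V, hV, rfl⟩, hη, hVU⟩ := X.isBasis_affineOpens.exists_subset_of_mem_open hηU'
    (U ⊓ φ ⁻¹ᵁ U).isOpen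
  have hle : V ≤ U := fun x hx => (hVU hx).1
  have hle' : V ≤ φ ⁻¹ᵁ U := fun x hx => (hVU hx).2
  obtain ⟨Z, -, hZ, -⟩ := exists_finset_adjoin_genGerm hk hV hη
  obtain ⟨N, hN, χ, hχ, hper⟩ := S.exists_periodic Z
  obtain ⟨ψ, hψ⟩ : ∃ ψ : ℕ → Γ(X, V) →+* k, ∀ i a, ψ i a = χ i ⟨genGerm X V hη a, hZ a⟩ :=
    ⟨fun i => (χ i : _ →+* k).comp ((genGerm X V hη).codRestrict _ hZ), fun _ _ => rfl⟩
  let q (i : ℕ) : Spec (CommRingCat.of k) ⟶ X := affinePoint hV (ψ i)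
  have hq (i : ℕ) : q i ≫ φ = q (i + 1) := by
    refine affinePoint_comp hU hV hle hle' fun b => ?_
    rw [hψ, hψ]
    refine (hχ i _ _ ?_).symm
    change genGerm X V hη (φ.appLE U V hle' b) = f (genGerm X V hη (sres X hle b))
    rw [hf, genGerm_sres]
    exact (funMap_genGerm φ _ _ _ _).symm
  have hq0 : q 0 ≫ sX = 𝟙 _ := affinePoint_comp_structure sX hV fun c => by
    refine (hψ _ _).trans (Eq.trans ?_ ((χ 0).commutes c))
    exact congrArg (χ 0) (Subtype.ext (hk.genGerm_secMap hη c))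
  have hqN : q 0 ≫ morphIter φ N = q 0 := by
    rw [comp_morphIter q hq]
    refine congrArg (affinePoint hV) (RingHom.ext fun a => ?_)
    rw [hψ, hψ, ← hper 0, zero_add]
  let y : Spec (CommRingCat.of k) := IsLocalRing.closedPoint k
  refine ⟨q 0 y, hUO (hle (affinePoint_mem hV _ y)), ⟨N, hN, ?_⟩,
    isClosed_singleton_of_section sX hq0 y⟩
  exact congrArg (fun g : Spec (CommRingCat.of k) ⟶ X => g y) hqN

end RationalPoints

/-- Let `X` be a projective variety over an algebraically closed field `k`,
`φ : X → X` a dominant morphism and `L` a line bundle on `X` such that `φ*(L) ⊗ L⁻¹` is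
ample. Then the set of periodic points of `φ` in `X(k)` (= the closed points of `X`) is
Zariski dense in `X`. -/
theorem stmt_15 {k : Type u} [Field k] [IsAlgClosed k] {X : Scheme.{u}}
    (sX : X ⟶ Spec (CommRingCat.of k)) (hX : IsProjectiveVariety sX)
    (φ : X ⟶ X) (hφ : φ ≫ sX = sX) (hdom : IsDominant φ)
    (L : LineBundle X)
    (hL : ((LineBundle.pullbackLB φ L).tensor L.dual).IsAmple) :
    Dense {x : X | (∃ m : ℕ, 0 < m ∧ (morphIter φ m).base x = x) ∧ IsClosed ({x} : Set X)} := by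
  have := hX.1
  have := hX.isProper
  obtain ⟨_, hk⟩ := exists_isFunAlgebra sX
  obtain ⟨f, hf⟩ := exists_algHom_eq_funMap hk hφ
  obtain ⟨S⟩ := hL.nonempty_polarSystem hk hf
  exact dense_periodic_of_polarSystem hk hf S
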